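/- arXiv:1107.1094 — 3 statements merged into one kernel-verified Lean document; each statement's English description precedes it below -/
import Mathlib

section
/- Let ν be a probability measure on SL(2,ℝ) with ∫ log ‖M‖ dν(M) < ∞ whose smallest closed subgroup G_ν containing supp ν is not compact and admits no finite non-empty invariant subset of ℙ¹(ℝ), and let m be a ν-invariant probability measure on ℙ¹(ℝ). Then there is γ ∈ ℝ such that for ν^{ℕ}-almost every sequence (T_1, T_2, …), (1/n) log ‖T_n ⋯ T_1‖ → γ, and moreover γ = ∫∫ log( ‖M v̂‖ / ‖v̂‖ ) dν(M) dm(v), where v̂ ∈ ℝ² \ {0} is any representative of v ∈ ℙ¹(ℝ) (the integrand is independent of the choice of representative). -/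
open MeasureTheory Filter

noncomputable section

/-- The group `SL(2,ℝ)`. -/
abbrev SL2 := Matrix.SpecialLinearGroup (Fin 2) ℝ

instance : TopologicalSpace SL2 := instTopologicalSpaceSubtype
instance : MeasurableSpace SL2 := borel SL2

/-- The real projective line `ℙ¹(ℝ)`, the projectivization of `ℝ² \ {0}`. -/
abbrev P1 := Projectivization ℝ (EuclideanSpace ℝ (Fin 2))

instance : TopologicalSpace P1 := instTopologicalSpaceQuotient
instance : MeasurableSpace P1 := borel P1

/-- The operator (Euclidean) norm of a real 2×2 matrix. -/
def opNorm (M : Matrix (Fin 2) (Fin 2) ℝ) : ℝ := ‖Matrix.toEuclideanCLM (𝕜 := ℝ) M‖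

lemma sl2_inj (M : SL2) :
    Function.Injective (Matrix.toEuclideanCLM (𝕜 := ℝ) (M : Matrix (Fin 2) (Fin 2) ℝ)) := by
  intro x y h
  have h2 := congrArg (fun v => Matrix.toEuclideanCLM (𝕜 := ℝ)
    ((M⁻¹ : SL2) : Matrix (Fin 2) (Fin 2) ℝ) v) h
  simpa [← ContinuousLinearMap.comp_apply, ← ContinuousLinearMap.mul_def, ← map_mul,
    Matrix.SpecialLinearGroup.coe_inv, Matrix.adjugate_mul, M.prop, one_smul] using h2

/-- The induced action of `M ∈ SL(2,ℝ)` on the real projective line. -/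
def projAct (M : SL2) (x : P1) : P1 :=
  Projectivization.map
    ((Matrix.toEuclideanCLM (𝕜 := ℝ) (M : Matrix (Fin 2) (Fin 2) ℝ)) : _ →ₗ[ℝ] _)
    (sl2_inj M) x

/-- The topological support of a measure. -/
def msupp {X : Type*} [TopologicalSpace X] [MeasurableSpace X] (ν : Measure X) : Set X :=
  {x | ∀ U ∈ nhds x, ν U ≠ 0}

/-- The smallest closed subgroup of `SL(2,ℝ)` containing the support of `ν`: the topological
closure of the subgroup generated by `supp ν`. -/
def Gnu (ν : Measure SL2) : Set SL2 := closure (Subgroup.closure (msupp ν) : Set SL2)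

/-- The ordered product `T n * ⋯ * T 1` (the value `T 0` is unused). -/
def Pprod (T : ℕ → SL2) : ℕ → SL2
  | 0 => 1
  | n + 1 => T (n + 1) * Pprod T n


set_option linter.unusedSectionVars false



namespace Fk

/-- shift by `k` -/
def sh {X : Type*} (k : ℕ) (T : ℕ → X) : ℕ → X := fun i => T (k + i)

/-- prepend a letter -/
def cons {X : Type*} (x : X) (T : ℕ → X) : ℕ → X
  | 0 => x
  | n + 1 => T n

lemma sh_sh {X : Type*} (k l : ℕ) (T : ℕ → X) : sh k (sh l T) = sh (l + k) T := by
  funext i; simp [sh, add_assoc]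

lemma sh_zero {X : Type*} (T : ℕ → X) : sh 0 T = T := by
  funext i; simp [sh]

lemma measurable_sh {X : Type*} [MeasurableSpace X] (k : ℕ) :
    Measurable (sh k : (ℕ → X) → (ℕ → X)) := by
  unfold sh; fun_prop

lemma measurable_cons {X : Type*} [MeasurableSpace X] :
    Measurable (fun p : X × (ℕ → X) => cons p.1 p.2) := by
  rw [measurable_pi_iff]
  intro n
  cases n with
  | zero => exact measurable_fst
  | succ n => exact (measurable_pi_apply n).comp measurable_snd

variable {X : Type*} [MeasurableSpace X] (ν : Measure X) [IsProbabilityMeasure ν]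

/-- iid measure -/
abbrev iid : Measure (ℕ → X) := Measure.infinitePi (fun _ : ℕ => ν)

lemma mp_sh (k : ℕ) : MeasurePreserving (sh k) (iid ν) (iid ν) := by
  refine ⟨measurable_sh k, ?_⟩
  apply Measure.eq_infinitePi
  intro s t ht
  rw [Measure.map_apply (measurable_sh k)
    (MeasurableSet.pi s.countable_toSet (fun i _ => ht i))]
  have : sh k ⁻¹' (Set.pi (s : Set ℕ) t)
      = Set.pi ((s.map (addLeftEmbedding k) : Finset ℕ) : Set ℕ) (fun i => t (i - k)) := by
    ext T
    simp only [sh, Set.mem_pi, Set.mem_preimage, Finset.coe_map, Set.mem_image, Finset.mem_coe,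
      forall_exists_index, and_imp, forall_apply_eq_imp_iff₂, addLeftEmbedding_apply]
    refine forall₂_congr fun i _ => ?_
    rw [Nat.add_sub_cancel_left]
  rw [this, Measure.infinitePi_pi]
  · rw [Finset.prod_map]
    refine Finset.prod_congr rfl fun i _ => ?_
    rw [addLeftEmbedding_apply, Nat.add_sub_cancel_left]
  · intro i _; exact ht _

lemma mp_cons : MeasurePreserving (fun p : X × (ℕ → X) => cons p.1 p.2)
    (ν.prod (iid ν)) (iid ν) := by
  refine ⟨measurable_cons, ?_⟩
  apply Measure.eq_infinitePi
  intro s t ht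
  rw [Measure.map_apply measurable_cons
    (MeasurableSet.pi s.countable_toSet (fun i _ => ht i))]
  classical
  have : (fun p : X × (ℕ → X) => cons p.1 p.2) ⁻¹' (Set.pi (s : Set ℕ) t)
      = (if 0 ∈ s then t 0 else Set.univ) ×ˢ
        Set.pi ((s.preimage Nat.succ (Nat.succ_injective.injOn) : Finset ℕ) : Set ℕ)
          (fun i => t (i+1)) := by
    ext ⟨x, T⟩
    simp only [Set.mem_preimage, Set.mem_pi, Set.mem_prod, Finset.mem_coe, Finset.mem_preimage]
    constructor
    · intro h
      refine ⟨?_, fun i hi => h (i+1) hi⟩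
      split_ifs with h0
      · exact h 0 h0
      · trivial
    · rintro ⟨h1, h2⟩ i hi
      cases i with
      | zero =>
        rw [if_pos hi] at h1
        exact h1
      | succ i => exact h2 i hi
  rw [this, Measure.prod_prod, Measure.infinitePi_pi _ (fun i _ => ht _)]
  have h2 : ∏ i ∈ s.preimage Nat.succ (Nat.succ_injective.injOn), ν (t (i+1))
      = ∏ i ∈ s.erase 0, ν (t i) := by
    refine Finset.prod_bij (fun i _ => i + 1) ?_ ?_ ?_ ?_
    · intro i hi; simpa using hi
    · intro i _ j _ h; omega
    · intro j hj
      obtain ⟨h1, h2⟩ := Finset.mem_erase.1 hj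
      exact ⟨j - 1, by simpa [Nat.sub_add_cancel (Nat.pos_of_ne_zero h1)] using h2, by omega⟩
    · intro i _; rfl
  rw [h2]
  split_ifs with h0
  · rw [Finset.mul_prod_erase s (fun i => ν (t i)) h0]
  · rw [Finset.erase_eq_of_notMem h0]; simp

/-- Deterministic block decomposition. -/
lemma steele (g : ℕ → ℕ → ℝ) (Y : ℕ → ℝ) (hY : ∀ k, 0 ≤ Y k) (c : ℝ) (hc : 0 ≤ c)
    (hsub : ∀ k l n, k ≤ l → l ≤ n → g k n ≤ g k l + g l n)
    (h1 : ∀ k, g k (k+1) ≤ Y k) (h0 : ∀ k, g k k ≤ 0) (N : ℕ) (bad : ℕ → Prop)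
    [DecidablePred bad]
    (hgood : ∀ k, ¬ bad k → ∃ l, 1 ≤ l ∧ l ≤ N ∧ g k (k + l) ≤ l * c) (d : ℕ) :
    ∀ k, g k (k + d) ≤ d * c + ∑ j ∈ Finset.Ico k (k+d), (if bad j then Y j else 0)
      + ∑ j ∈ Finset.Ico k (k+d), (if k + d ≤ j + N then Y j else 0) := by
  induction d using Nat.strong_induction_on with
  | _ d ih =>
  intro k
  have nn1 : ∀ j, 0 ≤ (if bad j then Y j else 0) := by
    intro j; split_ifs; exacts [hY j, le_rfl]
  have nn2 : ∀ m j, 0 ≤ (if m ≤ j + N then Y j else 0) := by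
    intro m j; split_ifs; exacts [hY j, le_rfl]
  rcases Nat.eq_zero_or_pos d with rfl | hd
  · simpa using h0 k
  by_cases hb : bad k
  · have e := ih (d-1) (by omega) (k+1)
    have ek : k + 1 + (d - 1) = k + d := by omega
    rw [ek] at e
    have hs := hsub k (k+1) (k+d) (by omega) (by omega)
    rw [Finset.sum_eq_sum_Ico_succ_bot (by omega : k < k + d),
      Finset.sum_eq_sum_Ico_succ_bot (by omega : k < k + d)]
    rw [if_pos hb]
    have := nn2 (k+d) k
    have h1k := h1 k
    have : ((d - 1 : ℕ) : ℝ) * c ≤ d * c := by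
      gcongr; omega
    linarith
  · obtain ⟨l, hl1, hlN, hl⟩ := hgood k hb
    by_cases hld : l ≤ d
    · have e := ih (d-l) (by omega) (k+l)
      have ek : k + l + (d - l) = k + d := by omega
      rw [ek] at e
      have hs := hsub k (k+l) (k+d) (by omega) (by omega)
      rw [← Finset.sum_Ico_consecutive _ (by omega : k ≤ k + l) (by omega : k + l ≤ k + d),
        ← Finset.sum_Ico_consecutive _ (by omega : k ≤ k + l) (by omega : k + l ≤ k + d)]
      have a1 := Finset.sum_nonneg (s := Finset.Ico k (k+l)) (fun j _ => nn1 j)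
      have a2 := Finset.sum_nonneg (s := Finset.Ico k (k+l)) (fun j _ => nn2 (k+d) j)
      have : ((d - l : ℕ) : ℝ) * c = d * c - l * c := by
        rw [Nat.cast_sub hld]; ring
      linarith
    · have e := ih (d-1) (by omega) (k+1)
      have ek : k + 1 + (d - 1) = k + d := by omega
      rw [ek] at e
      have hs := hsub k (k+1) (k+d) (by omega) (by omega)
      rw [Finset.sum_eq_sum_Ico_succ_bot (by omega : k < k + d),
        Finset.sum_eq_sum_Ico_succ_bot (by omega : k < k + d)]
      rw [if_neg hb, if_pos (by omega : k + d ≤ k + N)]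
      have h1k := h1 k
      have : ((d - 1 : ℕ) : ℝ) * c ≤ d * c := by
        gcongr; omega
      linarith

/-- strong law for a function of finitely many coordinates, along disjoint blocks -/
lemma slln_block (p : ℕ) (G : (ℕ → X) → ℝ) (hG : Measurable G)
    (hdep : ∀ T T' : ℕ → X, (∀ i < p, T i = T' i) → G T = G T')
    (hint : Integrable G (iid ν)) :
    (Pairwise fun i j => ProbabilityTheory.IndepFun (fun T : ℕ → X => G (sh (p * i) T))
        (fun T : ℕ → X => G (sh (p * j) T)) (iid ν)) ∧
    (∀ i, ProbabilityTheory.IdentDistrib (fun T : ℕ → X => G (sh (p * i) T))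
        (fun T : ℕ → X => G (sh (p * 0) T)) (iid ν) (iid ν)) ∧
    ∀ᵐ T ∂(iid ν), Tendsto (fun n : ℕ => (∑ i ∈ Finset.range n, G (sh (p * i) T)) / n)
      atTop (nhds (∫ T, G T ∂(iid ν))) := by
  have hind : Pairwise fun i j => ProbabilityTheory.IndepFun (fun T : ℕ → X => G (sh (p * i) T))
        (fun T : ℕ → X => G (sh (p * j) T)) (iid ν) := by
    intro i j hij
    have hii : ProbabilityTheory.iIndepFun (fun (i : ℕ) (T : ℕ → X) => T i) (iid ν) := by
      have := ProbabilityTheory.iIndepFun_infinitePi (P := fun _ : ℕ => ν)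
        (X := fun _ : ℕ => (id : X → X)) (fun _ => measurable_id)
      simpa using this
    let S : ℕ → Finset ℕ := fun i => Finset.Ico (p * i) (p * i + p)
    have hdisj : Disjoint (S i) (S j) := by
      rw [Finset.disjoint_left]
      intro a ha hb
      simp only [S, Finset.mem_Ico] at ha hb
      apply hij
      have hp : 0 < p := by omega
      have e1 : a / p = i := by
        rw [Nat.div_eq_iff hp]
        constructor
        · rw [mul_comm]; exact ha.1
        · rw [mul_comm]; omega
      have e2 : a / p = j := by
        rw [Nat.div_eq_iff hp]
        constructor
        · rw [mul_comm]; exact hb.1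
        · rw [mul_comm]; omega
      omega
    have key := hii.indepFun_finset (S i) (S j) hdisj (fun i => measurable_pi_apply i)
    have hne : Nonempty X := nonempty_of_isProbabilityMeasure ν
    let x0 : X := hne.some
    classical
    let E : ∀ i : ℕ, ((S i) → X) → ℝ := fun i t =>
      G (fun k => if h : p * i + k ∈ S i then t ⟨p * i + k, h⟩ else x0)
    have hE : ∀ i, Measurable (E i) := by
      intro i
      apply hG.comp
      rw [measurable_pi_iff]
      intro k
      by_cases h : p * i + k ∈ S i
      · simp only [h, dite_true]; exact measurable_pi_apply _
      · simp only [h, dite_false]; exact measurable_const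
    have e : ∀ i, (fun T : ℕ → X => G (sh (p * i) T)) =
        (E i) ∘ (fun T (k : S i) => T k) := by
      intro i
      funext T
      apply hdep
      intro k hk
      simp [S, sh, hk]
    rw [e i, e j]
    exact key.comp (hE i) (hE j)
  have hid : ∀ i, ProbabilityTheory.IdentDistrib (fun T : ℕ → X => G (sh (p * i) T))
        (fun T : ℕ → X => G (sh (p * 0) T)) (iid ν) (iid ν) := by
    intro i
    refine ⟨(hG.comp (measurable_sh _)).aemeasurable, (hG.comp (measurable_sh _)).aemeasurable, ?_⟩
    have : ∀ k, Measure.map (fun T : ℕ → X => G (sh k T)) (iid ν) = Measure.map G (iid ν) := by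
      intro k
      have := (mp_sh ν k).map_eq
      conv_rhs => rw [← this, Measure.map_map hG (measurable_sh k)]
      rfl
    rw [this, this]
  refine ⟨hind, hid, ?_⟩
  have := ProbabilityTheory.strong_law_ae_real (μ := iid ν) (fun i T => G (sh (p * i) T))
    (by simpa [sh_zero] using hint) hind hid
  simpa [sh_zero] using this

end Fk




namespace Fk

variable {X : Type*} [MeasurableSpace X] (ν : Measure X) [IsProbabilityMeasure ν]

lemma integral_sh (k : ℕ) {G : (ℕ → X) → ℝ} (hG : Measurable G) :
    ∫ T, G (sh k T) ∂(iid ν) = ∫ T, G T ∂(iid ν) := by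
  have h := (mp_sh ν k).map_eq
  conv_rhs => rw [← h]
  rw [integral_map (measurable_sh k).aemeasurable hG.aestronglyMeasurable]

lemma integrable_sh (k : ℕ) {G : (ℕ → X) → ℝ} (hG : Measurable G) (hi : Integrable G (iid ν)) :
    Integrable (fun T => G (sh k T)) (iid ν) :=
  ((mp_sh ν k).integrable_comp hG.aestronglyMeasurable).2 hi

/-- nonnegative subadditive functionals over the iid shift -/
structure KData (F : ℕ → (ℕ → X) → ℝ) : Prop where
  meas : ∀ n, Measurable (F n)
  nonneg : ∀ n T, 0 ≤ F n T
  dep : ∀ n (T T' : ℕ → X), (∀ i < n, T i = T' i) → F n T = F n T'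
  sub : ∀ n k T, F (n + k) T ≤ F n T + F k (sh n T)
  zero : ∀ T, F 0 T = 0
  back : ∀ n T, F n (sh 1 T) ≤ F (n + 1) T + F 1 T
  int : Integrable (F 1) (iid ν)

namespace KData

variable {ν} {F : ℕ → (ℕ → X) → ℝ}

lemma le_sum (K : KData ν F) (n : ℕ) (T : ℕ → X) : F n T ≤ ∑ k ∈ Finset.range n, F 1 (sh k T) := by
  induction n with
  | zero => simp [K.zero]
  | succ n ih =>
    rw [Finset.sum_range_succ]
    exact (K.sub n 1 T).trans (by linarith)

lemma integrable (K : KData ν F) (n : ℕ) : Integrable (F n) (iid ν) := by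
  have h : Integrable (fun T => ∑ k ∈ Finset.range n, F 1 (sh k T)) (iid ν) :=
    integrable_finsetSum _ fun k _ => integrable_sh ν k (K.meas 1) K.int
  refine h.mono' (K.meas n).aestronglyMeasurable (ae_of_all _ fun T => ?_)
  rw [Real.norm_of_nonneg (K.nonneg n T)]
  exact K.le_sum n T

lemma subadd (K : KData ν F) : Subadditive (fun n => ∫ T, F n T ∂(iid ν)) := by
  intro n k
  change ∫ T, F (n + k) T ∂(iid ν) ≤ ∫ T, F n T ∂(iid ν) + ∫ T, F k T ∂(iid ν)
  have h1 : ∫ T, F k (sh n T) ∂(iid ν) = ∫ T, F k T ∂(iid ν) := integral_sh ν n (K.meas k)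
  rw [← h1, ← integral_add (K.integrable n) (integrable_sh ν n (K.meas k) (K.integrable k))]
  exact integral_mono (K.integrable _)
    ((K.integrable n).add (integrable_sh ν n (K.meas k) (K.integrable k))) (fun T => K.sub n k T)

lemma bdd (K : KData ν F) : BddBelow (Set.range fun n : ℕ => (∫ T, F n T ∂(iid ν)) / n) := by
  refine ⟨0, ?_⟩
  rintro _ ⟨n, rfl⟩
  have := integral_nonneg (μ := iid ν) (f := F n) (fun T => K.nonneg n T)
  positivity

lemma block (K : KData ν F) (p q : ℕ) (T : ℕ → X) :
    F (p * q) T ≤ ∑ i ∈ Finset.range q, F p (sh (p * i) T) := by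
  induction q with
  | zero => simp [K.zero]
  | succ q ih =>
    rw [Finset.sum_range_succ, Nat.mul_succ]
    exact (K.sub (p*q) p T).trans (by linarith)

lemma slln (K : KData ν F) : ∀ᵐ T ∂(iid ν), Tendsto
    (fun n : ℕ => (∑ i ∈ Finset.range n, F 1 (sh i T)) / n)
      atTop (nhds (∫ T, F 1 T ∂(iid ν))) := by
  have := (slln_block ν 1 (F 1) (K.meas 1) (K.dep 1) K.int).2.2
  simpa using this

lemma upper_aux (K : KData ν F) (p : ℕ) (hp : 0 < p) :
    ∀ᵐ T ∂(iid ν), ∀ L, (∫ T, F p T ∂(iid ν)) / p < L → ∀ᶠ n : ℕ in atTop, F n T / n < L := by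
  filter_upwards [K.slln, (slln_block ν p (F p) (K.meas p) (K.dep p) (K.integrable p)).2.2]
    with T h1 h2 L hL
  set a := ∫ T, F p T ∂(iid ν)
  set Λ := ∫ T, F 1 T ∂(iid ν)
  set S : ℕ → ℝ := fun n => ∑ i ∈ Finset.range n, F 1 (sh i T) with hS
  set Z : ℕ → ℝ := fun n => ∑ i ∈ Finset.range n, F p (sh (p * i) T) with hZ
  have hp' : (0:ℝ) < p := by exact_mod_cast hp
  have hq : Tendsto (fun n : ℕ => ((n / p : ℕ) : ℝ) / n) atTop (nhds (1 / p)) := by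
    have l1 : Tendsto (fun n : ℕ => (1:ℝ) / p - 1 / n) atTop (nhds (1 / p)) := by
      simpa using (tendsto_const_nhds (x := (1:ℝ)/p)).sub
        (tendsto_one_div_atTop_nhds_zero_nat (𝕜 := ℝ))
    refine tendsto_of_tendsto_of_tendsto_of_le_of_le' l1 tendsto_const_nhds ?_ ?_
    · filter_upwards [eventually_gt_atTop 0] with n hn
      have hn' : (0:ℝ) < n := by exact_mod_cast hn
      have : (n:ℝ) ≤ p * ((n / p : ℕ) : ℝ) + p := by
        have h3 := Nat.div_add_mod n p
        have h4 := Nat.mod_lt n hp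
        have : n ≤ p * (n / p) + p := by omega
        exact_mod_cast this
      rw [div_sub_div _ _ hp'.ne' hn'.ne', div_le_div_iff₀ (by positivity) hn']
      nlinarith
    · filter_upwards [eventually_gt_atTop 0] with n hn
      have hn' : (0:ℝ) < n := by exact_mod_cast hn
      rw [div_le_div_iff₀ hn' hp']
      have := Nat.div_mul_le_self n p
      have : (((n/p : ℕ):ℝ)) * p ≤ n := by exact_mod_cast this
      linarith
  have hqt : Tendsto (fun n : ℕ => n / p) atTop atTop := Nat.tendsto_div_const_atTop hp.ne'
  have hpqt : Tendsto (fun n : ℕ => p * (n / p)) atTop atTop :=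
    (tendsto_id.const_mul_atTop' hp).comp hqt
  have hR : Tendsto (fun n : ℕ => ((n / p : ℕ) : ℝ) / n * (Z (n/p) / ((n/p : ℕ):ℝ))
      + (S n / n - p * (((n / p : ℕ) : ℝ) / n) * (S (p * (n/p)) / ((p * (n/p) : ℕ) : ℝ))))
      atTop (nhds (1 / p * a + (Λ - p * (1 / p) * Λ))) :=
    (hq.mul (h2.comp hqt)).add (h1.sub ((hq.const_mul _).mul (h1.comp hpqt)))
  have e : 1 / p * a + (Λ - p * (1 / p) * Λ) = a / p := by field_simp; ring
  rw [e] at hR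
  have hev : ∀ᶠ n : ℕ in atTop, 0 < n / p := hqt.eventually_gt_atTop 0
  filter_upwards [hR.eventually_lt_const hL, hev] with n hn hnp
  refine lt_of_le_of_lt ?_ hn
  have hnp' : (0:ℝ) < ((n/p : ℕ):ℝ) := by exact_mod_cast hnp
  have hn0 : 0 < n := by
    rcases Nat.eq_zero_or_pos n with h | h
    · simp [h] at hnp
    · exact h
  have hn' : (0:ℝ) < n := by exact_mod_cast hn0
  have e2 : ((n / p : ℕ) : ℝ) / n * (Z (n/p) / ((n/p : ℕ):ℝ))
      + (S n / n - p * (((n / p : ℕ) : ℝ) / n) * (S (p * (n/p)) / ((p * (n/p) : ℕ) : ℝ)))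
      = (Z (n/p) + S n - S (p * (n/p))) / n := by
    push_cast
    field_simp
    ring
  rw [e2]
  gcongr
  have hle : p * (n / p) ≤ n := Nat.mul_div_le n p
  have hs : S n - S (p * (n/p)) = ∑ i ∈ Finset.range (n - p * (n/p)),
      F 1 (sh (p * (n/p) + i) T) := by
    have := Finset.sum_range_add (fun i => F 1 (sh i T)) (p * (n/p)) (n - p * (n/p))
    rw [Nat.add_sub_cancel' hle] at this
    simp only [hS]
    linarith
  have h3 := K.sub (p * (n/p)) (n - p * (n/p)) T
  rw [Nat.add_sub_cancel' hle] at h3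
  have h4 := K.le_sum (n - p * (n/p)) (sh (p * (n/p)) T)
  simp only [sh_sh] at h4
  have h5 := K.block p (n/p) T
  have : S n = S (p * (n/p)) + ∑ i ∈ Finset.range (n - p * (n/p)),
      F 1 (sh (p * (n/p) + i) T) := by linarith
  rw [this]
  simp only [hZ]
  linarith

lemma upper (K : KData ν F) : ∀ᵐ T ∂(iid ν), ∀ L, K.subadd.lim < L → ∀ᶠ n : ℕ in atTop, F n T / n < L := by
  have h : ∀ᵐ T ∂(iid ν), ∀ p : ℕ, 0 < p → ∀ L, (∫ T, F p T ∂(iid ν)) / p < L →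
      ∀ᶠ n : ℕ in atTop, F n T / n < L := by
    rw [ae_all_iff]
    intro p
    by_cases hp : 0 < p
    · filter_upwards [K.upper_aux p hp] with T hT _ using hT
    · exact ae_of_all _ fun T h => absurd h hp
  filter_upwards [h] with T hT L hL
  have := (K.subadd.tendsto_lim K.bdd).eventually_lt_const hL
  obtain ⟨p, h1, h2⟩ := (this.and (eventually_gt_atTop 0)).exists
  exact hT p h2 L h1

lemma hb {C : ℝ} (u : ℕ → ℝ) (hu : ∀ n, 0 ≤ u n) (hC : 0 ≤ C) :
    IsBoundedUnder (fun x1 x2 => x1 ≥ x2) atTop (fun n => min (u n) C) ∧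
    IsCoboundedUnder (fun x1 x2 => x1 ≥ x2) atTop (fun n => min (u n) C) := by
  constructor
  · exact isBoundedUnder_of ⟨0, fun n => le_min (hu n) hC⟩
  · exact IsBoundedUnder.isCoboundedUnder_ge (isBoundedUnder_of ⟨C, fun n => min_le_right _ _⟩)

lemma fdiv_nonneg (K : KData ν F) (n : ℕ) (T : ℕ → X) : 0 ≤ F n T / n :=
  div_nonneg (K.nonneg n T) n.cast_nonneg

/-- invariance of the truncated liminf -/
lemma h_shift (K : KData ν F) {C : ℝ} (hC : 0 ≤ C) (T : ℕ → X) :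
    liminf (fun n : ℕ => min (F n (sh 1 T) / n) C) atTop
      ≤ liminf (fun n : ℕ => min (F n T / n) C) atTop := by
  have b1 := hb (C := C) _ (fun n => K.fdiv_nonneg n T) hC
  have b2 := hb (C := C) _ (fun n => K.fdiv_nonneg n (sh 1 T)) hC
  refine le_of_forall_gt_imp_ge_of_dense fun c hc => ?_
  rcases le_or_gt C c with hCc | hCc
  · exact (liminf_le_of_frequently_le
      (Frequently.of_forall fun n => min_le_right _ _) b2.1).trans hCc
  obtain ⟨c', hc1, hc2⟩ := exists_between hc
  have hf := frequently_lt_of_liminf_lt b1.2 hc1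
  apply liminf_le_of_frequently_le _ b2.1
  have hc0 : 0 ≤ c' := by
    obtain ⟨n, hn⟩ := hf.exists
    exact (le_min (K.fdiv_nonneg n T) hC).trans hn.le
  have hlim : ∀ᶠ n : ℕ in atTop, c' * n + c' + F 1 T ≤ c * n := by
    have : Tendsto (fun n : ℕ => (c - c') * (n:ℝ)) atTop atTop :=
      (tendsto_natCast_atTop_atTop).const_mul_atTop (by linarith)
    filter_upwards [this.eventually_ge_atTop (c' + F 1 T)] with n hn
    linarith
  rw [Filter.frequently_atTop] at hf ⊢
  intro N
  rw [eventually_atTop] at hlim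
  obtain ⟨N1, hN1⟩ := hlim
  obtain ⟨n, hn, hlt⟩ := hf (N + N1 + 2)
  refine ⟨n - 1, by omega, ?_⟩
  apply (min_le_left _ _).trans
  have hn' : (0:ℝ) < ((n-1 : ℕ):ℝ) := by
    have : 0 < n - 1 := by omega
    exact_mod_cast this
  have e1 : ((n : ℕ):ℝ) = ((n-1:ℕ):ℝ) + 1 := by
    rw [Nat.cast_sub (by omega)]; simp
  have h1 : F n T / n < c' := by
    rcases min_lt_iff.1 hlt with h | h
    · exact h
    · linarith
  rw [div_lt_iff₀ (by rw [e1]; linarith), e1] at h1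
  have h2 := K.back (n-1) T
  rw [show n - 1 + 1 = n by omega] at h2
  rw [div_le_iff₀ hn']
  have := hN1 (n-1) (by omega)
  linarith

lemma lower_key (K : KData ν F) {C : ℝ} (hC : K.subadd.lim < C) :
    K.subadd.lim ≤ ∫ T, liminf (fun n : ℕ => min (F n T / n) C) atTop ∂(iid ν) := by
  classical
  have hγ0 : 0 ≤ K.subadd.lim := by
    refine ge_of_tendsto' (K.subadd.tendsto_lim K.bdd) fun n => ?_
    have := integral_nonneg (μ := iid ν) (f := F n) (fun T => K.nonneg n T)
    positivity
  have hC0 : 0 ≤ C := hγ0.trans hC.le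
  set h : (ℕ → X) → ℝ := fun T => liminf (fun n : ℕ => min (F n T / n) C) atTop with hh
  have b := fun T => hb (C := C) _ (fun n => K.fdiv_nonneg n T) hC0
  have hmeas : Measurable h := by
    apply Measurable.liminf
    intro n
    exact ((K.meas n).div_const _).min measurable_const
  have h0 : ∀ T, 0 ≤ h T := fun T =>
    le_liminf_of_le (b T).2 (Eventually.of_forall fun n => le_min (K.fdiv_nonneg n T) hC0)
  have hle : ∀ T, h T ≤ C := fun T => liminf_le_of_frequently_le
      (Frequently.of_forall fun n => min_le_right _ _) (b T).1
  have hint : Integrable h (iid ν) := by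
    refine (integrable_const C).mono' hmeas.aestronglyMeasurable (ae_of_all _ fun T => ?_)
    rw [Real.norm_of_nonneg (h0 T)]; exact hle T
  have hsh : ∀ k T, h (sh k T) ≤ h T := by
    intro k
    induction k with
    | zero => intro T; rw [sh_zero]
    | succ k ih =>
      intro T
      rw [← sh_sh 1 k T]
      exact (K.h_shift hC0 (sh k T)).trans (ih T)
  have hlt : ∀ᵐ T ∂(iid ν), h T < C := by
    filter_upwards [K.upper] with T hT
    obtain ⟨c, hc1, hc2⟩ := exists_between hC
    refine lt_of_le_of_lt ?_ hc2
    exact liminf_le_of_frequently_le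
      ((hT c hc1).frequently.mono fun n hn => (min_le_left _ _).trans hn.le) (b T).1
  refine le_of_forall_pos_le_add fun ε hε => ?_
  set D : ℕ → Set (ℕ → X) := fun N => {T | ∀ n, 1 ≤ n → n ≤ N → n * (h T + ε) < F n T} with hD
  have hDm : ∀ N, MeasurableSet (D N) := by
    intro N
    have : D N = ⋂ n : ℕ, ⋂ (_ : 1 ≤ n), ⋂ (_ : n ≤ N), {T | n * (h T + ε) < F n T} := by
      ext T; simp [hD]
    rw [this]
    refine MeasurableSet.iInter fun n => MeasurableSet.iInter fun _ =>
      MeasurableSet.iInter fun _ => ?_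
    exact measurableSet_lt ((hmeas.add_const ε).const_mul _) (K.meas n)
  set f : ℕ → (ℕ → X) → ℝ := fun N => (D N).indicator (F 1) with hf
  have hfm : ∀ N, Measurable (f N) := fun N => (K.meas 1).indicator (hDm N)
  have hfi : ∀ N, Integrable (f N) (iid ν) := fun N => K.int.indicator (hDm N)
  have hft : Tendsto (fun N => ∫ T, f N T ∂(iid ν)) atTop (nhds 0) := by
    have : Tendsto (fun N => ∫ T, f N T ∂(iid ν)) atTop (nhds (∫ T, (0:ℝ) ∂(iid ν))) := by
      refine tendsto_integral_of_dominated_convergence (F 1)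
        (fun N => (hfm N).aestronglyMeasurable) K.int ?_ ?_
      · intro N
        refine ae_of_all _ fun T => ?_
        rw [Real.norm_eq_abs]
        by_cases hT : T ∈ D N
        · simp only [hf, Set.indicator_of_mem hT]; rw [abs_of_nonneg (K.nonneg 1 T)]
        · simp only [hf, Set.indicator_of_notMem hT]; simpa using K.nonneg 1 T
      · filter_upwards [hlt] with T hT
        have hfr := frequently_lt_of_liminf_lt (b T).2
          (show liminf (fun n : ℕ => min (F n T / n) C) atTop < min (h T + ε) C from
            lt_min (by simp only [hh]; linarith) hT)
        obtain ⟨n, hn, hn1⟩ := (hfr.and_eventually (eventually_ge_atTop 1)).exists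
        have hn' : (0:ℝ) < n := by exact_mod_cast hn1
        have hlt2 : F n T / n < h T + ε := by
          rcases min_lt_iff.1 hn with h' | h'
          · exact h'.trans_le (min_le_left _ _)
          · exact absurd (h'.trans_le (min_le_right _ _)) (lt_irrefl _)
        rw [div_lt_iff₀ hn'] at hlt2
        refine tendsto_const_nhds.congr' ?_
        filter_upwards [eventually_ge_atTop n] with N hN
        have : T ∉ D N := by
          intro hTD
          have := hTD n hn1 hN
          linarith
        simp only [hf, Set.indicator_of_notMem this]
    simpa using this
  have hkey : ∀ N n : ℕ, ∫ T, F n T ∂(iid ν) ≤ n * (∫ T, h T ∂(iid ν) + ε)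
      + n * ∫ T, f N T ∂(iid ν) + N * ∫ T, F 1 T ∂(iid ν) := by
    intro N n
    have hdet : ∀ T, F n T ≤ n * (h T + ε) + ∑ j ∈ Finset.range n, f N (sh j T)
        + ∑ j ∈ Finset.range n, (if n ≤ j + N then F 1 (sh j T) else 0) := by
      intro T
      have := steele (fun k l => F (l - k) (sh k T)) (fun k => F 1 (sh k T))
        (fun k => K.nonneg _ _) (h T + ε) (by linarith [h0 T])
        (by
          intro k l n hkl hln
          have := K.sub (l - k) (n - l) (sh k T)
          rw [sh_sh, show l - k + (n - l) = n - k by omega, show k + (l - k) = l by omega] at this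
          exact this)
        (by intro k; simp)
        (by intro k; simp [K.zero])
        N (fun k => sh k T ∈ D N)
        (by
          intro k hk
          simp only [hD, Set.mem_ofPred_eq, not_forall, not_lt] at hk
          obtain ⟨l, h1, h2, h3⟩ := hk
          refine ⟨l, h1, h2, ?_⟩
          rw [Nat.add_sub_cancel_left]
          refine h3.trans ?_
          have := hsh k T
          gcongr) n 0
      simp only [zero_add, Nat.sub_zero, sh_zero, Nat.Ico_zero_eq_range] at this
      refine this.trans (le_of_eq ?_)
      congr 2
      refine Finset.sum_congr rfl fun j _ => ?_
      simp only [hf, Set.indicator_apply]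
    have hI1 : Integrable (fun T => ∑ j ∈ Finset.range n, f N (sh j T)) (iid ν) :=
      integrable_finsetSum _ fun k _ => integrable_sh ν k (hfm N) (hfi N)
    have hI2' : ∀ j, Integrable (fun T => if n ≤ j + N then F 1 (sh j T) else 0) (iid ν) := by
      intro j
      by_cases hj : n ≤ j + N
      · simp only [hj, if_true]; exact integrable_sh ν j (K.meas 1) K.int
      · simp only [hj, if_false]; exact integrable_zero _ _ _
    have hI2 : Integrable (fun T => ∑ j ∈ Finset.range n,
        (if n ≤ j + N then F 1 (sh j T) else 0)) (iid ν) :=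
      integrable_finsetSum _ fun k _ => hI2' k
    have hI0 : Integrable (fun T => n * (h T + ε)) (iid ν) :=
      (hint.add (integrable_const ε)).const_mul _
    have hmono := integral_mono (K.integrable n) ((hI0.add hI1).add hI2) hdet
    have e0 : ∫ T, n * (h T + ε) ∂(iid ν) = n * (∫ T, h T ∂(iid ν) + ε) := by
      rw [integral_const_mul, integral_add hint (integrable_const ε)]
      simp
    have e1 : ∫ T, ∑ j ∈ Finset.range n, f N (sh j T) ∂(iid ν) = n * ∫ T, f N T ∂(iid ν) := by
      rw [integral_finsetSum _ fun k _ => integrable_sh ν k (hfm N) (hfi N)]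
      simp [integral_sh ν _ (hfm N)]
    have e2 : ∫ T, ∑ j ∈ Finset.range n, (if n ≤ j + N then F 1 (sh j T) else 0) ∂(iid ν)
        ≤ N * ∫ T, F 1 T ∂(iid ν) := by
      rw [integral_finsetSum _ fun k _ => hI2' k]
      have hΛ : 0 ≤ ∫ T, F 1 T ∂(iid ν) := integral_nonneg (fun T => K.nonneg 1 T)
      have : ∀ j, ∫ T, (if n ≤ j + N then F 1 (sh j T) else 0) ∂(iid ν)
          = if n ≤ j + N then ∫ T, F 1 T ∂(iid ν) else 0 := by
        intro j
        by_cases hj : n ≤ j + N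
        · simp only [hj, if_true]; exact integral_sh ν j (K.meas 1)
        · simp only [hj, if_false]; simp
      simp only [this]
      rw [← Finset.sum_filter, Finset.sum_const, nsmul_eq_mul]
      gcongr
      have hsub : (Finset.range n).filter (fun j => n ≤ j + N) ⊆ Finset.Ico (n - N) n := by
        intro j hj
        simp only [Finset.mem_filter, Finset.mem_range, Finset.mem_Ico] at hj ⊢
        omega
      refine (Finset.card_le_card hsub).trans ?_
      rw [Nat.card_Ico]; omega
    have e3 : ∫ T, (n * (h T + ε) + ∑ j ∈ Finset.range n, f N (sh j T)
        + ∑ j ∈ Finset.range n, (if n ≤ j + N then F 1 (sh j T) else 0)) ∂(iid ν)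
        = ∫ T, n * (h T + ε) ∂(iid ν) + ∫ T, ∑ j ∈ Finset.range n, f N (sh j T) ∂(iid ν)
          + ∫ T, ∑ j ∈ Finset.range n, (if n ≤ j + N then F 1 (sh j T) else 0) ∂(iid ν) := by
      rw [← integral_add hI0 hI1]
      exact integral_add (hI0.add hI1) hI2
    have hmono' : ∫ T, F n T ∂(iid ν) ≤ ∫ T, (n * (h T + ε) + ∑ j ∈ Finset.range n, f N (sh j T)
        + ∑ j ∈ Finset.range n, (if n ≤ j + N then F 1 (sh j T) else 0)) ∂(iid ν) := hmono
    rw [e3, e0, e1] at hmono'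
    linarith
  have hkey2 : ∀ N : ℕ, K.subadd.lim ≤ (∫ T, h T ∂(iid ν) + ε) + ∫ T, f N T ∂(iid ν) := by
    intro N
    have ht : Tendsto (fun n : ℕ => (∫ T, h T ∂(iid ν) + ε) + ∫ T, f N T ∂(iid ν)
        + N * (∫ T, F 1 T ∂(iid ν)) / n) atTop
        (nhds ((∫ T, h T ∂(iid ν) + ε) + ∫ T, f N T ∂(iid ν) + 0)) :=
      tendsto_const_nhds.add (tendsto_const_div_atTop_nhds_zero_nat _)
    rw [add_zero] at ht
    refine ge_of_tendsto ht ?_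
    filter_upwards [eventually_gt_atTop 0] with n hn
    have hn' : (0:ℝ) < n := by exact_mod_cast hn
    refine (K.subadd.lim_le_div K.bdd hn.ne').trans ?_
    rw [div_le_iff₀ hn']
    refine (hkey N n).trans (le_of_eq ?_)
    field_simp
  have := ge_of_tendsto' (tendsto_const_nhds.add hft) hkey2
  linarith

theorem kingman (K : KData ν F) : ∀ᵐ T ∂(iid ν), Tendsto (fun n : ℕ => F n T / n) atTop (nhds K.subadd.lim) := by
  set γ := K.subadd.lim with hγ
  have hγ0 : 0 ≤ γ := by
    refine ge_of_tendsto' (K.subadd.tendsto_lim K.bdd) fun n => ?_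
    have := integral_nonneg (μ := iid ν) (f := F n) (fun T => K.nonneg n T)
    positivity
  have hC0 : (0:ℝ) ≤ γ + 1 := by linarith
  have hlow := K.lower_key (C := γ + 1) (by linarith)
  set h : (ℕ → X) → ℝ := fun T => liminf (fun n : ℕ => min (F n T / n) (γ + 1)) atTop with hh
  have b := fun T => hb (C := γ + 1) _ (fun n => K.fdiv_nonneg n T) hC0
  have hmeas : Measurable h := by
    apply Measurable.liminf
    intro n
    exact ((K.meas n).div_const _).min measurable_const
  have h0 : ∀ T, 0 ≤ h T := fun T =>
    le_liminf_of_le (b T).2 (Eventually.of_forall fun n => le_min (K.fdiv_nonneg n T) hC0)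
  have hle : ∀ T, h T ≤ γ + 1 := fun T => liminf_le_of_frequently_le
      (Frequently.of_forall fun n => min_le_right _ _) (b T).1
  have hint : Integrable h (iid ν) := by
    refine (integrable_const (γ + 1)).mono' hmeas.aestronglyMeasurable (ae_of_all _ fun T => ?_)
    rw [Real.norm_of_nonneg (h0 T)]; exact hle T
  have hup : ∀ᵐ T ∂(iid ν), h T ≤ γ := by
    filter_upwards [K.upper] with T hT
    refine le_of_forall_gt_imp_ge_of_dense fun c hc => ?_
    exact liminf_le_of_frequently_le
      ((hT c hc).frequently.mono fun n hn => (min_le_left _ _).trans hn.le) (b T).1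
  have hz : ∫ T, (γ - h T) ∂(iid ν) = 0 := by
    apply le_antisymm
    · rw [integral_sub (integrable_const _) hint]
      simp only [integral_const, probReal_univ, one_smul]
      linarith
    · exact integral_nonneg_of_ae (hup.mono fun T hT => by simpa using hT)
  have hz2 := (integral_eq_zero_iff_of_nonneg_ae (hup.mono fun T hT => by simpa using hT)
    ((integrable_const γ).sub hint)).1 hz
  filter_upwards [hz2, K.upper] with T hT hU
  have hT' : h T = γ := by
    have : γ - h T = 0 := hT
    linarith
  refine tendsto_order.2 ⟨fun l hl => ?_, fun L hL => hU L hL⟩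
  have := eventually_lt_of_lt_liminf (show l < liminf (fun n : ℕ => min (F n T / n) (γ + 1)) atTop
    from by change l < h T; rw [hT']; exact hl) (b T).1
  exact this.mono fun n hn => hn.trans_le (min_le_left _ _)

end KData

end Fk


namespace Fk

/-- the Euclidean plane -/
abbrev E2 := EuclideanSpace ℝ (Fin 2)

/-- linear action -/
abbrev ac (M : SL2) : E2 →L[ℝ] E2 :=
  Matrix.toEuclideanCLM (𝕜 := ℝ) (M : Matrix (Fin 2) (Fin 2) ℝ)

/-- operator norm of an element of `SL2` -/
abbrev nm (M : SL2) : ℝ := opNorm (M : Matrix (Fin 2) (Fin 2) ℝ)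

/-- the area form -/
def wedge (v w : E2) : ℝ := v 0 * w 1 - v 1 * w 0

lemma ac_zero (M : SL2) (v : E2) : ac M v 0 = M.1 0 0 * v 0 + M.1 0 1 * v 1 := by
  rw [Matrix.ofLp_toEuclideanCLM]; simp [Matrix.mulVec, dotProduct, Fin.sum_univ_two]

lemma ac_one (M : SL2) (v : E2) : ac M v 1 = M.1 1 0 * v 0 + M.1 1 1 * v 1 := by
  rw [Matrix.ofLp_toEuclideanCLM]; simp [Matrix.mulVec, dotProduct, Fin.sum_univ_two]

lemma ac_mul (M N : SL2) (v : E2) : ac (M * N) v = ac M (ac N v) := by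
  simp [ac, map_mul]

lemma ac_one' (v : E2) : ac 1 v = v := by
  simp [ac]

lemma nsq (v : E2) : ‖v‖ ^ 2 = v 0 ^ 2 + v 1 ^ 2 := by
  rw [EuclideanSpace.norm_sq_eq]; simp [Fin.sum_univ_two]

lemma wedge_ac (M : SL2) (v w : E2) : wedge (ac M v) (ac M w) = wedge v w := by
  have h := M.2
  rw [Matrix.det_fin_two] at h
  simp only [wedge, ac_zero, ac_one]
  linear_combination (v 0 * w 1 - v 1 * w 0) * h

lemma abs_wedge_le (v w : E2) : |wedge v w| ≤ ‖v‖ * ‖w‖ := by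
  apply abs_le_of_sq_le_sq _ (by positivity)
  rw [mul_pow, nsq, nsq, wedge]
  nlinarith [sq_nonneg (v 0 * w 0 + v 1 * w 1)]

lemma wedge_comm (v w : E2) : wedge v w = - wedge w v := by
  simp only [wedge]; ring

lemma wedge_tri (a b c : E2) (hb : ‖b‖ = 1) :
    |wedge a c| ≤ ‖c‖ * |wedge a b| + ‖a‖ * |wedge b c| := by
  have h1 : wedge a c = inner ℝ a b * wedge b c + wedge a b * inner ℝ b c := by
    have h := nsq b
    rw [hb] at h
    simp only [wedge, PiLp.inner_apply, Fin.sum_univ_two, RCLike.inner_apply, conj_trivial]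
    linear_combination (a 0 * c 1 - a 1 * c 0) * h
  rw [h1]
  refine (abs_add_le _ _).trans ?_
  rw [abs_mul, abs_mul]
  have h2 := abs_real_inner_le_norm a b
  have h3 := abs_real_inner_le_norm b c
  rw [hb] at h2 h3
  nlinarith [abs_nonneg (wedge b c), abs_nonneg (wedge a b)]

lemma norm_ac_le (M : SL2) (v : E2) : ‖ac M v‖ ≤ nm M * ‖v‖ :=
  ContinuousLinearMap.le_opNorm _ _

lemma nm_nonneg (M : SL2) : 0 ≤ nm M := norm_nonneg _

lemma norm_le_ac (M : SL2) (x : E2) : ‖x‖ ≤ nm M * ‖ac M x‖ := by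
  rcases eq_or_ne x 0 with rfl | hx
  · simp
  have hpos : 0 < ‖x‖ := norm_pos_iff.2 hx
  let y : E2 := !₂[- x 1, x 0]
  have hy : ‖y‖ = ‖x‖ := by
    have : ‖y‖ ^ 2 = ‖x‖ ^ 2 := by
      rw [nsq, nsq]; simp [y]; ring
    exact (sq_eq_sq₀ (norm_nonneg _) (norm_nonneg _)).1 this
  have h1 : wedge x y = ‖x‖ ^ 2 := by
    rw [nsq]; simp [wedge, y]; ring
  have h2 : ‖x‖ ^ 2 ≤ ‖ac M x‖ * ‖ac M y‖ := by
    rw [← h1, ← wedge_ac M]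
    exact (le_abs_self _).trans (abs_wedge_le _ _)
  have h3 := norm_ac_le M y
  rw [hy] at h3
  have h4 : ‖x‖ ^ 2 ≤ ‖ac M x‖ * (nm M * ‖x‖) :=
    h2.trans (mul_le_mul_of_nonneg_left h3 (norm_nonneg _))
  have : ‖x‖ * ‖x‖ ≤ (nm M * ‖ac M x‖) * ‖x‖ := by nlinarith
  exact le_of_mul_le_mul_right this hpos

/-- a unit vector -/
def e0 : E2 := !₂[1, 0]

lemma norm_e0 : ‖e0‖ = 1 := by
  have : ‖e0‖ ^ 2 = 1 ^ 2 := by rw [nsq]; simp [e0]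
  exact (sq_eq_sq₀ (norm_nonneg _) (by norm_num)).1 this

lemma one_le_nm (M : SL2) : 1 ≤ nm M := by
  have h1 := norm_le_ac M e0
  have h2 := norm_ac_le M e0
  rw [norm_e0] at h1 h2
  have := nm_nonneg M
  by_contra hlt
  push Not at hlt
  nlinarith

lemma nm_pos (M : SL2) : 0 < nm M := lt_of_lt_of_le one_pos (one_le_nm M)

lemma nm_mul (M N : SL2) : nm (M * N) ≤ nm M * nm N := by
  unfold nm opNorm
  rw [Matrix.SpecialLinearGroup.coe_mul, map_mul]
  exact norm_mul_le _ _

lemma nm_one : nm (1 : SL2) = 1 := by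
  simp [nm, opNorm]

lemma nm_le_of {M : SL2} {C : ℝ} (hC : 0 ≤ C) (h : ∀ v, ‖ac M v‖ ≤ C * ‖v‖) : nm M ≤ C :=
  ContinuousLinearMap.opNorm_le_bound _ hC h

lemma nm_inv (M : SL2) : nm M⁻¹ = nm M := by
  have key : ∀ M : SL2, nm M ≤ nm M⁻¹ := by
    intro M
    apply nm_le_of (nm_nonneg _)
    intro v
    have := norm_le_ac M⁻¹ (ac M v)
    rwa [← ac_mul, inv_mul_cancel, ac_one'] at this
  apply le_antisymm _ (key M)
  simpa using key M⁻¹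

lemma ac_ne_zero (M : SL2) {v : E2} (hv : v ≠ 0) : ac M v ≠ 0 := by
  intro h
  apply hv
  have := norm_le_ac M v
  rw [h, norm_zero, mul_zero] at this
  exact norm_le_zero_iff.1 this

/-- an almost maximally contracted unit vector -/
lemma exists_contr (M : SL2) : ∃ u : E2, ‖u‖ = 1 ∧ ‖ac M u‖ ≤ 2 / nm M := by
  have hpos := nm_pos M
  have hlt : nm M / 2 < ‖ac M⁻¹‖ := by
    have : ‖ac M⁻¹‖ = nm M⁻¹ := rfl
    rw [this, nm_inv]; linarith
  obtain ⟨y, hy, hy2⟩ := (ac M⁻¹).exists_lt_apply_of_lt_opNorm hlt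
  have h0 : 0 < ‖ac M⁻¹ y‖ := by linarith
  refine ⟨(‖ac M⁻¹ y‖)⁻¹ • ac M⁻¹ y, ?_, ?_⟩
  · rw [norm_smul, norm_inv, norm_norm, inv_mul_cancel₀ h0.ne']
  · rw [map_smul, norm_smul, norm_inv, norm_norm, ← ac_mul, mul_inv_cancel, ac_one',
      inv_mul_le_iff₀ h0]
    have h1 : 1 ≤ ‖ac M⁻¹ y‖ * (2 / nm M) := by
      rw [mul_div_assoc', le_div_iff₀ hpos]; linarith
    linarith

/-- product of the first `n` letters -/
def Q (T : ℕ → SL2) : ℕ → SL2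
  | 0 => 1
  | n + 1 => T n * Q T n

lemma Q_succ (T : ℕ → SL2) (n : ℕ) : Q T (n+1) = T n * Q T n := rfl

lemma Q_add (T : ℕ → SL2) (n k : ℕ) : Q T (n + k) = Q (sh n T) k * Q T n := by
  induction k with
  | zero => simp [Q]
  | succ k ih =>
    rw [← add_assoc, Q_succ, ih, Q_succ, mul_assoc]; rfl

lemma Pprod_eq (T : ℕ → SL2) (n : ℕ) : Pprod T n = Q (sh 1 T) n := by
  induction n with
  | zero => rfl
  | succ n ih =>
    rw [Q_succ, ← ih, Pprod]
    simp [sh, add_comm]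

lemma Q_dep (n : ℕ) (T T' : ℕ → SL2) (h : ∀ i < n, T i = T' i) : Q T n = Q T' n := by
  induction n with
  | zero => rfl
  | succ n ih =>
    rw [Q_succ, Q_succ, h n (by omega), ih fun i hi => h i (by omega)]

/-- the size of `v` after `n` steps -/
def good (γ : ℝ) (v : E2) (T : ℕ → SL2) : Prop :=
  Tendsto (fun n : ℕ => Real.log ‖ac (Q T n) v‖ / n) atTop (nhds γ)

lemma bad_freq {γ : ℝ} {v : E2} (hv : v ≠ 0) {T : ℕ → SL2}
    (h1 : Tendsto (fun n : ℕ => Real.log (nm (Q T n)) / n) atTop (nhds γ))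
    (hbad : ¬ good γ v T) :
    ∃ ε > 0, ∃ᶠ n : ℕ in atTop, ‖ac (Q T n) v‖ ≤ Real.exp (n * (γ - ε)) := by
  by_contra hcon
  push Not at hcon
  apply hbad
  have hup : Tendsto (fun n : ℕ => Real.log (nm (Q T n)) / n + Real.log ‖v‖ / n) atTop
      (nhds (γ + 0)) := h1.add (tendsto_const_div_atTop_nhds_zero_nat _)
  rw [add_zero] at hup
  refine tendsto_order.2 ⟨fun l hl => ?_, fun L hL => ?_⟩
  · have := hcon ((γ - l)) (by linarith)
    filter_upwards [this, eventually_gt_atTop 0] with n hn hn0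
    have hn' : (0:ℝ) < n := by exact_mod_cast hn0
    have h2 := Real.log_lt_log (Real.exp_pos _) hn
    rw [Real.log_exp] at h2
    rw [lt_div_iff₀ hn']
    linarith
  · filter_upwards [hup.eventually_lt_const hL] with n hn
    refine lt_of_le_of_lt ?_ hn
    rw [← add_div, ← Real.log_mul (nm_pos _).ne' (norm_ne_zero_iff.2 hv)]
    have := norm_ac_le (Q T n) v
    gcongr
    exact norm_pos_iff.2 (ac_ne_zero _ hv)

lemma good_zero {v : E2} (hv : v ≠ 0) {T : ℕ → SL2}
    (h1 : Tendsto (fun n : ℕ => Real.log (nm (Q T n)) / n) atTop (nhds 0)) : good 0 v T := by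
  have hv' : 0 < ‖v‖ := norm_pos_iff.2 hv
  have hup : Tendsto (fun n : ℕ => Real.log (nm (Q T n)) / n + Real.log ‖v‖ / n) atTop
      (nhds (0 + 0)) := h1.add (tendsto_const_div_atTop_nhds_zero_nat _)
  have hlo : Tendsto (fun n : ℕ => Real.log ‖v‖ / n - Real.log (nm (Q T n)) / n) atTop
      (nhds (0 - 0)) := (tendsto_const_div_atTop_nhds_zero_nat _).sub h1
  rw [add_zero] at hup
  rw [sub_zero] at hlo
  refine tendsto_of_tendsto_of_tendsto_of_le_of_le hlo hup (fun n => ?_) (fun n => ?_)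
  · rw [← sub_div, ← Real.log_div hv'.ne' (nm_pos _).ne']
    have := norm_le_ac (Q T n) v
    have hp := nm_pos (Q T n)
    gcongr
    rw [div_le_iff₀ hp]; linarith
  · rw [← add_div, ← Real.log_mul (nm_pos _).ne' (norm_ne_zero_iff.2 hv)]
    have := norm_ac_le (Q T n) v
    gcongr
    exact norm_pos_iff.2 (ac_ne_zero _ hv)

lemma not_both_bad {γ : ℝ} (hγ : 0 ≤ γ) {v w : E2} (hv : v ≠ 0) (hw : w ≠ 0)
    (hvw : wedge v w ≠ 0) {T : ℕ → SL2}
    (h1 : Tendsto (fun n : ℕ => Real.log (nm (Q T n)) / n) atTop (nhds γ))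
    (h2 : Tendsto (fun n : ℕ => Real.log (nm (T n)) / n) atTop (nhds 0)) :
    good γ v T ∨ good γ w T := by
  rcases hγ.eq_or_lt with rfl | hγ
  · exact Or.inl (good_zero hv h1)
  by_contra hcon
  push Not at hcon
  obtain ⟨hbv, hbw⟩ := hcon
  choose u hu1 hu2 using fun n => exists_contr (Q T n)
  -- basic estimate
  have hbase : ∀ n (z : E2), |wedge z (u n)| ≤ ‖ac (Q T n) z‖ * (2 / nm (Q T n)) := by
    intro n z
    rw [← wedge_ac (Q T n)]
    exact (abs_wedge_le _ _).trans (mul_le_mul_of_nonneg_left (hu2 n) (norm_nonneg _))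
  -- lower bound on the norm
  have hlow : ∀ c < γ, ∀ᶠ n : ℕ in atTop, Real.exp (n * c) ≤ nm (Q T n) := by
    intro c hc
    filter_upwards [h1.eventually_const_lt hc, eventually_gt_atTop 0] with n hn hn0
    have hn' : (0:ℝ) < n := by exact_mod_cast hn0
    rw [lt_div_iff₀ hn'] at hn
    rw [← Real.le_log_iff_exp_le (nm_pos _)]
    linarith
  have hT : ∀ᶠ n : ℕ in atTop, nm (T n) ≤ Real.exp (n * (γ/4)) := by
    filter_upwards [h2.eventually_lt_const (show (0:ℝ) < γ/4 by linarith), eventually_gt_atTop 0]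
      with n hn hn0
    have hn' : (0:ℝ) < n := by exact_mod_cast hn0
    rw [div_lt_iff₀ hn'] at hn
    rw [← Real.log_le_iff_le_exp (nm_pos _)]
    linarith
  have hstep : ∀ᶠ n : ℕ in atTop, |wedge (u n) (u (n+1))| ≤ 4 * (Real.exp (-(γ/4))) ^ n := by
    have hl := hlow (γ/2) (by linarith)
    filter_upwards [hT, hl, (tendsto_add_atTop_nat 1).eventually hl] with n a1 a2 a3
    have e : ‖ac (Q T (n+1)) (u n)‖ ≤ nm (T n) * (2 / nm (Q T n)) := by
      rw [Q_succ, ac_mul]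
      exact (norm_ac_le _ _).trans (mul_le_mul_of_nonneg_left (hu2 n) (nm_nonneg _))
    have hp1 := nm_pos (Q T n)
    have hp2 := nm_pos (Q T (n+1))
    have hge := one_le_nm (Q T (n+1))
    have hp3 := nm_pos (T n)
    calc |wedge (u n) (u (n+1))| ≤ ‖ac (Q T (n+1)) (u n)‖ * (2 / nm (Q T (n+1))) := hbase _ _
      _ ≤ (nm (T n) * (2 / nm (Q T n))) * (2 / 1) := by gcongr
      _ ≤ (Real.exp (n * (γ/4)) * (2 / Real.exp (n * (γ/2)))) * (2 / 1) := by gcongr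
      _ = 4 * (Real.exp (n * (γ/4)) / Real.exp (n * (γ/2))) := by ring
      _ = 4 * (Real.exp (-(γ/4))) ^ n := by
        rw [← Real.exp_sub, ← Real.exp_nat_mul]
        congr 2; ring
  have hsum : Summable (fun n : ℕ => |wedge (u n) (u (n+1))|) := by
    have hg : Summable (fun n : ℕ => 4 * (Real.exp (-(γ/4))) ^ n) :=
      (summable_geometric_of_lt_one (Real.exp_pos _).le (by
        rw [Real.exp_lt_one_iff]; linarith)).mul_left _
    refine Summable.of_norm_bounded_eventually_nat hg ?_
    filter_upwards [hstep] with n hn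
    simpa using hn
  have hzero : ∀ z : E2, z ≠ 0 → ¬ good γ z T →
      Tendsto (fun n => |wedge z (u n)|) atTop (nhds 0) := by
    intro z hz hb
    have hc : CauchySeq (fun n => |wedge z (u n)|) := by
      apply cauchySeq_of_summable_dist
      refine Summable.of_nonneg_of_le (fun _ => dist_nonneg) (fun n => ?_) (hsum.mul_left ‖z‖)
      rw [Real.dist_eq, abs_le]
      have t1 := wedge_tri z (u n) (u (n+1)) (hu1 n)
      have t2 := wedge_tri z (u (n+1)) (u n) (hu1 (n+1))
      rw [wedge_comm (u (n+1)) (u n), abs_neg] at t2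
      rw [hu1] at t1 t2
      constructor <;> linarith
    obtain ⟨l, hl⟩ := cauchySeq_tendsto_of_complete hc
    obtain ⟨ε, hε, hfr⟩ := bad_freq hz h1 hb
    have hl0 : 0 ≤ l := ge_of_tendsto' hl fun n => abs_nonneg _
    have : l ≤ 0 := by
      have hg : Tendsto (fun n : ℕ => 2 * (Real.exp (-(ε/2))) ^ n) atTop (nhds (2 * 0)) :=
        (tendsto_pow_atTop_nhds_zero_of_lt_one (Real.exp_pos _).le (by
          rw [Real.exp_lt_one_iff]; linarith)).const_mul 2
      rw [mul_zero] at hg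
      have hfr2 : ∃ᶠ n : ℕ in atTop, |wedge z (u n)| - 2 * (Real.exp (-(ε/2))) ^ n ≤ 0 := by
        refine (hfr.and_eventually (hlow (γ - ε/2) (by linarith))).mono ?_
        rintro n ⟨b1, b2⟩
        have hp1 := nm_pos (Q T n)
        have : |wedge z (u n)| ≤ 2 * (Real.exp (-(ε/2))) ^ n := by
          calc |wedge z (u n)| ≤ ‖ac (Q T n) z‖ * (2 / nm (Q T n)) := hbase _ _
            _ ≤ Real.exp (n * (γ - ε)) * (2 / Real.exp (n * (γ - ε/2))) := by gcongr
            _ = 2 * (Real.exp (n * (γ - ε)) / Real.exp (n * (γ - ε/2))) := by ring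
            _ = 2 * (Real.exp (-(ε/2))) ^ n := by
              rw [← Real.exp_sub, ← Real.exp_nat_mul]
              congr 2; ring
        linarith
      have := le_of_tendsto_of_frequently (hl.sub hg) hfr2
      linarith
    have : l = 0 := le_antisymm this hl0
    rwa [this] at hl
  have hv0 := hzero v hv hbv
  have hw0 := hzero w hw hbw
  have hlim : Tendsto (fun n => ‖w‖ * |wedge v (u n)| + ‖v‖ * |wedge w (u n)|) atTop
      (nhds (‖w‖ * 0 + ‖v‖ * 0)) := (hv0.const_mul _).add (hw0.const_mul _)
  have : |wedge v w| ≤ ‖w‖ * 0 + ‖v‖ * 0 := by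
    refine ge_of_tendsto' hlim fun n => ?_
    have := wedge_tri v (u n) w (hu1 n)
    rwa [wedge_comm (u n) w, abs_neg] at this
  rw [mul_zero, mul_zero, add_zero] at this
  exact hvw (abs_nonpos_iff.1 this)

end Fk


namespace Fk

instance : BorelSpace SL2 := ⟨rfl⟩
instance : BorelSpace P1 := ⟨rfl⟩

lemma cont_val : Continuous (fun M : SL2 => (M : Matrix (Fin 2) (Fin 2) ℝ)) :=
  continuous_subtype_val

lemma cont_ac : Continuous (fun M : SL2 => ac M) := by
  have h : Continuous (fun A : Matrix (Fin 2) (Fin 2) ℝ =>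
      Matrix.toEuclideanCLM (𝕜 := ℝ) A) :=
    LinearMap.continuous_of_finiteDimensional
      ((Matrix.toEuclideanCLM (𝕜 := ℝ) (n := Fin 2)).toAlgEquiv.toLinearMap)
  exact h.comp cont_val

lemma cont_nm : Continuous (fun M : SL2 => nm M) := cont_ac.norm

lemma cont_act : Continuous (fun p : SL2 × E2 => ac p.1 p.2) :=
  (cont_ac.comp continuous_fst).clm_apply continuous_snd

lemma cont_acv (v : E2) : Continuous (fun M : SL2 => ac M v) :=
  cont_ac.clm_apply continuous_const

instance : SecondCountableTopology (Matrix (Fin 2) (Fin 2) ℝ) :=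
  inferInstanceAs (SecondCountableTopology (Fin 2 → Fin 2 → ℝ))
instance : SecondCountableTopology SL2 :=
  TopologicalSpace.Subtype.secondCountableTopology _

instance : ContinuousMul SL2 := by
  refine ⟨?_⟩
  refine Continuous.subtype_mk (f := fun p : SL2 × SL2 =>
    (p.1 : Matrix (Fin 2) (Fin 2) ℝ) * (p.2 : Matrix (Fin 2) (Fin 2) ℝ)) ?_ _
  exact (cont_val.comp continuous_fst).matrix_mul (cont_val.comp continuous_snd)

lemma meas_Q (n : ℕ) : Measurable (fun T : ℕ → SL2 => Q T n) := by
  induction n with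
  | zero => exact measurable_const
  | succ n ih =>
    simp only [Q_succ]
    exact (measurable_pi_apply n).mul ih

lemma meas_nm : Measurable (fun M : SL2 => nm M) := cont_nm.measurable

lemma meas_acv (v : E2) : Measurable (fun M : SL2 => ‖ac M v‖) :=
  (cont_acv v).norm.measurable

/-- the subadditive functional -/
def FF (n : ℕ) (T : ℕ → SL2) : ℝ := Real.log (nm (Q T n))

lemma FF_one (T : ℕ → SL2) : FF 1 T = Real.log (nm (T 0)) := by
  simp [FF, Q]

lemma kdata (ν : Measure SL2) [IsProbabilityMeasure ν]
    (hlog : ∫⁻ M : SL2, ENNReal.ofReal (Real.log (opNorm (M : Matrix (Fin 2) (Fin 2) ℝ))) ∂ν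
      < ⊤) : KData ν FF where
  meas n := (meas_nm.comp (meas_Q n)).log
  nonneg n T := Real.log_nonneg (one_le_nm _)
  dep n T T' h := by simp only [FF, Q_dep n T T' h]
  sub n k T := by
    simp only [FF]
    rw [Q_add, ← Real.log_mul (nm_pos _).ne' (nm_pos _).ne', mul_comm (nm (Q T n))]
    exact Real.log_le_log (nm_pos _) (nm_mul _ _)
  zero T := by simp only [FF, Q, nm_one, Real.log_one]
  back n T := by
    have e : Q (sh 1 T) n = Q T (n+1) * (Q T 1)⁻¹ := by
      rw [add_comm n 1, Q_add, mul_assoc, mul_inv_cancel, mul_one]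
    simp only [FF]
    rw [e, ← Real.log_mul (nm_pos _).ne' (nm_pos _).ne', ← nm_inv (Q T 1)]
    exact Real.log_le_log (nm_pos _) (nm_mul _ _)
  int := by
    have h1 : Integrable (fun M : SL2 => Real.log (nm M)) ν := by
      refine ⟨meas_nm.log.aestronglyMeasurable, ?_⟩
      rw [hasFiniteIntegral_iff_ofReal (ae_of_all _ fun M => Real.log_nonneg (one_le_nm M))]
      exact hlog
    have h2 := (measurePreserving_eval_infinitePi (fun _ : ℕ => ν) 0).integrable_comp
      (g := fun M : SL2 => Real.log (nm M)) meas_nm.log.aestronglyMeasurable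
    have h3 := h2.2 h1
    refine h3.congr (ae_of_all _ fun T => ?_)
    simp [FF_one, Function.eval]

lemma int_log (ν : Measure SL2) [IsProbabilityMeasure ν] (K : KData ν FF) :
    Integrable (fun M : SL2 => Real.log (nm M)) ν := by
  have h2 := (measurePreserving_eval_infinitePi (fun _ : ℕ => ν) 0).integrable_comp
      (g := fun M : SL2 => Real.log (nm M)) meas_nm.log.aestronglyMeasurable
  refine h2.1 (K.int.congr (ae_of_all _ fun T => ?_))
  simp [FF_one, Function.eval]

lemma mu_eq (ν : Measure SL2) [IsProbabilityMeasure ν] (μ : Measure (ℕ → SL2))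
    (hμ : ∀ (s : Finset ℕ) (A : ℕ → Set SL2), (∀ i, MeasurableSet (A i)) →
      μ {T | ∀ i ∈ s, T i ∈ A i} = ∏ i ∈ s, ν (A i)) : μ = iid ν := by
  apply Measure.eq_infinitePi
  intro s t ht
  exact hμ s t ht

lemma ae_T (ν : Measure SL2) [IsProbabilityMeasure ν] (K : KData ν FF) :
    ∀ᵐ T ∂(iid ν), Tendsto (fun n : ℕ => Real.log (nm (T n)) / n) atTop (nhds 0) := by
  filter_upwards [K.slln] with T hT
  set S : ℕ → ℝ := fun n => ∑ i ∈ Finset.range n, FF 1 (sh i T) with hS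
  set Λ := ∫ T, FF 1 T ∂(iid ν)
  have h1 : Tendsto (fun n : ℕ => S (n+1) / ((n+1 : ℕ):ℝ)) atTop (nhds Λ) :=
    hT.comp (tendsto_add_atTop_nat 1)
  have h2 : Tendsto (fun n : ℕ => ((n+1 : ℕ):ℝ) / n) atTop (nhds 1) := by
    have : Tendsto (fun n : ℕ => 1 + (1:ℝ) / n) atTop (nhds (1 + 0)) :=
      tendsto_const_nhds.add (tendsto_const_div_atTop_nhds_zero_nat 1)
    rw [add_zero] at this
    refine this.congr' ?_
    filter_upwards [eventually_gt_atTop 0] with n hn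
    have hn' : (n:ℝ) ≠ 0 := by exact_mod_cast hn.ne'
    push_cast; field_simp
  have h3 := (h1.mul h2).sub hT
  rw [mul_one, sub_self] at h3
  refine h3.congr' ?_
  filter_upwards [eventually_gt_atTop 0] with n hn
  have hn' : (n:ℝ) ≠ 0 := by exact_mod_cast hn.ne'
  have hn2 : ((n+1:ℕ):ℝ) ≠ 0 := by exact_mod_cast (Nat.succ_ne_zero n)
  have e : S (n+1) = S n + Real.log (nm (T n)) := by
    simp only [hS]
    rw [Finset.sum_range_succ, FF_one]; simp [sh]
  change S (n+1) / _ * _ - S n / n = _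
  rw [e]
  field_simp
  ring

/-! ### projective action -/

lemma projAct_mk (M : SL2) (v : E2) (hv : v ≠ 0) :
    projAct M (Projectivization.mk ℝ v hv) = Projectivization.mk ℝ (ac M v) (ac_ne_zero M hv) := by
  rw [projAct, Projectivization.map_mk]; rfl

lemma projAct_rep (M : SL2) (v : P1) :
    projAct M v = Projectivization.mk ℝ (ac M v.rep) (ac_ne_zero M v.rep_nonzero) := by
  conv_lhs => rw [← v.mk_rep]
  exact projAct_mk _ _ _

lemma mk_eq_iff_wedge {v w : E2} (hv : v ≠ 0) (hw : w ≠ 0) :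
    Projectivization.mk ℝ v hv = Projectivization.mk ℝ w hw ↔ wedge v w = 0 := by
  rw [Projectivization.mk_eq_mk_iff']
  constructor
  · rintro ⟨a, rfl⟩
    simp [wedge]; ring
  · intro h
    simp only [wedge] at h
    have hw2 : w 0 ^ 2 + w 1 ^ 2 ≠ 0 := by
      rw [← nsq]; exact pow_ne_zero 2 (norm_ne_zero_iff.2 hw)
    refine ⟨(v 0 * w 0 + v 1 * w 1) / (w 0 ^ 2 + w 1 ^ 2), ?_⟩
    ext i
    fin_cases i
    · simp; field_simp; linear_combination (- w 1) * h
    · simp; field_simp; linear_combination (w 0) * h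

lemma projAct_one (v : P1) : projAct 1 v = v := by
  rw [projAct_rep]
  conv_rhs => rw [← v.mk_rep]
  simp only [ac_one']

lemma projAct_mul (M N : SL2) (v : P1) : projAct (M * N) v = projAct M (projAct N v) := by
  rw [projAct_rep N v, projAct_mk, projAct_rep]
  simp only [ac_mul]

lemma projAct_inj (M : SL2) : Function.Injective (projAct M) := by
  intro v w h
  have := congrArg (projAct M⁻¹) h
  simpa only [← projAct_mul, inv_mul_cancel, projAct_one] using this

lemma closed_eq (v w : P1) : IsClosed {M : SL2 | projAct M v = w} := by
  have : {M : SL2 | projAct M v = w} = {M : SL2 | wedge (ac M v.rep) w.rep = 0} := by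
    ext M
    simp only [Set.mem_ofPred_eq]
    rw [projAct_rep, ← mk_eq_iff_wedge (ac_ne_zero M v.rep_nonzero) w.rep_nonzero, w.mk_rep]
  rw [this]
  apply isClosed_eq _ continuous_const
  have h : Continuous (fun M : SL2 => ac M v.rep) := cont_acv v.rep
  have hw : Continuous (fun x : E2 => wedge x w.rep) := by
    unfold wedge
    fun_prop
  exact hw.comp h

end Fk


namespace Fk

lemma closed_maps (v : P1) {L : Set P1} (hL : L.Finite) : IsClosed {M : SL2 | projAct M v ∈ L} := by
  have : {M : SL2 | projAct M v ∈ L} = ⋃ w ∈ L, {M : SL2 | projAct M v = w} := by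
    ext M; simp
  rw [this]
  exact hL.isClosed_biUnion fun w _ => closed_eq v w

lemma msupp_sub {ν : Measure SL2} {C : Set SL2} (hC : IsClosed C) (h : ∀ᵐ M ∂ν, M ∈ C) :
    msupp ν ⊆ C := by
  intro M hM
  by_contra hMC
  exact hM Cᶜ (hC.isOpen_compl.mem_nhds hMC) h

lemma image_eq {L : Set P1} (hL : L.Finite) {M : SL2} (h : ∀ v ∈ L, projAct M v ∈ L) :
    projAct M '' L = L := by
  apply Set.eq_of_subset_of_ncard_le
  · rintro _ ⟨v, hv, rfl⟩; exact h v hv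
  · rw [Set.ncard_image_of_injective _ (projAct_inj M)]
  · exact hL

lemma gnu_inv {ν : Measure SL2} {L : Set P1} (hL : L.Finite)
    (h : ∀ v ∈ L, ∀ᵐ M ∂ν, projAct M v ∈ L) : ∀ M ∈ Gnu ν, projAct M '' L = L := by
  have h1 : ∀ M ∈ msupp ν, projAct M '' L = L := by
    intro M hM
    apply image_eq hL
    intro v hv
    exact msupp_sub (closed_maps v hL) (h v hv) hM
  have h2 : ∀ M ∈ Subgroup.closure (msupp ν), projAct M '' L = L := by
    intro M hM
    induction hM using Subgroup.closure_induction with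
    | mem x hx => exact h1 x hx
    | one => 
      have : projAct 1 = id := funext projAct_one
      rw [this, Set.image_id]
    | mul x y _ _ hx hy =>
      have : projAct (x * y) = projAct x ∘ projAct y := funext (projAct_mul x y)
      rw [this, Set.image_comp, hy, hx]
    | inv x _ hx =>
      conv_lhs => rw [← hx]
      rw [← Set.image_comp]
      have : projAct x⁻¹ ∘ projAct x = id := by
        funext v
        simp only [Function.comp, ← projAct_mul, inv_mul_cancel, projAct_one, id]
      rw [this, Set.image_id]
  intro M hM
  apply image_eq hL
  intro v hv
  have : Gnu ν ⊆ {M : SL2 | projAct M v ∈ L} := by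
    apply closure_minimal _ (closed_maps v hL)
    intro N hN
    have := h2 N hN
    rw [Set.ext_iff] at this
    exact (this _).1 ⟨v, hv, rfl⟩
  exact this hM

lemma max_principle {ν : Measure SL2} [IsProbabilityMeasure ν]
    (hinv : ¬ ∃ L : Set P1, L.Finite ∧ L.Nonempty ∧ ∀ M ∈ Gnu ν, projAct M '' L = L)
    (p : P1 → ENNReal) (hp1 : ∀ v, p v ≤ 1)
    (hfin : ∀ δ : ENNReal, δ ≠ 0 → {v | δ ≤ p v}.Finite)
    (hharm : ∀ v, p v = ∫⁻ M, p (projAct M v) ∂ν) (v : P1) : p v = 0 := by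
  by_contra hv
  apply hinv
  obtain ⟨w, hw, hmax⟩ := Set.exists_max_image _ p (hfin _ hv) ⟨v, le_refl (p v)⟩
  have hle : ∀ u, p u ≤ p w := by
    intro u
    rcases le_or_gt (p v) (p u) with h | h
    · exact hmax u h
    · exact h.le.trans hw
  have hw0 : p w ≠ 0 := fun h => hv (le_zero_iff.1 (h ▸ hw))
  refine ⟨{u | p w ≤ p u}, hfin _ hw0, ⟨w, le_refl (p w)⟩, gnu_inv (hfin _ hw0) ?_⟩
  intro u hu
  have hu' : p u = p w := le_antisymm (hle u) hu
  have := ae_eq_of_ae_le_of_lintegral_le (μ := ν) (f := fun M => p (projAct M u))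
    (g := fun _ => p w) (ae_of_all _ fun M => hle _)
    (by rw [← hharm]; exact ne_top_of_le_ne_top ENNReal.one_ne_top (hp1 u))
    aemeasurable_const (by rw [← hharm, hu']; simp)
  filter_upwards [this] with M hM
  exact hM.ge

lemma good_smul {γ : ℝ} {v : E2} (hv : v ≠ 0) {c : ℝ} (hc : c ≠ 0) {T : ℕ → SL2}
    (h : good γ v T) : good γ (c • v) T := by
  have h1 : Tendsto (fun n : ℕ => Real.log ‖c‖ / n + Real.log ‖ac (Q T n) v‖ / n) atTop
    (nhds (0 + γ)) := (tendsto_const_div_atTop_nhds_zero_nat _).add h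
  rw [zero_add] at h1
  refine h1.congr fun n => ?_
  rw [map_smul, norm_smul, Real.log_mul (norm_ne_zero_iff.2 hc)
    (norm_ne_zero_iff.2 (ac_ne_zero _ hv)), add_div]

lemma good_mk {γ : ℝ} {v : E2} (hv : v ≠ 0) {T : ℕ → SL2} :
    good γ (Projectivization.mk ℝ v hv).rep T ↔ good γ v T := by
  obtain ⟨a, ha⟩ := Projectivization.exists_smul_eq_mk_rep ℝ v hv
  have ha' : (a : ℝ) • v = (Projectivization.mk ℝ v hv).rep := ha
  constructor
  · intro h
    have : v = (a:ℝ)⁻¹ • (Projectivization.mk ℝ v hv).rep := by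
      rw [← ha', smul_smul, inv_mul_cancel₀ a.ne_zero, one_smul]
    rw [this]
    exact good_smul (Projectivization.rep_nonzero _) (inv_ne_zero a.ne_zero) h
  · intro h
    rw [← ha']
    exact good_smul hv a.ne_zero h

lemma sh_cons (M : SL2) (T : ℕ → SL2) : sh 1 (cons M T) = T := by
  funext i
  simp only [sh, add_comm 1 i]; rfl

lemma Q_cons (M : SL2) (T : ℕ → SL2) (n : ℕ) : Q (cons M T) (n+1) = Q T n * M := by
  rw [add_comm, Q_add, sh_cons]
  simp [Q, cons]

lemma good_cons {γ : ℝ} {v : E2} {M : SL2} {T : ℕ → SL2} :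
    good γ v (cons M T) ↔ good γ (ac M v) T := by
  have hr : Tendsto (fun n : ℕ => ((n+1 : ℕ):ℝ) / n) atTop (nhds 1) := by
    have : Tendsto (fun n : ℕ => 1 + (1:ℝ) / n) atTop (nhds (1 + 0)) :=
      tendsto_const_nhds.add (tendsto_const_div_atTop_nhds_zero_nat 1)
    rw [add_zero] at this
    refine this.congr' ?_
    filter_upwards [eventually_gt_atTop 0] with n hn
    have hn' : (n:ℝ) ≠ 0 := by exact_mod_cast hn.ne'
    push_cast; field_simp
  have hr2 : Tendsto (fun n : ℕ => (n:ℝ) / ((n+1 : ℕ):ℝ)) atTop (nhds 1) := by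
    have := hr.inv₀ one_ne_zero
    simpa using this
  unfold good
  rw [← tendsto_add_atTop_iff_nat 1]
  simp only [Q_cons, ac_mul]
  constructor
  · intro h
    have := h.mul hr
    rw [mul_one] at this
    refine this.congr' ?_
    filter_upwards [eventually_gt_atTop 0] with n hn
    have hn' : (n:ℝ) ≠ 0 := by exact_mod_cast hn.ne'
    have hn2 : ((n+1:ℕ):ℝ) ≠ 0 := by exact_mod_cast (Nat.succ_ne_zero n)
    field_simp
  · intro h
    have := h.mul hr2
    rw [mul_one] at this
    refine this.congr' ?_
    filter_upwards [eventually_gt_atTop 0] with n hn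
    have hn' : (n:ℝ) ≠ 0 := by exact_mod_cast hn.ne'
    have hn2 : ((n+1:ℕ):ℝ) ≠ 0 := by exact_mod_cast (Nat.succ_ne_zero n)
    field_simp

/-- exceptional set -/
def bad (γ : ℝ) (v : P1) : Set (ℕ → SL2) := {T | ¬ good γ v.rep T}

lemma meas_logQ (v : E2) (n : ℕ) : Measurable (fun T : ℕ → SL2 => Real.log ‖ac (Q T n) v‖) :=
  ((meas_acv v).comp (meas_Q n)).log

lemma meas_bad (γ : ℝ) (v : P1) : MeasurableSet (bad γ v) := by
  have : MeasurableSet {T : ℕ → SL2 | good γ v.rep T} :=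
    measurableSet_tendsto (nhds γ) (fun n => (meas_logQ v.rep n).div_const _)
  exact this.compl

lemma harm (ν : Measure SL2) [IsProbabilityMeasure ν] (γ : ℝ) (v : P1) :
    iid ν (bad γ v) = ∫⁻ M, iid ν (bad γ (projAct M v)) ∂ν := by
  have h1 := (mp_cons ν).measure_preimage (meas_bad γ v).nullMeasurableSet
  rw [← h1, Measure.prod_apply (measurable_cons (meas_bad γ v))]
  refine lintegral_congr fun M => ?_
  congr 1
  ext T
  simp only [bad, Set.mem_preimage, Set.mem_ofPred_eq]
  rw [good_cons, projAct_rep, good_mk]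

lemma ae_good (ν : Measure SL2) [IsProbabilityMeasure ν] (K : KData ν FF)
    (hinv : ¬ ∃ L : Set P1, L.Finite ∧ L.Nonempty ∧ ∀ M ∈ Gnu ν, projAct M '' L = L)
    (v : P1) : ∀ᵐ T ∂(iid ν), good K.subadd.lim v.rep T := by
  set γ := K.subadd.lim with hγ
  have hγ0 : 0 ≤ γ := by
    refine ge_of_tendsto' (K.subadd.tendsto_lim K.bdd) fun n => ?_
    have := integral_nonneg (μ := iid ν) (f := FF n) (fun T => K.nonneg n T)
    positivity
  refine max_principle hinv (fun v => iid ν (bad γ v)) (fun v => prob_le_one) ?_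
    (fun v => harm ν γ v) v
  intro δ hδ
  apply Measure.finite_const_le_meas_of_disjoint_iUnion₀ (iid ν) (pos_iff_ne_zero.2 hδ)
    (fun v => (meas_bad γ v).nullMeasurableSet)
  · intro v w hvw
    have hw : wedge v.rep w.rep ≠ 0 := by
      intro h
      apply hvw
      rw [← mk_eq_iff_wedge v.rep_nonzero w.rep_nonzero, v.mk_rep, w.mk_rep] at h
      exact h
    have : ∀ᵐ T ∂(iid ν), ¬ (T ∈ bad γ v ∩ bad γ w) := by
      filter_upwards [K.kingman, ae_T ν K] with T h1 h2 h3
      rcases not_both_bad hγ0 v.rep_nonzero w.rep_nonzero hw h1 h2 with h | h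
      · exact h3.1 h
      · exact h3.2 h
    change iid ν (bad γ v ∩ bad γ w) = 0
    rw [ae_iff] at this
    simpa using this
  · exact measure_ne_top _ _

end Fk


namespace Fk

lemma gen_dct {Ω : Type*} [MeasurableSpace Ω] (P : Measure Ω) [IsProbabilityMeasure P]
    (X A : ℕ → Ω → ℝ) (γ Λ : ℝ) (hX : ∀ n, Measurable (X n)) (hA : ∀ n, Measurable (A n))
    (hA0 : ∀ n ω, 0 ≤ A n ω) (hXA : ∀ n ω, |X n ω| ≤ A n ω) (hAi : ∀ n, Integrable (A n) P)
    (hΛ0 : 0 ≤ Λ)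
    (hAΛ : ∀ n, 1 ≤ n → ∫ ω, A n ω ∂P = Λ)
    (hAt : ∀ᵐ ω ∂P, Tendsto (fun n => A n ω) atTop (nhds Λ))
    (hXt : ∀ᵐ ω ∂P, Tendsto (fun n => X n ω) atTop (nhds γ)) :
    Tendsto (fun n => ∫ ω, X n ω ∂P) atTop (nhds γ) := by
  have hXi : ∀ n, Integrable (X n) P := fun n =>
    (hAi n).mono' (hX n).aestronglyMeasurable (ae_of_all _ (hXA n))
  set C := Λ + |γ| with hC
  have hC0 : 0 ≤ C := by positivity
  set U : ℕ → Ω → ℝ := fun n ω => min |X n ω - γ| C with hU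
  set V : ℕ → Ω → ℝ := fun n ω => max (Λ - A n ω) 0 with hV
  have hUm : ∀ n, Measurable (U n) := fun n => by
    simp only [hU]
    exact (((hX n).sub_const γ).abs).min measurable_const
  have hVm : ∀ n, Measurable (V n) := fun n => ((hA n).const_sub Λ).max measurable_const
  have hUb : ∀ n ω, ‖U n ω‖ ≤ C := fun n ω => by
    rw [Real.norm_of_nonneg (le_min (abs_nonneg _) hC0)]; exact min_le_right _ _
  have hVb : ∀ n ω, ‖V n ω‖ ≤ Λ := fun n ω => by
    rw [Real.norm_of_nonneg (le_max_right _ _)]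
    exact max_le (by linarith [hA0 n ω]) hΛ0
  have hUt : Tendsto (fun n => ∫ ω, U n ω ∂P) atTop (nhds (∫ ω, (0:ℝ) ∂P)) := by
    refine tendsto_integral_of_dominated_convergence (fun _ => C)
      (fun n => (hUm n).aestronglyMeasurable) (integrable_const C)
      (fun n => ae_of_all _ (hUb n)) ?_
    filter_upwards [hXt] with ω h
    have := ((h.sub_const γ).abs).min (tendsto_const_nhds (x := C))
    simpa [hC0] using this
  have hVt : Tendsto (fun n => ∫ ω, V n ω ∂P) atTop (nhds (∫ ω, (0:ℝ) ∂P)) := by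
    refine tendsto_integral_of_dominated_convergence (fun _ => Λ)
      (fun n => (hVm n).aestronglyMeasurable) (integrable_const Λ)
      (fun n => ae_of_all _ (hVb n)) ?_
    filter_upwards [hAt] with ω h
    have := ((h.const_sub Λ)).max (tendsto_const_nhds (x := (0:ℝ)))
    simpa using this
  have hUi : ∀ n, Integrable (U n) P := fun n =>
    (integrable_const C).mono' (hUm n).aestronglyMeasurable (ae_of_all _ (hUb n))
  have hVi : ∀ n, Integrable (V n) P := fun n =>
    (integrable_const Λ).mono' (hVm n).aestronglyMeasurable (ae_of_all _ (hVb n))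
  have hUV := hUt.add hVt
  simp only [integral_zero, add_zero] at hUV
  rw [tendsto_iff_norm_sub_tendsto_zero]
  refine squeeze_zero' (Eventually.of_forall fun n => norm_nonneg _) ?_ hUV
  filter_upwards [eventually_ge_atTop 1] with n hn
  have hpt : ∀ ω, |X n ω - γ| ≤ U n ω + (V n ω + (A n ω - Λ)) := by
    intro ω
    have h1 := hXA n ω
    have h2 := abs_sub (X n ω) γ
    simp only [hU, hV]
    have h4 : A n ω - Λ ≤ max (Λ - A n ω) 0 + (A n ω - Λ) := by
      linarith [le_max_right (Λ - A n ω) 0]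
    have h5 : 0 ≤ max (Λ - A n ω) 0 + (A n ω - Λ) := by
      linarith [le_max_left (Λ - A n ω) 0]
    rcases le_total |X n ω - γ| C with h3 | h3
    · rw [min_eq_left h3]; linarith
    · rw [min_eq_right h3]; linarith
  have e1 : ∫ ω, X n ω ∂P - γ = ∫ ω, (X n ω - γ) ∂P := by
    rw [integral_sub (hXi n) (integrable_const _)]; simp
  rw [e1]
  refine (norm_integral_le_integral_norm _).trans ?_
  have hi2 : Integrable (fun ω => A n ω - Λ) P := (hAi n).sub (integrable_const _)
  have h6 : ∫ ω, |X n ω - γ| ∂P ≤ ∫ ω, (U n ω + (V n ω + (A n ω - Λ))) ∂P :=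
    integral_mono ((hXi n).sub (integrable_const _)).abs
      ((hUi n).add ((hVi n).add hi2)) hpt
  have e2 : ∫ ω, (U n ω + (V n ω + (A n ω - Λ))) ∂P = ∫ ω, U n ω ∂P + ∫ ω, V n ω ∂P := by
    have a1 : ∫ ω, (U n ω + (V n ω + (A n ω - Λ))) ∂P
      = ∫ ω, U n ω ∂P + ∫ ω, (V n ω + (A n ω - Λ)) ∂P := integral_add (hUi n) ((hVi n).add hi2)
    rw [a1, integral_add (hVi n) hi2, integral_sub (hAi n) (integrable_const _), hAΛ n hn]
    simp
  rw [e2] at h6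
  exact h6

/-- the logarithmic expansion cocycle -/
def psi (M : SL2) (v : P1) : ℝ := Real.log (‖ac M v.rep‖ / ‖v.rep‖)

lemma psi_mk (M : SL2) (x : E2) (hx : x ≠ 0) :
    psi M (Projectivization.mk ℝ x hx) = Real.log (‖ac M x‖ / ‖x‖) := by
  obtain ⟨a, ha⟩ := Projectivization.exists_smul_eq_mk_rep ℝ x hx
  have ha' : (a : ℝ) • x = (Projectivization.mk ℝ x hx).rep := ha
  rw [psi, ← ha', map_smul, norm_smul, norm_smul,
    mul_div_mul_left _ _ (norm_ne_zero_iff.2 a.ne_zero)]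

lemma psi_mul (M N : SL2) (v : P1) : psi (M * N) v = psi M (projAct N v) + psi N v := by
  rw [projAct_rep, psi_mk, psi, psi, ac_mul]
  have h1 := norm_pos_iff.2 v.rep_nonzero
  have h2 := norm_pos_iff.2 (ac_ne_zero N v.rep_nonzero)
  have h3 := norm_pos_iff.2 (ac_ne_zero M (ac_ne_zero N v.rep_nonzero))
  rw [Real.log_div h3.ne' h1.ne', Real.log_div h3.ne' h2.ne', Real.log_div h2.ne' h1.ne']
  ring

lemma psi_one (v : P1) : psi 1 v = 0 := by
  have h1 := norm_pos_iff.2 v.rep_nonzero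
  rw [psi, ac_one', div_self h1.ne', Real.log_one]

lemma abs_psi_le (M : SL2) (v : P1) : |psi M v| ≤ Real.log (nm M) := by
  have h1 := norm_pos_iff.2 v.rep_nonzero
  have h2 := norm_pos_iff.2 (ac_ne_zero M v.rep_nonzero)
  have h3 := norm_ac_le M v.rep
  have h4 := norm_le_ac M v.rep
  rw [psi, abs_le]
  constructor
  · rw [← Real.log_inv]
    apply Real.log_le_log (inv_pos.2 (nm_pos M))
    rw [inv_le_iff_one_le_mul₀ (nm_pos M), div_mul_eq_mul_div, le_div_iff₀ h1]
    linarith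
  · apply Real.log_le_log (by positivity)
    rw [div_le_iff₀ h1]; exact h3

lemma meas_psi (v : P1) : Measurable (fun M : SL2 => psi M v) :=
  ((meas_acv v.rep).div_const _).log

lemma meas_psiQ (v : P1) (n : ℕ) : Measurable (fun T : ℕ → SL2 => psi (Q T n) v) :=
  (meas_psi v).comp (meas_Q n)

lemma cont_P1 {f : P1 → ℝ}
    (h : Continuous (fun x : {x : E2 // x ≠ 0} => f (Projectivization.mk ℝ x.1 x.2))) :
    Continuous f := by
  apply continuous_coinduced_dom.2
  exact h

lemma cont_mk : Continuous (fun x : {x : E2 // x ≠ 0} => (Projectivization.mk ℝ x.1 x.2 : P1)) :=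
  continuous_coinduced_rng

lemma cont_projAct (v : P1) : Continuous (fun M : SL2 => projAct M v) := by
  simp only [projAct_rep]
  exact cont_mk.comp ((cont_acv v.rep).subtype_mk fun M => ac_ne_zero M v.rep_nonzero)

/-- mean expansion in `n` steps -/
def phi (ν : Measure SL2) [IsProbabilityMeasure ν] (n : ℕ) (v : P1) : ℝ :=
  ∫ T, psi (Q T n) v ∂(iid ν)

lemma int_psiQ {ν : Measure SL2} [IsProbabilityMeasure ν] (K : KData ν FF) (n : ℕ) (v : P1) :
    Integrable (fun T => psi (Q T n) v) (iid ν) :=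
  (K.integrable n).mono' (meas_psiQ v n).aestronglyMeasurable
    (ae_of_all _ fun T => abs_psi_le _ _)

lemma abs_phi_le {ν : Measure SL2} [IsProbabilityMeasure ν] (K : KData ν FF) (n : ℕ) (v : P1) :
    |phi ν n v| ≤ n * ∫ T, FF 1 T ∂(iid ν) := by
  have h : |phi ν n v| ≤ ∫ T, ∑ k ∈ Finset.range n, FF 1 (sh k T) ∂(iid ν) := by
    refine (abs_integral_le_integral_abs).trans ?_
    refine integral_mono (int_psiQ K n v).abs
      (integrable_finsetSum _ fun k _ => integrable_sh ν k (K.meas 1) K.int) fun T => ?_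
    exact (abs_psi_le _ _).trans (K.le_sum n T)
  refine h.trans (le_of_eq ?_)
  rw [integral_finsetSum _ fun k _ => integrable_sh ν k (K.meas 1) K.int]
  simp [integral_sh ν _ (K.meas 1)]

lemma cont_phi {ν : Measure SL2} [IsProbabilityMeasure ν] (K : KData ν FF) (n : ℕ) :
    Continuous (phi ν n) := by
  apply cont_P1
  unfold phi
  refine continuous_of_dominated (bound := FF n) (fun x => (meas_psiQ _ n).aestronglyMeasurable)
    (fun x => ae_of_all _ fun T => abs_psi_le _ _) (K.integrable n) (ae_of_all _ fun T => ?_)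
  simp only [psi_mk]
  refine Continuous.log (Continuous.div ?_ ?_ ?_) ?_
  · exact ((ac (Q T n)).continuous.comp continuous_subtype_val).norm
  · exact continuous_subtype_val.norm
  · exact fun x => norm_ne_zero_iff.2 x.2
  · exact fun x => div_ne_zero (norm_ne_zero_iff.2 (ac_ne_zero _ x.2)) (norm_ne_zero_iff.2 x.2)

lemma int_psi {ν : Measure SL2} [IsProbabilityMeasure ν] (K : KData ν FF) (v : P1) :
    Integrable (fun M => psi M v) ν :=
  (int_log ν K).mono' (meas_psi v).aestronglyMeasurable (ae_of_all _ fun T => abs_psi_le _ _)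

lemma phi_succ {ν : Measure SL2} [IsProbabilityMeasure ν] (K : KData ν FF) (n : ℕ) (v : P1) :
    phi ν (n+1) v = ∫ M, psi M v ∂ν + ∫ M, phi ν n (projAct M v) ∂ν := by
  have hmp := mp_cons ν
  have e1 : phi ν (n+1) v = ∫ p : SL2 × (ℕ → SL2), psi (Q (cons p.1 p.2) (n+1)) v
      ∂(ν.prod (iid ν)) := by
    have h := hmp.map_eq
    unfold phi
    conv_lhs => rw [← h]
    rw [integral_map hmp.measurable.aemeasurable (meas_psiQ v (n+1)).aestronglyMeasurable]
  have hi : Integrable (fun p : SL2 × (ℕ → SL2) => psi (Q (cons p.1 p.2) (n+1)) v)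
      (ν.prod (iid ν)) :=
    (hmp.integrable_comp (meas_psiQ v (n+1)).aestronglyMeasurable).2 (int_psiQ K (n+1) v)
  rw [e1, integral_prod _ hi]
  have e2 : ∀ M : SL2, ∫ T, psi (Q (cons M T) (n+1)) v ∂(iid ν)
      = psi M v + phi ν n (projAct M v) := by
    intro M
    simp only [Q_cons, psi_mul]
    rw [integral_add (int_psiQ K n _) (integrable_const _)]
    simp [phi, add_comm]
  simp only [e2]
  apply integral_add (int_psi K v)
  have hm : Measurable (fun M => phi ν n (projAct M v)) :=
    ((cont_phi K n).comp (cont_projAct v)).measurable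
  exact (integrable_const (n * ∫ T, FF 1 T ∂(iid ν))).mono' hm.aestronglyMeasurable
    (ae_of_all _ fun M => abs_phi_le K n _)

lemma phi_lim {ν : Measure SL2} [IsProbabilityMeasure ν] (K : KData ν FF)
    (hinv : ¬ ∃ L : Set P1, L.Finite ∧ L.Nonempty ∧ ∀ M ∈ Gnu ν, projAct M '' L = L)
    (v : P1) : Tendsto (fun n : ℕ => phi ν n v / n) atTop (nhds K.subadd.lim) := by
  have hi : ∀ n : ℕ, Integrable (fun T => (∑ i ∈ Finset.range n, FF 1 (sh i T))) (iid ν) :=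
    fun n => integrable_finsetSum _ fun k _ => integrable_sh ν k (K.meas 1) K.int
  have h := gen_dct (iid ν) (fun n T => psi (Q T n) v / n)
    (fun n T => (∑ i ∈ Finset.range n, FF 1 (sh i T)) / n) K.subadd.lim (∫ T, FF 1 T ∂(iid ν))
    (fun n => (meas_psiQ v n).div_const _)
    (fun n => (Finset.measurable_fun_sum _
      fun k _ => (K.meas 1).comp (measurable_sh k)).div_const _)
    (fun n T => div_nonneg (Finset.sum_nonneg fun k _ => K.nonneg 1 _) n.cast_nonneg)
    (fun n T => by
      rw [abs_div, Nat.abs_cast]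
      exact div_le_div_of_nonneg_right ((abs_psi_le _ _).trans (K.le_sum n T)) n.cast_nonneg)
    (fun n => (hi n).div_const _)
    (integral_nonneg (fun T => K.nonneg 1 T))
    (fun n hn => by
      have hn' : (n:ℝ) ≠ 0 := by
        have : n ≠ 0 := by omega
        exact_mod_cast this
      rw [integral_div, integral_finsetSum _ fun k _ => integrable_sh ν k (K.meas 1) K.int]
      simp only [integral_sh ν _ (K.meas 1), Finset.sum_const, Finset.card_range, nsmul_eq_mul]
      field_simp)
    K.slln
    (by
      filter_upwards [ae_good ν K hinv v] with T hT
      have h1 := hT.sub (tendsto_const_div_atTop_nhds_zero_nat (Real.log ‖v.rep‖))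
      rw [sub_zero] at h1
      refine h1.congr fun n => ?_
      rw [psi, Real.log_div (norm_ne_zero_iff.2 (ac_ne_zero _ v.rep_nonzero))
        (norm_ne_zero_iff.2 v.rep_nonzero), sub_div])
  refine h.congr fun n => ?_
  rw [integral_div, phi]

lemma final {ν : Measure SL2} [IsProbabilityMeasure ν] (K : KData ν FF)
    (hinv : ¬ ∃ L : Set P1, L.Finite ∧ L.Nonempty ∧ ∀ M ∈ Gnu ν, projAct M '' L = L)
    (m : Measure P1) [IsProbabilityMeasure m]
    (hm : ∀ f : P1 → ℝ, Continuous f → (∃ C : ℝ, ∀ x, |f x| ≤ C) →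
      ∫ x, f x ∂m = ∫ x, (∫ M, f (projAct M x) ∂ν) ∂m) :
    K.subadd.lim = ∫ v, (∫ M, psi M v ∂ν) ∂m := by
  set Λ := ∫ T, FF 1 T ∂(iid ν) with hΛ
  have hpm : ∀ n, AEStronglyMeasurable (phi ν n) m := fun n =>
    (cont_phi K n).measurable.aestronglyMeasurable
  have hpi : ∀ n, Integrable (phi ν n) m := fun n =>
    (integrable_const (n * Λ)).mono' (hpm n) (ae_of_all _ fun v => abs_phi_le K n v)
  have hphi0 : ∀ v, phi ν 0 v = 0 := fun v => by simp [phi, Q, psi_one]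
  have hphi1 : ∀ v, ∫ M, psi M v ∂ν = phi ν 1 v := by
    intro v
    have := phi_succ K 0 v
    simp only [hphi0, integral_zero, add_zero, zero_add] at this
    exact this.symm
  set α := ∫ v, (∫ M, psi M v ∂ν) ∂m with hα
  have hα1 : α = ∫ v, phi ν 1 v ∂m := by simp only [hα, hphi1]
  have hn : ∀ n : ℕ, ∫ v, phi ν n v ∂m = n * α := by
    intro n
    induction n with
    | zero => simp [hphi0]
    | succ n ih =>
      have e : ∀ v, phi ν (n+1) v - phi ν 1 v = ∫ M, phi ν n (projAct M v) ∂ν := fun v => by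
        rw [phi_succ K n v, hphi1]; ring
      have h1 := hm (phi ν n) (cont_phi K n) ⟨_, abs_phi_le K n⟩
      simp only [← e] at h1
      rw [integral_sub (hpi _) (hpi _), ih, ← hα1] at h1
      push_cast
      linarith
  have hlim : Tendsto (fun n : ℕ => ∫ v, phi ν n v / n ∂m) atTop
      (nhds (∫ v, K.subadd.lim ∂m)) := by
    refine tendsto_integral_of_dominated_convergence (fun _ => Λ)
      (fun n => ((cont_phi K n).measurable.div_const _).aestronglyMeasurable)
      (integrable_const _) (fun n => ae_of_all _ fun v => ?_)
      (ae_of_all _ fun v => phi_lim K hinv v)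
    have h0 : 0 ≤ Λ := integral_nonneg (fun T => K.nonneg 1 T)
    rw [Real.norm_eq_abs, abs_div, Nat.abs_cast]
    apply div_le_of_le_mul₀ n.cast_nonneg h0
    rw [mul_comm]
    exact abs_phi_le K n v
  have e2 : ∫ v, K.subadd.lim ∂m = K.subadd.lim := by simp
  rw [e2] at hlim
  refine tendsto_nhds_unique hlim ?_
  refine tendsto_const_nhds.congr' ?_
  filter_upwards [eventually_gt_atTop 0] with n hn0
  have hn' : (n:ℝ) ≠ 0 := by exact_mod_cast hn0.ne'
  rw [integral_div, hn]
  field_simp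

end Fk

theorem furstenberg_formula
    (ν : Measure SL2) [IsProbabilityMeasure ν]
    (hlog : ∫⁻ M : SL2, ENNReal.ofReal (Real.log (opNorm (M : Matrix (Fin 2) (Fin 2) ℝ))) ∂ν
      < ⊤)
    (hnc : ¬ IsCompact (Gnu ν))
    (hinv : ¬ ∃ L : Set P1, L.Finite ∧ L.Nonempty ∧ ∀ M ∈ Gnu ν, projAct M '' L = L)
    (m : Measure P1) [IsProbabilityMeasure m]
    (hm : ∀ f : P1 → ℝ, Continuous f → (∃ C : ℝ, ∀ x, |f x| ≤ C) →
      ∫ x, f x ∂m = ∫ x, (∫ M, f (projAct M x) ∂ν) ∂m)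
    (μ : Measure (ℕ → SL2)) [IsProbabilityMeasure μ]
    (hμ : ∀ (s : Finset ℕ) (A : ℕ → Set SL2), (∀ i, MeasurableSet (A i)) →
      μ {T | ∀ i ∈ s, T i ∈ A i} = ∏ i ∈ s, ν (A i)) :
    ∃ γ : ℝ,
      (∀ᵐ T ∂μ, Tendsto
        (fun n : ℕ => (1 / (n : ℝ)) *
          Real.log (opNorm ((Pprod T n : SL2) : Matrix (Fin 2) (Fin 2) ℝ)))
        atTop (nhds γ)) ∧
      γ = ∫ v : P1, (∫ M : SL2,
        Real.log (‖Matrix.toEuclideanCLM (𝕜 := ℝ) (M : Matrix (Fin 2) (Fin 2) ℝ) v.rep‖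
          / ‖v.rep‖) ∂ν) ∂m := by
  have hμ' : μ = Fk.iid ν := Fk.mu_eq ν μ hμ
  have K := Fk.kdata ν hlog
  refine ⟨K.subadd.lim, ?_, Fk.final K hinv m hm⟩
  rw [hμ']
  filter_upwards [(Fk.mp_sh ν 1).quasiMeasurePreserving.ae K.kingman] with T hT
  refine hT.congr fun n => ?_
  rw [Fk.Pprod_eq, one_div, inv_mul_eq_div]
  rfl
end
end

section
/- Let m be a non-atomic probability measure on the real projective line ℙ¹(ℝ). Then the set H = { M ∈ SL(2,ℝ) : M·m = m }, where M·m denotes the pushforward of m under the induced action of M on ℙ¹(ℝ), is a compact subgroup of SL(2,ℝ): it contains the identity, is closed under products and inverses, and is a compact subset of SL(2,ℝ). -/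
open MeasureTheory Filter

noncomputable section

instance : BorelSpace P1 := ⟨rfl⟩


abbrev matT (A : Matrix (Fin 2) (Fin 2) ℝ) (v : (EuclideanSpace ℝ (Fin 2))) : (EuclideanSpace ℝ (Fin 2)) := Matrix.toEuclideanCLM (𝕜 := ℝ) A v

lemma continuous_mkP : Continuous (fun v : {v : (EuclideanSpace ℝ (Fin 2)) // v ≠ 0} => Projectivization.mk ℝ v.1 v.2) :=
  continuous_quotient_mk'

lemma matT_ne (M : SL2) {v : (EuclideanSpace ℝ (Fin 2))} (hv : v ≠ 0) : matT M v ≠ 0 := by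
  intro h
  exact hv (sl2_inj M (by rw [map_zero]; exact h))

lemma act_mk (M : SL2) (v : (EuclideanSpace ℝ (Fin 2))) (hv : v ≠ 0) :
    projAct M (Projectivization.mk ℝ v hv) = Projectivization.mk ℝ (matT M v) (matT_ne M hv) := rfl

lemma matT_mul (A B : Matrix (Fin 2) (Fin 2) ℝ) (v : (EuclideanSpace ℝ (Fin 2))) : matT (A * B) v = matT A (matT B v) := by
  simp [matT, map_mul]

lemma act_one : projAct 1 = id := by
  funext x
  induction x using Projectivization.ind with
  | h v hv =>
    rw [act_mk]
    simp [matT]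

lemma act_mul (M N : SL2) : projAct (M * N) = projAct M ∘ projAct N := by
  funext x
  induction x using Projectivization.ind with
  | h v hv =>
    simp only [Function.comp, act_mk, Matrix.SpecialLinearGroup.coe_mul, matT_mul]

lemma continuous_act (M : SL2) : Continuous (projAct M) := by
  have hc : Continuous (fun v : {v : (EuclideanSpace ℝ (Fin 2)) // v ≠ 0} =>
      Projectivization.mk ℝ (matT M v.1) (matT_ne M v.2)) :=
    continuous_mkP.comp (Continuous.subtype_mk (f := fun v : {v : (EuclideanSpace ℝ (Fin 2)) // v ≠ 0} => matT M v.1)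
      (by fun_prop) (fun v => matT_ne M v.2))
  exact continuous_coinduced_dom.mpr hc

lemma continuous_matT_left (v : (EuclideanSpace ℝ (Fin 2))) : Continuous (fun A => matT A v) := by
  let L : Matrix (Fin 2) (Fin 2) ℝ →ₗ[ℝ] (EuclideanSpace ℝ (Fin 2)) :=
    { toFun := fun A => matT A v
      map_add' := by intro A B; simp [matT]
      map_smul' := by intro A B; simp [matT] }
  exact L.continuous_of_finiteDimensional

lemma act_tendsto (M : ℕ → SL2) (c : ℕ → ℝ) (hc : ∀ n, c n ≠ 0) (A : Matrix (Fin 2) (Fin 2) ℝ)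
    (hA : Tendsto (fun n => c n • (M n : Matrix (Fin 2) (Fin 2) ℝ)) atTop (nhds A))
    (v : (EuclideanSpace ℝ (Fin 2))) (hv : v ≠ 0) (hAv : matT A v ≠ 0) :
    Tendsto (fun n => projAct (M n) (Projectivization.mk ℝ v hv)) atTop
      (nhds (Projectivization.mk ℝ (matT A v) hAv)) := by
  have e : ∀ n, matT (c n • (M n : Matrix (Fin 2) (Fin 2) ℝ)) v = c n • matT (M n) v := by
    intro n; simp [matT]
  have hne : ∀ n, matT (c n • (M n : Matrix (Fin 2) (Fin 2) ℝ)) v ≠ 0 := by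
    intro n; rw [e]; exact smul_ne_zero (hc n) (matT_ne _ hv)
  have h1 : Tendsto (fun n => (⟨_, hne n⟩ : {v : (EuclideanSpace ℝ (Fin 2)) // v ≠ 0})) atTop (nhds ⟨_, hAv⟩) := by
    rw [tendsto_subtype_rng]
    exact ((continuous_matT_left v).tendsto A).comp hA
  refine ((continuous_mkP.tendsto _).comp h1).congr ?_
  intro n
  simp only [Function.comp, act_mk]
  rw [Projectivization.mk_eq_mk_iff']
  exact ⟨c n, (e n).symm⟩

/-- The embedding of the projective line by rank one projections. -/
def emb (x : P1) : Fin 2 → Fin 2 → ℝ :=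
  Projectivization.lift (fun v : {v : (EuclideanSpace ℝ (Fin 2)) // v ≠ 0} => fun i j => v.1 i * v.1 j / ‖v.1‖ ^ 2) (by
    rintro ⟨a, ha⟩ ⟨b, hb⟩ t h
    simp only at h
    subst h
    have ht : t ≠ 0 := by rintro rfl; simp at ha
    have hb' : ‖b‖ ≠ 0 := by simpa using hb
    funext i j
    simp only [PiLp.smul_apply, smul_eq_mul, norm_smul, mul_pow, Real.norm_eq_abs, sq_abs]
    field_simp) x

lemma emb_mk (v : (EuclideanSpace ℝ (Fin 2))) (hv : v ≠ 0) (i j : Fin 2) :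
    emb (Projectivization.mk ℝ v hv) i j = v i * v j / ‖v‖ ^ 2 := rfl

lemma continuous_emb : Continuous emb := by
  refine Continuous.quotient_lift (s := projectivizationSetoid ℝ (EuclideanSpace ℝ (Fin 2))) ?_ _
  refine continuous_pi fun i => continuous_pi fun j => ?_
  refine Continuous.div (by fun_prop) (by fun_prop) ?_
  rintro ⟨v, hv⟩
  simpa using hv

lemma emb_inj : Function.Injective emb := by
  intro x y h
  induction x using Projectivization.ind with
  | h v hv =>
  induction y using Projectivization.ind with
  | h w hw =>
    have h' : ∀ i j, v i * v j / ‖v‖ ^ 2 = w i * w j / ‖w‖ ^ 2 := fun i j => by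
      rw [← emb_mk v hv, ← emb_mk w hw, h]
    have hv' : ‖v‖ ≠ 0 := by simpa using hv
    have hw' : ‖w‖ ≠ 0 := by simpa using hw
    obtain ⟨i, hi⟩ : ∃ i, v i ≠ 0 := by
      by_contra! hcon
      exact hv (by ext i; simpa using hcon i)
    rw [Projectivization.mk_eq_mk_iff']
    refine ⟨w i * ‖v‖ ^ 2 / (v i * ‖w‖ ^ 2), ?_⟩
    ext j
    have := h' i j
    simp only [PiLp.smul_apply, smul_eq_mul]
    field_simp at this ⊢
    linarith

instance : T2Space P1 := T2Space.of_injective_continuous emb_inj continuous_emb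

instance : CompactSpace P1 := by
  have hne : ∀ v : Metric.sphere (0 : (EuclideanSpace ℝ (Fin 2))) 1, v.1 ≠ 0 := fun v h => by
    have := v.2
    simp [h] at this
  let q : Metric.sphere (0 : (EuclideanSpace ℝ (Fin 2))) 1 → P1 := fun v => Projectivization.mk ℝ v.1 (hne v)
  have hq : Continuous q := 
    continuous_mkP.comp (Continuous.subtype_mk continuous_subtype_val hne)
  have hs : Function.Surjective q := by
    intro x
    induction x using Projectivization.ind with
    | h v hv =>
      have hv' : ‖v‖ ≠ 0 := by simpa using hv
      refine ⟨⟨‖v‖⁻¹ • v, by simp [norm_smul, hv']⟩, ?_⟩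
      simp only [q]
      rw [Projectivization.mk_eq_mk_iff']
      exact ⟨_, rfl⟩
  exact hs.compactSpace hq

instance : TopologicalSpace.MetrizableSpace P1 :=
  (continuous_emb.isClosedEmbedding emb_inj).isEmbedding.metrizableSpace

lemma limit_map (m : Measure P1) [IsProbabilityMeasure m] (M : ℕ → SL2)
    (hM : ∀ n, Measure.map (projAct (M n)) m = m) (g : P1 → P1) (hg : Measurable g)
    (h : ∀ᵐ x ∂m, Tendsto (fun n => projAct (M n) x) atTop (nhds (g x))) :
    Measure.map g m = m := by
  have : IsProbabilityMeasure (Measure.map g m) := Measure.isProbabilityMeasure_map hg.aemeasurable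
  refine ext_of_forall_integral_eq_of_IsFiniteMeasure ?_
  intro f
  rw [integral_map hg.aemeasurable f.continuous.aestronglyMeasurable]
  have key : Tendsto (fun n => ∫ x, f (projAct (M n) x) ∂m) atTop (nhds (∫ x, f (g x) ∂m)) := by
    refine tendsto_integral_of_dominated_convergence (fun _ => ‖f‖) ?_ (integrable_const _) ?_ ?_
    · intro n
      exact (f.continuous.comp (continuous_act (M n))).aestronglyMeasurable
    · intro n
      exact Eventually.of_forall fun x => f.norm_coe_le_norm _
    · filter_upwards [h] with x hx
      exact (f.continuous.tendsto _).comp hx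
  have e : ∀ n, ∫ x, f (projAct (M n) x) ∂m = ∫ x, f x ∂m := by
    intro n
    conv_rhs => rw [← hM n]
    rw [integral_map (continuous_act _).measurable.aemeasurable
      f.continuous.aestronglyMeasurable]
  simp only [e] at key
  exact tendsto_nhds_unique key tendsto_const_nhds

/-- A singular nonzero matrix: a single bad point, and constant elsewhere. -/
lemma singular_map (A : Matrix (Fin 2) (Fin 2) ℝ) (hA : A ≠ 0) (hd : A.det = 0) :
    ∃ k r : P1, ∀ (v : (EuclideanSpace ℝ (Fin 2))) (hv : v ≠ 0), Projectivization.mk ℝ v hv ≠ k →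
      ∃ h : matT A v ≠ 0, Projectivization.mk ℝ (matT A v) h = r := by
  obtain ⟨k0, hk0, hk⟩ := Matrix.exists_mulVec_eq_zero_iff.mpr hd
  have hk1 : (WithLp.toLp 2 k0 : (EuclideanSpace ℝ (Fin 2))) ≠ 0 := by simpa using hk0
  have hdet : ∀ v : (EuclideanSpace ℝ (Fin 2)), v ≠ 0 → v 0 * k0 1 - v 1 * k0 0 = 0 →
      ∃ (a : ℝ), a • (WithLp.toLp 2 k0 : (EuclideanSpace ℝ (Fin 2))) = v := by
    intro v hv h
    by_cases h0 : k0 0 = 0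
    · have h1 : k0 1 ≠ 0 := by
        intro h1; apply hk0; ext i; fin_cases i <;> simp [h0, h1]
      refine ⟨v 1 / k0 1, ?_⟩
      have : v 0 = 0 := by simpa [h0, h1] using h
      ext i; fin_cases i <;> simp [h0, h1, this]
    · refine ⟨v 0 / k0 0, ?_⟩
      ext i; fin_cases i
      · simp [h0]
      · simp; field_simp; linarith
  -- a nonzero column of A spans the range
  obtain ⟨j, hj⟩ : ∃ j, matT A (EuclideanSpace.single j 1) ≠ 0 := by
    by_contra! hcon
    apply hA
    ext i j
    have := congrArg (fun w : (EuclideanSpace ℝ (Fin 2)) => w i) (hcon j)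
    simpa [matT, Matrix.ofLp_toEuclideanCLM] using this
  set r0 := matT A (EuclideanSpace.single j 1) with hr0
  refine ⟨Projectivization.mk ℝ _ hk1, Projectivization.mk ℝ r0 hj, ?_⟩
  intro v hv hne
  have hD : v 0 * k0 1 - v 1 * k0 0 ≠ 0 := by
    intro h
    apply hne
    rw [Projectivization.mk_eq_mk_iff']
    exact hdet v hv h
  have hk' : matT A (WithLp.toLp 2 k0) = 0 := by
    simp [matT, Matrix.toEuclideanCLM_toLp, hk]
  -- every vector is a combination of v and k0
  have hcomb : ∀ u : (EuclideanSpace ℝ (Fin 2)), ∃ a b : ℝ, u = a • v + b • (WithLp.toLp 2 k0 : (EuclideanSpace ℝ (Fin 2))) := by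
    intro u
    refine ⟨(u 0 * k0 1 - u 1 * k0 0) / (v 0 * k0 1 - v 1 * k0 0),
      (v 0 * u 1 - v 1 * u 0) / (v 0 * k0 1 - v 1 * k0 0), ?_⟩
    ext i; fin_cases i
    · simp
      rw [div_mul_eq_mul_div, div_mul_eq_mul_div, ← add_div, eq_div_iff hD]
      ring
    · simp
      rw [div_mul_eq_mul_div, div_mul_eq_mul_div, ← add_div, eq_div_iff hD]
      ring
  obtain ⟨a, b, hab⟩ := hcomb (EuclideanSpace.single j 1)
  have hr : r0 = a • matT A v := by
    rw [hr0, hab]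
    have := hk'
    simp only [matT] at this ⊢
    rw [map_add, map_smul, map_smul, this, smul_zero, add_zero]
  have hAv : matT A v ≠ 0 := by
    intro h; rw [h, smul_zero] at hr; exact hj hr
  refine ⟨hAv, ?_⟩
  symm
  rw [Projectivization.mk_eq_mk_iff']
  exact ⟨a, hr.symm⟩

attribute [local instance] Matrix.normedAddCommGroup Matrix.normedSpace

lemma stab_compact (m : Measure P1) [IsProbabilityMeasure m]
    (hna : ∀ v : P1, m {v} = 0) :
    IsCompact {M : SL2 | Measure.map (projAct M) m = m} := by
  have hemb : Topology.IsEmbedding (fun M : SL2 => (M.1 : Matrix (Fin 2) (Fin 2) ℝ)) :=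
    Topology.IsEmbedding.subtypeVal
  refine (Topology.IsEmbedding.isCompact_iff (X := SL2) hemb).mpr ?_
  have : TopologicalSpace.PseudoMetrizableSpace (Matrix (Fin 2) (Fin 2) ℝ) :=
    inferInstanceAs (TopologicalSpace.PseudoMetrizableSpace (Fin 2 → Fin 2 → ℝ))
  apply IsSeqCompact.isCompact
  intro B hB
  choose M hM hMB using hB
  obtain rfl : (fun n => (M n).1) = B := funext hMB
  let c : ℕ → ℝ := fun n => (1 + ‖(M n).1‖)⁻¹
  have hpos : ∀ n, 0 < 1 + ‖(M n).1‖ := fun n => by positivity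
  have hc0 : ∀ n, c n ≠ 0 := fun n => (inv_pos.mpr (hpos n)).ne'
  have hnorm : ∀ n, ‖c n • (M n).1‖ = 1 - c n := by
    intro n
    have := hpos n
    rw [norm_smul, Real.norm_of_nonneg (inv_pos.mpr this).le]
    simp only [c]
    field_simp
    ring
  have hcmem : ∀ n, c n ∈ Set.Icc (0 : ℝ) 1 := fun n =>
    ⟨(inv_pos.mpr (hpos n)).le, inv_le_one_of_one_le₀ (by linarith [norm_nonneg (M n).1])⟩
  have hK : IsCompact (Set.Icc (0 : ℝ) 1 ×ˢ
      Metric.closedBall (0 : Matrix (Fin 2) (Fin 2) ℝ) 1) := by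
    have : ProperSpace (Matrix (Fin 2) (Fin 2) ℝ) := FiniteDimensional.proper ℝ _
    exact isCompact_Icc.prod (isCompact_closedBall _ _)
  obtain ⟨⟨d, A⟩, -, φ, hφ, hlim⟩ := hK.tendsto_subseq (x := fun n => (c n, c n • (M n).1))
    (fun n => ⟨hcmem n, by rw [mem_closedBall_zero_iff, hnorm]; linarith [(hcmem n).1]⟩)
  have hcl : Tendsto (fun n => c (φ n)) atTop (nhds d) :=
    (continuous_fst.tendsto _).comp hlim
  have hAl : Tendsto (fun n => c (φ n) • (M (φ n)).1) atTop (nhds A) :=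
    (continuous_snd.tendsto _).comp hlim
  by_cases hd : d = 0
  · exfalso
    subst hd
    have hA1 : ‖A‖ = 1 := by
      have h1 := hAl.norm
      simp only [hnorm] at h1
      have h2 := hcl.const_sub 1
      simpa using tendsto_nhds_unique h1 h2
    have hA0 : A ≠ 0 := by
      rintro rfl
      simp at hA1
    have hdet : A.det = 0 := by
      have h1 : Tendsto (fun n => (c (φ n) • (M (φ n)).1).det) atTop (nhds A.det) :=
        ((continuous_id.matrix_det).tendsto A).comp hAl
      have h2 : Tendsto (fun n => c (φ n) ^ 2) atTop (nhds (0 ^ 2)) := hcl.pow 2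
      have e : ∀ n, (c (φ n) • (M (φ n)).1).det = c (φ n) ^ 2 := by
        intro n
        rw [Matrix.det_smul, (M (φ n)).2]; simp
      simp only [e] at h1
      simpa using tendsto_nhds_unique h1 h2
    obtain ⟨k, r, hkr⟩ := singular_map A hA0 hdet
    have := limit_map m (fun n => M (φ n)) (fun n => hM _) (fun _ => r) measurable_const (by
      have hk : ∀ᵐ x ∂m, x ≠ k := by
        rw [ae_iff]; simpa using hna k
      filter_upwards [hk] with x hx
      induction x using Projectivization.ind with
      | h v hv =>
        obtain ⟨h, hr⟩ := hkr v hv hx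
        rw [← hr]
        exact act_tendsto (fun n => M (φ n)) (fun n => c (φ n)) (fun n => hc0 _) A hAl v hv h)
    rw [Measure.map_const, measure_univ, one_smul] at this
    have h0 := hna r
    rw [← this] at h0
    simp at h0
  · have hML : Tendsto (fun n => (M (φ n)).1) atTop (nhds (d⁻¹ • A)) := by
      refine ((hcl.inv₀ hd).smul hAl).congr ?_
      intro n
      rw [smul_smul, inv_mul_cancel₀ (hc0 _), one_smul]
    have hdet : (d⁻¹ • A).det = 1 := by
      have h1 : Tendsto (fun n => ((M (φ n)).1).det) atTop (nhds (d⁻¹ • A).det) :=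
        ((continuous_id.matrix_det).tendsto _).comp hML
      simp only [fun n => (M (φ n)).2] at h1
      exact tendsto_nhds_unique h1 tendsto_const_nhds
    let L : SL2 := ⟨d⁻¹ • A, hdet⟩
    refine ⟨d⁻¹ • A, ⟨L, ?_, rfl⟩, φ, hφ, hML⟩
    refine limit_map m (fun n => M (φ n)) (fun n => hM _) _ (continuous_act L).measurable ?_
    refine Eventually.of_forall fun x => ?_
    induction x using Projectivization.ind with
    | h v hv =>
      exact act_tendsto (fun n => M (φ n)) (fun _ => 1) (fun n => one_ne_zero) L.1
        (by simpa using hML) v hv (matT_ne L hv)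

/-- **The stabilizer of a non-atomic measure on `ℙ¹(ℝ)` is a compact subgroup of
`SL(2,ℝ)`.** If `m` is a non-atomic probability measure on `ℙ¹(ℝ)`, then
`H = {M : M·m = m}` contains the identity, is closed under products and inverses, and is a
compact subset of `SL(2,ℝ)`. -/
theorem stabilizer_compact_subgroup
    (m : Measure P1) [IsProbabilityMeasure m]
    (hna : ∀ v : P1, m {v} = 0) :
    (1 : SL2) ∈ {M : SL2 | Measure.map (projAct M) m = m} ∧
    (∀ M N : SL2, M ∈ {M : SL2 | Measure.map (projAct M) m = m} →
      N ∈ {M : SL2 | Measure.map (projAct M) m = m} →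
      M * N ∈ {M : SL2 | Measure.map (projAct M) m = m}) ∧
    (∀ M : SL2, M ∈ {M : SL2 | Measure.map (projAct M) m = m} →
      M⁻¹ ∈ {M : SL2 | Measure.map (projAct M) m = m}) ∧
    IsCompact {M : SL2 | Measure.map (projAct M) m = m} := by
  have hmul : ∀ M N : SL2, Measure.map (projAct (M * N)) m =
      Measure.map (projAct M) (Measure.map (projAct N) m) := by
    intro M N
    rw [act_mul, Measure.map_map (continuous_act M).measurable (continuous_act N).measurable]
  have hone : Measure.map (projAct 1) m = m := by rw [act_one, Measure.map_id]
  refine ⟨hone, ?_, ?_, stab_compact m hna⟩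
  · intro M N hM hN
    simp only [Set.mem_ofPred_eq] at hM hN ⊢
    rw [hmul, hN, hM]
  · intro M hM
    simp only [Set.mem_ofPred_eq] at hM ⊢
    have := hmul M⁻¹ M
    rw [inv_mul_cancel, hone, hM] at this
    exact this.symm
end
end

section
/- Let ν be a probability measure on ℝ whose support is compact and contains at least two points, and let μ = ν^{ℕ} be the product measure on sequences (ω_1, ω_2, …) ∈ ℝ^{ℕ}. Fix E ∈ ℝ and let A_E(x) ∈ SL(2,ℝ) be the matrix with rows (E - x, -1) and (1, 0). Then there exists γ(E) > 0 such that for μ-almost every sequence ω, (1/n) log ‖A_E(ω_n) ⋯ A_E(ω_1)‖ → γ(E) as n → ∞. -/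
open MeasureTheory Filter

noncomputable section

/-- The one-step transfer matrix `A_E(x)` of the discrete Schrödinger equation. -/
def AE (E x : ℝ) : Matrix (Fin 2) (Fin 2) ℝ := !![E - x, -1; 1, 0]

/-- The `n`-step transfer matrix `A_E(ω_n) ⋯ A_E(ω_1)` (the value `ω 0` is unused). -/
def transferN (E : ℝ) (ω : ℕ → ℝ) : ℕ → Matrix (Fin 2) (Fin 2) ℝ
  | 0 => 1
  | n + 1 => AE E (ω (n + 1)) * transferN E ω n

section PK2
open MeasureTheory Filter

open scoped ENNReal

lemma ennreal_two_mul_le (p q : ℝ≥0∞) (θ : ℝ) (hθ : 0 < θ) :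
    2 * (p * q) ≤ p ^ 2 * ENNReal.ofReal θ + q ^ 2 * ENNReal.ofReal θ⁻¹ := by
  have h1 : ENNReal.ofReal θ ≠ 0 := by simpa using hθ
  have h2 : ENNReal.ofReal θ⁻¹ ≠ 0 := by simpa using hθ
  by_cases hp : p = ∞
  · subst hp; simp [ENNReal.top_mul h1]
  by_cases hq : q = ∞
  · subst hq; simp [ENNReal.top_mul h2]
  lift p to NNReal using hp
  lift q to NNReal using hq
  have e1 : (p : ℝ≥0∞) = ENNReal.ofReal (p : ℝ) := by simp
  have e2 : (q : ℝ≥0∞) = ENNReal.ofReal (q : ℝ) := by simp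
  have e3 : (2 : ℝ≥0∞) = ENNReal.ofReal 2 := by simp
  have hp0 : (0 : ℝ) ≤ p := p.2
  have hq0 : (0 : ℝ) ≤ q := q.2
  rw [e1, e2, e3, ← ENNReal.ofReal_pow hp0, ← ENNReal.ofReal_pow hq0, ← ENNReal.ofReal_mul hp0,
    ← ENNReal.ofReal_mul (by norm_num), ← ENNReal.ofReal_mul (by positivity),
    ← ENNReal.ofReal_mul (by positivity), ← ENNReal.ofReal_add (by positivity) (by positivity)]
  apply ENNReal.ofReal_le_ofReal
  have : (p : ℝ) ^ 2 * θ + (q : ℝ) ^ 2 * θ⁻¹ - 2 * (p * q) = θ⁻¹ * (p * θ - q) ^ 2 := by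
    field_simp; ring
  have h3 : 0 ≤ θ⁻¹ * ((p : ℝ) * θ - q) ^ 2 := by positivity
  linarith

/-- The pointwise (Schur test) inequality. -/
lemma schur_ineq (l R D s t : ℝ) (hl : 0 < l) (hD : |t| ≤ D)
    (hlarge : 100 * (R ^ 2 + D ^ 2) ≤ l) :
    (l + s ^ 2) / (l + (s + t) ^ 2) + (l + s ^ 2) / (l + (s - t) ^ 2)
      + (if |s| ≤ R then 3 * (t ^ 2 / l) else 0) ≤ 2 * (1 + 6 / 10 * (t ^ 2 / l)) := by
  have ht : t ^ 2 ≤ D ^ 2 := by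
    rw [← sq_abs t]; gcongr
  set T := t ^ 2 with hT
  set u := s ^ 2 with hu
  have hT0 : 0 ≤ T := sq_nonneg t
  have hu0 : 0 ≤ u := sq_nonneg s
  have hR0 : 0 ≤ R ^ 2 := sq_nonneg R
  have hTl : 100 * T ≤ l := by linarith
  have d1 : 0 < l + (s + t) ^ 2 := by positivity
  have d2 : 0 < l + (s - t) ^ 2 := by positivity
  have hDD : (l + (s + t) ^ 2) * (l + (s - t) ^ 2) = (l + u + T) ^ 2 - 4 * u * T := by
    rw [hu, hT]; ring
  have hDpos : 0 < (l + u + T) ^ 2 - 4 * u * T := by rw [← hDD]; positivity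
  have hsum : (l + u) / (l + (s + t) ^ 2) + (l + u) / (l + (s - t) ^ 2)
      = 2 * ((l + u) * (l + u + T)) / ((l + u + T) ^ 2 - 4 * u * T) := by
    rw [← hDD]
    field_simp
    rw [hu, hT]; ring
  have hsum2 : 2 * ((l + u) * (l + u + T)) / ((l + u + T) ^ 2 - 4 * u * T)
      = 2 - 2 * T * ((l - 3 * u + T) / ((l + u + T) ^ 2 - 4 * u * T)) := by
    rw [div_eq_iff hDpos.ne', sub_mul, mul_assoc (2 * T), div_mul_cancel₀ _ hDpos.ne']; ring
  rw [hsum, hsum2]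
  by_cases hs : |s| ≤ R
  · rw [if_pos hs]
    have hur : u ≤ R ^ 2 := by rw [hu, ← sq_abs s]; gcongr
    have key : 9 / 10 * (1 / l) ≤ (l - 3 * u + T) / ((l + u + T) ^ 2 - 4 * u * T) := by
      rw [le_div_iff₀ hDpos, mul_one_div, div_mul_eq_mul_div, div_le_iff₀ hl]
      nlinarith [mul_nonneg hu0 hT0, mul_nonneg hu0 hu0, mul_nonneg hT0 hT0]
    have := mul_le_mul_of_nonneg_left key hT0
    have e : T / l = T * (1 / l) := by ring
    rw [e]; linarith
  · rw [if_neg hs]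
    have key : -(6 / 10) * (1 / l) ≤ (l - 3 * u + T) / ((l + u + T) ^ 2 - 4 * u * T) := by
      rw [le_div_iff₀ hDpos, mul_one_div, div_mul_eq_mul_div, div_le_iff₀ hl]
      nlinarith [mul_nonneg hu0 hT0, mul_nonneg hu0 hu0, mul_nonneg hT0 hT0, sq_nonneg (3 * u - 5 * l),
        mul_nonneg hu0 hl.le]
    have := mul_le_mul_of_nonneg_left key hT0
    have e : T / l = T * (1 / l) := by ring
    rw [e]; linarith

lemma corr_bound (h : ℝ → ℝ≥0∞) (hm : Measurable h) (l R D t : ℝ) (hl : 0 < l) (hD : |t| ≤ D)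
    (hlarge : 100 * (R ^ 2 + D ^ 2) ≤ l) :
    (∫⁻ s, h s * h (s + t)) + ENNReal.ofReal (3 / 2 * (t ^ 2 / l)) * (∫⁻ s in {s | |s| ≤ R}, h s ^ 2)
      ≤ ENNReal.ofReal (1 + 6 / 10 * (t ^ 2 / l)) * ∫⁻ s, h s ^ 2 := by
  have hI : MeasurableSet {s : ℝ | |s| ≤ R} := measurableSet_le (by fun_prop) (by fun_prop)
  have pos : ∀ x : ℝ, 0 < l + x ^ 2 := fun x => by positivity
  let r1 : ℝ → ℝ := fun s => (l + s ^ 2) / (l + (s + t) ^ 2)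
  let r2 : ℝ → ℝ := fun s => (l + s ^ 2) / (l + (s - t) ^ 2)
  have hr1 : Measurable r1 := by fun_prop
  have hr2 : Measurable r2 := by fun_prop
  have h1 : 2 * (∫⁻ s, h s * h (s + t)) ≤
      (∫⁻ s, h s ^ 2 * ENNReal.ofReal (r1 s)) + ∫⁻ s, h s ^ 2 * ENNReal.ofReal (r2 s) := by
    calc 2 * (∫⁻ s, h s * h (s + t)) = ∫⁻ s, 2 * (h s * h (s + t)) := by
          rw [lintegral_const_mul _ (by fun_prop)]
      _ ≤ ∫⁻ s, (h s ^ 2 * ENNReal.ofReal (r1 s) + h (s + t) ^ 2 * ENNReal.ofReal (r2 (s + t))) := by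
          refine lintegral_mono fun s => ?_
          have := ennreal_two_mul_le (h s) (h (s + t)) (r1 s) (div_pos (pos _) (pos _))
          have e : (r1 s)⁻¹ = r2 (s + t) := by simp [r1, r2]
          rwa [e] at this
      _ = (∫⁻ s, h s ^ 2 * ENNReal.ofReal (r1 s)) +
            ∫⁻ s, h (s + t) ^ 2 * ENNReal.ofReal (r2 (s + t)) := by
          rw [lintegral_add_left (by fun_prop)]
      _ = _ := by
          rw [lintegral_add_right_eq_self (fun s => h s ^ 2 * ENNReal.ofReal (r2 s)) t]
  have h2 : 2 * (ENNReal.ofReal (3 / 2 * (t ^ 2 / l)) * (∫⁻ s in {s | |s| ≤ R}, h s ^ 2))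
      = ∫⁻ s, h s ^ 2 * ENNReal.ofReal (if |s| ≤ R then 3 * (t ^ 2 / l) else 0) := by
    have e : ∀ s, h s ^ 2 * ENNReal.ofReal (if |s| ≤ R then 3 * (t ^ 2 / l) else 0)
        = ENNReal.ofReal (3 * (t ^ 2 / l)) * {s : ℝ | |s| ≤ R}.indicator (fun s => h s ^ 2) s := by
      intro s
      by_cases hs : |s| ≤ R
      · rw [if_pos hs, Set.indicator_of_mem (by exact hs), mul_comm]
      · rw [if_neg hs, Set.indicator_of_notMem (by exact hs)]; simp
    simp_rw [e]
    rw [lintegral_const_mul _ ((hm.pow_const 2).indicator hI), lintegral_indicator hI, ← mul_assoc]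
    congr 1
    rw [show (2 : ℝ≥0∞) = ENNReal.ofReal 2 by simp, ← ENNReal.ofReal_mul (by norm_num)]
    congr 1; ring
  have h3 : 2 * ((∫⁻ s, h s * h (s + t)) +
      ENNReal.ofReal (3 / 2 * (t ^ 2 / l)) * (∫⁻ s in {s | |s| ≤ R}, h s ^ 2)) ≤
      2 * (ENNReal.ofReal (1 + 6 / 10 * (t ^ 2 / l)) * ∫⁻ s, h s ^ 2) := by
    rw [mul_add, h2]
    have hq : Measurable fun s : ℝ => if |s| ≤ R then 3 * (t ^ 2 / l) else 0 :=
      Measurable.ite hI measurable_const measurable_const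
    calc _ ≤ (∫⁻ s, h s ^ 2 * ENNReal.ofReal (r1 s)) + (∫⁻ s, h s ^ 2 * ENNReal.ofReal (r2 s)) +
          ∫⁻ s, h s ^ 2 * ENNReal.ofReal (if |s| ≤ R then 3 * (t ^ 2 / l) else 0) := by gcongr
      _ = ∫⁻ s, h s ^ 2 * ENNReal.ofReal (r1 s + r2 s + if |s| ≤ R then 3 * (t ^ 2 / l) else 0) := by
          rw [← lintegral_add_left (by fun_prop), ← lintegral_add_left (by fun_prop)]
          refine lintegral_congr fun s => ?_
          have p1 : 0 ≤ r1 s := (div_pos (pos _) (pos _)).le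
          have p2 : 0 ≤ r2 s := (div_pos (pos _) (pos _)).le
          have p3 : 0 ≤ if |s| ≤ R then 3 * (t ^ 2 / l) else 0 := by split_ifs <;> positivity
          rw [ENNReal.ofReal_add (by positivity) p3, ENNReal.ofReal_add p1 p2]; ring
      _ ≤ ∫⁻ s, h s ^ 2 * ENNReal.ofReal (2 * (1 + 6 / 10 * (t ^ 2 / l))) := by
          refine lintegral_mono fun s => ?_
          gcongr
          exact schur_ineq l R D s t hl hD hlarge
      _ = _ := by
          rw [lintegral_mul_const _ (by fun_prop), ENNReal.ofReal_mul (by norm_num)]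
          simp; ring
  exact (ENNReal.mul_le_mul_iff_right (by simp) (by simp)).1 h3

noncomputable def Kop (ν : Measure ℝ) (E : ℝ) (h : ℝ → ℝ≥0∞) (s : ℝ) : ℝ≥0∞ := ∫⁻ x, h (E - x + s) ∂ν

noncomputable def Jop (h : ℝ → ℝ≥0∞) (t : ℝ) : ℝ≥0∞ := ENNReal.ofReal |t|⁻¹ * h (-t⁻¹)

lemma measurable_Jop {h : ℝ → ℝ≥0∞} (hm : Measurable h) : Measurable (Jop h) := by
  unfold Jop; fun_prop

lemma measurable_Kop (ν : Measure ℝ) [IsProbabilityMeasure ν] (E : ℝ) {h : ℝ → ℝ≥0∞}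
    (hm : Measurable h) : Measurable (Kop ν E h) := by
  unfold Kop
  exact Measurable.lintegral_prod_right' (f := fun p : ℝ × ℝ => h (E - p.2 + p.1)) (by fun_prop)

lemma Jop_iso (h V : ℝ → ℝ≥0∞) :
    ∫⁻ t, Jop h t ^ 2 * V t = ∫⁻ s, h s ^ 2 * V (-s⁻¹) := by
  have him : (fun t : ℝ => -t⁻¹) '' ({0}ᶜ : Set ℝ) = {0}ᶜ := by
    ext y; constructor
    · rintro ⟨t, ht, rfl⟩; simpa using ht
    · intro hy; exact ⟨-y⁻¹, by simpa using hy, by simp [inv_neg]⟩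
  have hcv := lintegral_image_eq_lintegral_abs_deriv_mul (s := ({0}ᶜ : Set ℝ))
    (f := fun t : ℝ => -t⁻¹) (f' := fun t => (t ^ 2)⁻¹) (measurableSet_singleton 0).compl
    (fun t ht => by
      have := (hasDerivAt_inv (x := t) (by simpa using ht)).neg
      rw [neg_neg] at this
      exact this.hasDerivWithinAt)
    (fun a _ b _ hab => by simpa using hab) (fun s => h s ^ 2 * V (-s⁻¹))
  rw [him] at hcv
  have hz : (volume : Measure ℝ).restrict ({0}ᶜ : Set ℝ) = volume := by
    rw [Measure.restrict_eq_self_of_ae_mem]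
    exact compl_mem_ae_iff.2 (by simp)
  rw [hz] at hcv
  rw [hcv]
  have h0 : ∀ᵐ t : ℝ, t ≠ 0 := by
    exact compl_mem_ae_iff.2 (by simp : volume ({0} : Set ℝ) = 0)
  refine lintegral_congr_ae ?_
  filter_upwards [h0] with t ht
  unfold Jop
  have e : - (-t⁻¹)⁻¹ = t := by simp [inv_neg]
  rw [e, mul_pow, ← ENNReal.ofReal_pow (by positivity), abs_of_nonneg (by positivity : 0 ≤ (t ^ 2)⁻¹),
    inv_pow, sq_abs, mul_assoc]

lemma Jop_norm (h : ℝ → ℝ≥0∞) : ∫⁻ t, Jop h t ^ 2 = ∫⁻ s, h s ^ 2 := by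
  simpa using Jop_iso h (fun _ => 1)

lemma Kop_sq (ν : Measure ℝ) [IsProbabilityMeasure ν] (E : ℝ) {h : ℝ → ℝ≥0∞} (hm : Measurable h) :
    ∫⁻ s, Kop ν E h s ^ 2 = ∫⁻ x, ∫⁻ y, (∫⁻ s, h s * h (s + (x - y))) ∂ν ∂ν := by
  have h1 : ∀ s, Kop ν E h s ^ 2 = ∫⁻ x, ∫⁻ y, h (E - x + s) * h (E - y + s) ∂ν ∂ν := by
    intro s
    have : ∀ x, ∫⁻ y, h (E - x + s) * h (E - y + s) ∂ν = h (E - x + s) * Kop ν E h s := fun x =>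
      lintegral_const_mul _ (by fun_prop)
    simp_rw [this]
    rw [lintegral_mul_const _ (by fun_prop), sq]; rfl
  simp_rw [h1]
  rw [lintegral_lintegral_swap]
  · refine lintegral_congr fun x => ?_
    rw [lintegral_lintegral_swap]
    · refine lintegral_congr fun y => ?_
      rw [← lintegral_add_left_eq_self (fun s => h s * h (s + (x - y))) (E - x)]
      refine lintegral_congr fun s => ?_
      congr 2; ring
    · simp only [Function.uncurry_def]; fun_prop
  · exact (Measurable.lintegral_prod_right' (f := fun p : (ℝ × ℝ) × ℝ =>
      h (E - p.1.2 + p.1.1) * h (E - p.2 + p.1.1)) (by fun_prop)).aemeasurable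

lemma Kop_main (ν : Measure ℝ) [IsProbabilityMeasure ν] (E B : ℝ) (hB : ∀ᵐ x ∂ν, |x| ≤ B)
    {h : ℝ → ℝ≥0∞} (hm : Measurable h) (l R : ℝ) (hl : 0 < l)
    (hlarge : 100 * (R ^ 2 + (2 * B) ^ 2) ≤ l) (v : ℝ) (hv : v = ∫ x, ∫ y, (x - y) ^ 2 ∂ν ∂ν) :
    (∫⁻ s, Kop ν E h s ^ 2) + ENNReal.ofReal (3 / 2 * (v / l)) * (∫⁻ s in {s | |s| ≤ R}, h s ^ 2)
      ≤ ENNReal.ofReal (1 + 6 / 10 * (v / l)) * ∫⁻ s, h s ^ 2 := by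
  have hint1 : ∀ᵐ x ∂ν, Integrable (fun y => (x - y) ^ 2) ν := by
    filter_upwards [hB] with x hx
    refine Integrable.of_bound (by fun_prop) ((2 * B) ^ 2) ?_
    filter_upwards [hB] with y hy
    rw [Real.norm_of_nonneg (sq_nonneg _), ← sq_abs]
    have := abs_sub x y
    gcongr; linarith
  have hint2 : Integrable (fun x => ∫ y, (x - y) ^ 2 ∂ν) ν := by
    refine Integrable.of_bound (C := (2 * B) ^ 2) ?_ ?_
    · exact (StronglyMeasurable.integral_prod_right' (f := fun p : ℝ × ℝ => (p.1 - p.2) ^ 2)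
        (by fun_prop : Measurable fun p : ℝ × ℝ => (p.1 - p.2) ^ 2).stronglyMeasurable).aestronglyMeasurable
    · filter_upwards [hB] with x hx
      have := norm_integral_le_of_norm_le_const (μ := ν) (f := fun y => (x - y) ^ 2) (C := (2 * B) ^ 2) ?_
      · simpa using this
      filter_upwards [hB] with y hy
      rw [Real.norm_of_nonneg (sq_nonneg _), ← sq_abs]
      have := abs_sub x y
      gcongr; linarith
  have hv0 : 0 ≤ v := by rw [hv]; positivity
  have hlin : ∀ c d : ℝ, 0 ≤ c → 0 ≤ d →
      ∫⁻ x, ∫⁻ y, ENNReal.ofReal (d + c * ((x - y) ^ 2 / l)) ∂ν ∂ν = ENNReal.ofReal (d + c * (v / l)) := by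
    intro c d hc hd
    have e1 : ∀ᵐ x ∂ν, ∫⁻ y, ENNReal.ofReal (d + c * ((x - y) ^ 2 / l)) ∂ν
        = ENNReal.ofReal (d + c * ((∫ y, (x - y) ^ 2 ∂ν) / l)) := by
      filter_upwards [hint1] with x hx
      rw [← ofReal_integral_eq_lintegral_ofReal]
      · rw [integral_add (integrable_const _) ((hx.div_const l).const_mul c), integral_const_mul,
          integral_div]; simp
      · exact (integrable_const _).add ((hx.div_const l).const_mul c)
      · exact Eventually.of_forall fun y => by simp only [Pi.zero_apply]; positivity
    rw [lintegral_congr_ae e1, ← ofReal_integral_eq_lintegral_ofReal]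
    · rw [integral_add (integrable_const _) ((hint2.div_const l).const_mul c), integral_const_mul,
          integral_div, hv]; simp
    · exact (integrable_const _).add ((hint2.div_const l).const_mul c)
    · refine Eventually.of_forall fun y => ?_
      have : 0 ≤ ∫ y', (y - y') ^ 2 ∂ν := integral_nonneg fun _ => sq_nonneg _
      simp only [Pi.zero_apply]; positivity
  set m := ∫⁻ s in {s | |s| ≤ R}, h s ^ 2
  set N := ∫⁻ s, h s ^ 2
  have l1 := hlin (3 / 2) 0 (by norm_num) le_rfl
  have l2 := hlin (6 / 10) 1 (by norm_num) (by norm_num)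
  simp only [zero_add] at l1
  rw [Kop_sq ν E hm, ← l1, ← l2]
  have mm : ∀ c d : ℝ, Measurable fun p : ℝ × ℝ => ENNReal.ofReal (d + c * ((p.1 - p.2) ^ 2 / l)) := by
    intro c d; fun_prop
  have mm0 : Measurable fun p : ℝ × ℝ => ENNReal.ofReal (3 / 2 * ((p.1 - p.2) ^ 2 / l)) := by fun_prop
  rw [← lintegral_mul_const _ (Measurable.lintegral_prod_right' (mm _ _)),
    ← lintegral_mul_const _ (Measurable.lintegral_prod_right' mm0),
    ← lintegral_add_right _ ((Measurable.lintegral_prod_right' mm0).mul_const _)]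
  refine lintegral_mono_ae ?_
  filter_upwards [hB] with x hx
  rw [← lintegral_mul_const _ (by fun_prop), ← lintegral_mul_const _ (by fun_prop),
    ← lintegral_add_right _ (by fun_prop)]
  refine lintegral_mono_ae ?_
  filter_upwards [hB] with y hy
  refine corr_bound h hm l R (2 * B) (x - y) hl ?_ hlarge
  have := abs_sub x y
  linarith

lemma Kop_local (ν : Measure ℝ) [IsProbabilityMeasure ν] (E B : ℝ) (hB : ∀ᵐ x ∂ν, |x| ≤ B)
    {h : ℝ → ℝ≥0∞} (hm : Measurable h) (R : ℝ) (hR : 1 + |E| + B ≤ R) :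
    ∫⁻ s in {s | |s| ≤ 1}, Kop ν E h s ^ 2 ≤ ∫⁻ s in {s | |s| ≤ R}, h s ^ 2 := by
  have hI : ∀ R, MeasurableSet {s : ℝ | |s| ≤ R} := fun R => measurableSet_le (by fun_prop) (by fun_prop)
  have h1 : ∀ s, Kop ν E h s ^ 2 ≤ ∫⁻ x, h (E - x + s) ^ 2 ∂ν := by
    intro s
    have := ENNReal.lintegral_mul_le_Lp_mul_Lq ν (p := 2) (q := 2) Real.HolderConjugate.two_two
      (f := fun x => h (E - x + s)) (g := fun _ => 1) (by fun_prop) (by fun_prop)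
    simp only [Pi.mul_apply, mul_one, ENNReal.one_rpow, lintegral_const, measure_univ] at this
    have h2 := pow_le_pow_left' this 2
    rw [← ENNReal.rpow_natCast (_ ^ _), ← ENNReal.rpow_mul] at h2
    simpa [Kop] using h2
  calc _ ≤ ∫⁻ s in {s | |s| ≤ 1}, ∫⁻ x, h (E - x + s) ^ 2 ∂ν := lintegral_mono fun s => h1 s
    _ = ∫⁻ x, (∫⁻ s in {s | |s| ≤ 1}, h (E - x + s) ^ 2) ∂ν := by
        rw [lintegral_lintegral_swap]
        simp only [Function.uncurry_def]; fun_prop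
    _ ≤ ∫⁻ x, (∫⁻ s in {s | |s| ≤ R}, h s ^ 2) ∂ν := by
        refine lintegral_mono_ae ?_
        filter_upwards [hB] with x hx
        rw [← lintegral_indicator (hI _), ← lintegral_indicator (hI _),
          
          ← lintegral_add_left_eq_self (Set.indicator {s | |s| ≤ R} _) (E - x)]
        refine lintegral_mono fun s => ?_
        by_cases hs : |s| ≤ 1
        · rw [Set.indicator_of_mem (by exact hs), Set.indicator_of_mem]
          show |E - x + s| ≤ R
          have a1 := abs_add_le (E - x) s
          have a2 := abs_sub E x
          linarith
        · rw [Set.indicator_of_notMem (by exact hs)]; exact zero_le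
    _ = _ := by simp

lemma two_step (ν : Measure ℝ) [IsProbabilityMeasure ν] (E B : ℝ) (hB : ∀ᵐ x ∂ν, |x| ≤ B)
    (v : ℝ) (hv : v = ∫ x, ∫ y, (x - y) ^ 2 ∂ν ∂ν) (hv0 : 0 < v) :
    ∃ ρ : ℝ, 0 < ρ ∧ ρ < 1 ∧ ∀ h : ℝ → ℝ≥0∞, Measurable h → ∫⁻ s, h s ^ 2 ≠ ∞ →
      ∫⁻ s, Jop (Kop ν E (Jop (Kop ν E h))) s ^ 2 ≤ ENNReal.ofReal ρ * ∫⁻ s, h s ^ 2 := by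
  have hB0 : 0 ≤ B := by
    obtain ⟨x, hx⟩ := hB.exists
    exact (abs_nonneg x).trans hx
  set R := 1 + |E| + B with hR
  have hR1 : 1 ≤ R := by have := abs_nonneg E; linarith
  set l := 100 * (R ^ 2 + (2 * B) ^ 2) + 100 * v with hl
  have hl0 : 0 < l := by positivity
  set τ := v / l with hτ
  have hτ0 : 0 < τ := by positivity
  have hτ1 : τ ≤ 1 / 100 := by
    rw [hτ, div_le_iff₀ hl0, hl]; nlinarith [sq_nonneg R, sq_nonneg B]
  refine ⟨1 - 3 / 10 * τ + 81 / 100 * τ ^ 2, by nlinarith, by nlinarith, fun h hm hfin => ?_⟩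
  have hI : ∀ R, MeasurableSet {s : ℝ | |s| ≤ R} := fun R => measurableSet_le (by fun_prop) (by fun_prop)
  have hKm := measurable_Kop ν E hm
  set g := Jop (Kop ν E h) with hg
  have hgm : Measurable g := measurable_Jop hKm
  have A1 := Kop_main ν E B hB hm l R hl0 (by rw [hl]; linarith) v hv
  have A2 := Kop_main ν E B hB hgm l R hl0 (by rw [hl]; linarith) v hv
  have A3 := Kop_local ν E B hB hm R le_rfl
  rw [Jop_norm]
  have hN : ∫⁻ s, g s ^ 2 = ∫⁻ s, Kop ν E h s ^ 2 := Jop_norm _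
  rw [hN] at A2
  have A4 : ∫⁻ s, Kop ν E h s ^ 2 ≤
      (∫⁻ s in {s | |s| ≤ R}, g s ^ 2) + ∫⁻ s in {s | |s| ≤ 1}, Kop ν E h s ^ 2 := by
    have e : ∫⁻ s in {s | |s| ≤ R}, g s ^ 2 =
        ∫⁻ s, Kop ν E h s ^ 2 * {s : ℝ | |s| ≤ R}.indicator (fun _ => 1) (-s⁻¹) := by
      rw [← Jop_iso, ← lintegral_indicator (hI R)]
      refine lintegral_congr fun s => ?_
      by_cases hs : |s| ≤ R
      · rw [Set.indicator_of_mem (by exact hs), Set.indicator_of_mem (by exact hs), mul_one]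
      · rw [Set.indicator_of_notMem (by exact hs), Set.indicator_of_notMem (by exact hs), mul_zero]
    rw [e, ← lintegral_indicator (hI 1), ← lintegral_add_right _ ((hKm.pow_const 2).indicator (hI 1))]
    refine lintegral_mono fun s => ?_
    by_cases hs : |s| ≤ 1
    · rw [Set.indicator_of_mem (s := {s : ℝ | |s| ≤ 1}) (by exact hs)]; exact le_add_self
    · rw [Set.indicator_of_mem, mul_one]
      · exact le_self_add
      · show |-s⁻¹| ≤ R
        push Not at hs
        rw [abs_neg, abs_inv]
        exact (inv_le_one_of_one_le₀ hs.le).trans hR1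
  have A5 : ∫⁻ s in {s | |s| ≤ R}, h s ^ 2 ≤ ∫⁻ s, h s ^ 2 := setLIntegral_le_lintegral _ _
  have A6 : ∫⁻ s in {s | |s| ≤ R}, g s ^ 2 ≤ ∫⁻ s, g s ^ 2 := setLIntegral_le_lintegral _ _
  rw [hN] at A6
  generalize ∫⁻ s, Kop ν E g s ^ 2 = Xg at *
  generalize ∫⁻ s, Kop ν E h s ^ 2 = Xh at *
  generalize ∫⁻ s, h s ^ 2 = N at *
  generalize ∫⁻ s in {s | |s| ≤ R}, h s ^ 2 = m at *
  generalize ∫⁻ s in {s | |s| ≤ R}, g s ^ 2 = mg at *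
  generalize ∫⁻ s in {s | |s| ≤ 1}, Kop ν E h s ^ 2 = M at *
  have f1 : Xh ≠ ∞ := ne_top_of_le_ne_top (ENNReal.mul_ne_top (by simp) hfin) (le_self_add.trans A1)
  have f2 : Xg ≠ ∞ := ne_top_of_le_ne_top (ENNReal.mul_ne_top (by simp) f1) (le_self_add.trans A2)
  have f3 : m ≠ ∞ := ne_top_of_le_ne_top hfin A5
  have f4 : mg ≠ ∞ := ne_top_of_le_ne_top f1 A6
  have f5 : M ≠ ∞ := ne_top_of_le_ne_top f3 A3
  lift Xg to NNReal using f2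
  lift Xh to NNReal using f1
  lift N to NNReal using hfin
  lift m to NNReal using f3
  lift mg to NNReal using f4
  lift M to NNReal using f5
  have cv : ∀ x : NNReal, (x : ℝ≥0∞) = ENNReal.ofReal (x : ℝ) := fun x => by simp
  have nn : ∀ x : NNReal, (0 : ℝ) ≤ x := fun x => x.2
  simp only [cv] at A1 A2 A3 A4 A5 ⊢
  have n1 := nn Xg; have n2 := nn Xh; have n3 := nn N; have n4 := nn m; have n5 := nn mg
  have n6 := nn M
  rw [← ENNReal.ofReal_mul (by positivity), ← ENNReal.ofReal_mul (by positivity),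
    ← ENNReal.ofReal_add (by positivity) (by positivity),
    ENNReal.ofReal_le_ofReal_iff (by positivity)] at A1 A2
  rw [ENNReal.ofReal_le_ofReal_iff (by positivity)] at A3 A5
  rw [← ENNReal.ofReal_add (by positivity) (by positivity),
    ENNReal.ofReal_le_ofReal_iff (by positivity)] at A4
  rw [← ENNReal.ofReal_mul (by nlinarith)]
  apply ENNReal.ofReal_le_ofReal
  -- real arithmetic
  have B1 : (Xg : ℝ) ≤ (1 - 9 / 10 * τ) * Xh + 3 / 2 * τ * m := by nlinarith
  have B2 : (1 - 9 / 10 * τ) * (Xh : ℝ) ≤ (1 - 9 / 10 * τ) * ((1 + 6 / 10 * τ) * N - 3 / 2 * τ * m) := by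
    apply mul_le_mul_of_nonneg_left <;> linarith
  have B3 : τ ^ 2 * (m : ℝ) ≤ τ ^ 2 * N := by gcongr
  nlinarith

end PK2

section PK4
open MeasureTheory Filter

lemma greedy_bound (a : ℕ → ℕ → ℝ) (b : ℕ → ℝ) (hb : ∀ i, 0 ≤ b i) (C c : ℝ) (N : ℕ) (hc : 0 ≤ c)
    (hC0 : 0 ≤ C)
    (hC : ∀ i n, a i n ≤ n * C) (hsub : ∀ i m n, a i (m + n) ≤ a i m + a (i + m) n)
    (hgood : ∀ i, (∃ n, 1 ≤ n ∧ n ≤ N ∧ a i n ≤ n * c) ∨ a i 1 ≤ b i) :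
    ∀ L i, a i L ≤ L * c + ∑ j ∈ Finset.range L, b (i + j) + C * N := by
  intro L
  induction L using Nat.strong_induction_on with
  | _ L ih =>
    intro i
    have hsum : 0 ≤ ∑ j ∈ Finset.range L, b (i + j) := Finset.sum_nonneg fun _ _ => hb _
    by_cases hLN : L ≤ N
    · have h1 := hC i L
      have h2 : (L : ℝ) ≤ N := by exact_mod_cast hLN
      have h3 : 0 ≤ (L : ℝ) * c := by positivity
      nlinarith
    · push Not at hLN
      rcases hgood i with ⟨n, hn1, hnN, hn⟩ | hbad
      · obtain ⟨M, rfl⟩ : ∃ M, L = n + M := ⟨L - n, by omega⟩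
        have h1 := ih M (by omega) (i + n)
        have h2 := hsub i n M
        rw [Finset.sum_range_add]
        have h3 : 0 ≤ ∑ j ∈ Finset.range n, b (i + j) := Finset.sum_nonneg fun _ _ => hb _
        have h4 : ∑ j ∈ Finset.range M, b (i + n + j) = ∑ j ∈ Finset.range M, b (i + (n + j)) := by
          simp only [add_assoc]
        push_cast
        linarith
      · obtain ⟨M, rfl⟩ : ∃ M, L = 1 + M := ⟨L - 1, by omega⟩
        have h1 := ih M (by omega) (i + 1)
        have h2 := hsub i 1 M
        rw [Finset.sum_range_add]
        have h4 : ∑ j ∈ Finset.range M, b (i + 1 + j) = ∑ j ∈ Finset.range M, b (i + (1 + j)) := by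
          simp only [add_assoc]
        simp only [Finset.sum_range_one, add_zero]
        push_cast
        linarith

section king
set_option linter.unusedSectionVars false
variable {Ω : Type*} [MeasurableSpace Ω] {μ : Measure Ω} [IsProbabilityMeasure μ] {S : Ω → Ω}
  {X : ℕ → Ω → ℝ} {C : ℝ}

lemma king_div_nonneg (h0 : ∀ n ω, 0 ≤ X n ω) (n : ℕ) (ω : Ω) : 0 ≤ X n ω / n :=
  div_nonneg (h0 n ω) (Nat.cast_nonneg n)

lemma king_C (h0 : ∀ n ω, 0 ≤ X n ω) (hC : ∀ n ω, X n ω ≤ n * C) (ω : Ω) : 0 ≤ C := by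
  have := (h0 1 ω).trans (hC 1 ω)
  simpa using this

lemma king_div_le (h0 : ∀ n ω, 0 ≤ X n ω) (hC : ∀ n ω, X n ω ≤ n * C) (n : ℕ) (ω : Ω) :
    X n ω / n ≤ C := by
  rcases Nat.eq_zero_or_pos n with rfl | hn
  · simpa using king_C h0 hC ω
  · rw [div_le_iff₀ (by exact_mod_cast hn), mul_comm]
    exact hC n ω

lemma king_g_inv (h0 : ∀ n ω, 0 ≤ X n ω) (hC : ∀ n ω, X n ω ≤ n * C)
    (hinv : ∀ n ω, X n (S ω) ≤ X (n + 1) ω + C) (ω : Ω) :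
    liminf (fun n : ℕ => X n (S ω) / n) atTop ≤ liminf (fun n : ℕ => X n ω / n) atTop := by
  have hbd : ∀ ω, IsBoundedUnder (· ≥ ·) atTop (fun n : ℕ => X n ω / n) := fun ω =>
    isBoundedUnder_of ⟨0, fun n => king_div_nonneg h0 n ω⟩
  have hcb : ∀ ω, IsCoboundedUnder (· ≥ ·) atTop (fun n : ℕ => X n ω / n) := fun ω =>
    (isBoundedUnder_of ⟨C, fun n => king_div_le h0 hC n ω⟩ :
      IsBoundedUnder (· ≤ ·) atTop (fun n : ℕ => X n ω / n)).isCoboundedUnder_ge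
  refine le_of_forall_pos_le_add fun ε hε => ?_
  set g := liminf (fun n : ℕ => X n ω / n) atTop with hg
  have hfr : ∃ᶠ n : ℕ in atTop, X n ω / n < g + ε / 2 :=
    frequently_lt_of_liminf_lt (hcb ω) (by rw [← hg]; linarith)
  have hgC : 0 ≤ g := by
    rw [hg]; exact le_liminf_of_le (hcb ω) (Eventually.of_forall fun n => king_div_nonneg h0 n ω)
  refine liminf_le_of_frequently_le ?_ (hbd _)
  have hlarge : ∀ᶠ n : ℕ in atTop, (2 * (g + C + ε) / ε + 2 : ℝ) ≤ n :=
    tendsto_natCast_atTop_atTop.eventually_ge_atTop _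
  have hCC := king_C h0 hC ω
  have h2 := hfr.and_eventually hlarge
  rw [frequently_atTop] at h2 ⊢
  intro a
  obtain ⟨n, hn, h3, h4⟩ := h2 (a + 1)
  refine ⟨n - 1, by omega, ?_⟩
  obtain ⟨m, rfl⟩ : ∃ m, n = m + 1 := ⟨n - 1, by omega⟩
  simp only [Nat.add_sub_cancel]
  have h5 : (2 * (g + C + ε) / ε : ℝ) ≤ m := by push_cast at h4; linarith
  have hm1 : (1 : ℝ) ≤ m := by
    push_cast at h4
    have : 0 ≤ (2 * (g + C + ε) / ε : ℝ) := by positivity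
    linarith
  rw [div_le_iff₀ hε] at h5
  rw [div_lt_iff₀ (by positivity)] at h3
  rw [div_le_iff₀ (by linarith)]
  have h6 := hinv m ω
  push_cast at h3
  nlinarith

theorem kingman_abs (hS : MeasurePreserving S μ μ) (hXm : ∀ n, Measurable (X n))
    (h0 : ∀ n ω, 0 ≤ X n ω) (hC : ∀ n ω, X n ω ≤ n * C)
    (hsub : ∀ m n ω, X (m + n) ω ≤ X m ω + X n (S^[m] ω))
    (hinv : ∀ n ω, X n (S ω) ≤ X (n + 1) ω + C)
    (hslln : ∀ m, 0 < m → ∀ᵐ ω ∂μ, Tendsto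
      (fun k : ℕ => (∑ j ∈ Finset.range k, X m (S^[m * j] ω)) / k) atTop (nhds (∫ ω, X m ω ∂μ)))
    (c K : ℝ) (hc : 0 < c) (hlow : ∀ n : ℕ, c * n - K ≤ ∫ ω, X (2 * n) ω ∂μ) :
    ∃ γ : ℝ, 0 < γ ∧ ∀ᵐ ω ∂μ, Tendsto (fun n : ℕ => (1 / (n : ℝ)) * X n ω) atTop (nhds γ) := by
  obtain ⟨ω₀⟩ : Nonempty Ω := nonempty_of_isProbabilityMeasure μ
  have hC0 : 0 ≤ C := king_C h0 hC ω₀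
  have hIntg : ∀ n, Integrable (X n) μ := fun n =>
    Integrable.of_bound (hXm n).aestronglyMeasurable (n * C)
      (Eventually.of_forall fun ω => by rw [Real.norm_of_nonneg (h0 n ω)]; exact hC n ω)
  have hSi : ∀ m, MeasurePreserving (S^[m]) μ μ := fun m => hS.iterate m
  set u : ℕ → ℝ := fun n => ∫ ω, X n ω ∂μ with hu
  have husub : Subadditive u := by
    intro m n
    have h1 : ∫ ω, X n (S^[m] ω) ∂μ = ∫ ω, X n ω ∂μ := by
      rw [← integral_map (hSi m).measurable.aemeasurable
        (by rw [(hSi m).map_eq]; exact (hXm n).aestronglyMeasurable), (hSi m).map_eq]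
    have h2 : Integrable (fun ω => X n (S^[m] ω)) μ := (hSi m).integrable_comp_of_integrable (hIntg n)
    calc u (m + n) ≤ ∫ ω, (X m ω + X n (S^[m] ω)) ∂μ :=
          integral_mono (hIntg _) ((hIntg m).add h2) (hsub m n)
      _ = u m + u n := by rw [integral_add (hIntg m) h2, h1]
  have hu0 : ∀ n, 0 ≤ u n := fun n => integral_nonneg (h0 n)
  have hbdd : BddBelow (Set.range fun n => u n / n) := ⟨0, by
    rintro _ ⟨n, rfl⟩; exact div_nonneg (hu0 n) (Nat.cast_nonneg n)⟩
  set β := husub.lim with hβ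
  have hβt : Tendsto (fun n => u n / n) atTop (nhds β) := husub.tendsto_lim hbdd
  have hβle : ∀ n : ℕ, n ≠ 0 → β ≤ u n / n := fun n hn => husub.lim_le_div hbdd hn
  have hβc : c / 2 ≤ β := by
    have h1 : Tendsto (fun n : ℕ => (c - K / (n : ℝ)) / 2) atTop (nhds ((c - 0) / 2)) :=
      (tendsto_const_nhds.sub (tendsto_const_div_atTop_nhds_zero_nat K)).div_const 2
    rw [sub_zero] at h1
    have h2 : Tendsto (fun n : ℕ => 2 * n) atTop atTop := tendsto_id.const_mul_atTop' two_pos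
    refine le_of_tendsto_of_tendsto h1 (hβt.comp h2) ?_
    filter_upwards [eventually_gt_atTop 0] with n hn
    have hn' : (0 : ℝ) < n := by exact_mod_cast hn
    simp only [Function.comp_apply]
    push_cast
    rw [le_div_iff₀ (by positivity)]
    have := hlow n
    have h3 : (c - K / n) / 2 * (2 * n) = c * n - K := by field_simp
    rw [h3]; exact this
  refine ⟨β, (half_pos hc).trans_le hβc, ?_⟩
  -- upper bound
  have hup : ∀ᵐ ω ∂μ, ∀ ε > 0, ∀ᶠ n : ℕ in atTop, X n ω / n < β + ε := by
    have hall : ∀ᵐ ω ∂μ, ∀ m, 0 < m → Tendsto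
      (fun k : ℕ => (∑ j ∈ Finset.range k, X m (S^[m * j] ω)) / k) atTop (nhds (∫ ω, X m ω ∂μ)) := by
      rw [ae_all_iff]; intro m
      by_cases hm : 0 < m
      · filter_upwards [hslln m hm] with ω h _ using h
      · filter_upwards with ω h; exact absurd h hm
    filter_upwards [hall] with ω hω ε hε
    obtain ⟨m, hm, hm1⟩ : ∃ m : ℕ, u m / m < β + ε / 3 ∧ 0 < m :=
      ((hβt.eventually_lt_const (by linarith : β < β + ε / 3)).and (eventually_gt_atTop 0)).exists
    have hmR : (0 : ℝ) < m := by exact_mod_cast hm1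
    have hblock : ∀ k, X (m * k) ω ≤ ∑ j ∈ Finset.range k, X m (S^[m * j] ω) := by
      intro k
      induction k with
      | zero => simpa using hC 0 ω
      | succ k ih =>
        rw [Finset.sum_range_succ, Nat.mul_succ]
        exact (hsub _ _ _).trans (by linarith)
    have hev := (hω m hm1).eventually_lt_const
      (by nlinarith : ∫ ω, X m ω ∂μ < u m + m * (ε / 3))
    have hdiv : Tendsto (fun n : ℕ => n / m) atTop atTop := Nat.tendsto_div_const_atTop hm1.ne'
    have hlarge : ∀ᶠ n : ℕ in atTop, (3 * (m * C) / ε + 1 : ℝ) ≤ n :=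
      tendsto_natCast_atTop_atTop.eventually_ge_atTop _
    filter_upwards [hdiv.eventually hev, hlarge, hdiv.eventually (eventually_gt_atTop 0)] with n h1 h2 h3
    have hk : (0 : ℝ) < ((n / m : ℕ) : ℝ) := by exact_mod_cast h3
    rw [div_lt_iff₀ hk] at h1
    have hnn : m * (n / m) + n % m = n := Nat.div_add_mod n m
    have h4 := hsub (m * (n / m)) (n % m) ω
    rw [hnn] at h4
    have h5 := hC (n % m) (S^[m * (n / m)] ω)
    have h6 := hblock (n / m)
    have h7 : ((n % m : ℕ) : ℝ) ≤ m := by exact_mod_cast (Nat.mod_lt n hm1).le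
    have h8 : (m : ℝ) * ((n / m : ℕ) : ℝ) ≤ n := by
      exact_mod_cast Nat.mul_div_le n m
    have hCm : 0 ≤ m * C := by positivity
    have hnpos : (0 : ℝ) < n := by
      have : 0 ≤ (3 * (m * C) / ε : ℝ) := by positivity
      linarith
    rw [div_lt_iff₀ hnpos]
    rw [div_lt_iff₀ hmR] at hm
    have h9 : (3 * (m * C) / ε : ℝ) < n := by linarith
    rw [div_lt_iff₀ hε] at h9
    have h10 : u m + m * (ε / 3) ≤ m * (β + 2 * ε / 3) := by nlinarith
    have h11 : ((n % m : ℕ) : ℝ) * C ≤ m * C := by gcongr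
    have hβ0 : 0 ≤ β + 2 * ε / 3 := by linarith
    have h12 : (u m + m * (ε / 3)) * ((n / m : ℕ) : ℝ) ≤ (β + 2 * ε / 3) * n := by
      calc (u m + m * (ε / 3)) * ((n / m : ℕ) : ℝ) ≤ (m * (β + 2 * ε / 3)) * ((n / m : ℕ) : ℝ) := by gcongr
        _ = (β + 2 * ε / 3) * (m * ((n / m : ℕ) : ℝ)) := by ring
        _ ≤ _ := by gcongr
    nlinarith
  -- the liminf
  set g : Ω → ℝ := fun ω => liminf (fun n : ℕ => X n ω / n) atTop with hg
  have hbd : ∀ ω, IsBoundedUnder (· ≥ ·) atTop (fun n : ℕ => X n ω / n) := fun ω =>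
    isBoundedUnder_of ⟨0, fun n => king_div_nonneg h0 n ω⟩
  have hcb : ∀ ω, IsCoboundedUnder (· ≥ ·) atTop (fun n : ℕ => X n ω / n) := fun ω =>
    (isBoundedUnder_of ⟨C, fun n => king_div_le h0 hC n ω⟩ :
      IsBoundedUnder (· ≤ ·) atTop (fun n : ℕ => X n ω / n)).isCoboundedUnder_ge
  have hgm : Measurable g := Measurable.liminf fun n => (hXm n).div_const _
  have hg0 : ∀ ω, 0 ≤ g ω := fun ω =>
    le_liminf_of_le (hcb ω) (Eventually.of_forall fun n => king_div_nonneg h0 n ω)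
  have hgC : ∀ ω, g ω ≤ C := fun ω =>
    liminf_le_of_frequently_le (Eventually.of_forall fun n => king_div_le h0 hC n ω).frequently (hbd ω)
  have hgi : Integrable g μ := Integrable.of_bound hgm.aestronglyMeasurable C
      (Eventually.of_forall fun ω => by rw [Real.norm_of_nonneg (hg0 ω)]; exact hgC ω)
  have hginv : ∀ i ω, g (S^[i] ω) ≤ g ω := by
    intro i
    induction i with
    | zero => intro ω; simp
    | succ i ih =>
      intro ω
      rw [Function.iterate_succ_apply]
      exact (ih (S ω)).trans (king_g_inv h0 hC hinv ω)
  have hgle : ∀ᵐ ω ∂μ, g ω ≤ β := by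
    filter_upwards [hup] with ω hω
    refine le_of_forall_pos_le_add fun ε hε => ?_
    exact liminf_le_of_frequently_le ((hω ε hε).mono fun n hn => hn.le).frequently (hbd ω)
  have hEg : β ≤ ∫ ω, g ω ∂μ := by
    refine le_of_forall_pos_le_add fun ε hε => ?_
    set δ := ε / 3 with hδ
    have hδ0 : 0 < δ := by positivity
    let Bad : ℕ → Set Ω := fun N => {ω | ∀ n, 1 ≤ n → n ≤ N → n * (g ω + δ) < X n ω}
    have hBm : ∀ N, MeasurableSet (Bad N) := by
      intro N
      have : Bad N = ⋂ n, ⋂ (_ : 1 ≤ n), ⋂ (_ : n ≤ N), {ω | n * (g ω + δ) < X n ω} := by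
        ext ω; simp [Bad]
      rw [this]
      refine MeasurableSet.iInter fun n => MeasurableSet.iInter fun _ => MeasurableSet.iInter fun _ => ?_
      exact measurableSet_lt ((hgm.add_const δ).const_mul _) (hXm n)
    have hBanti : Antitone Bad := fun N M hNM ω hω n h1 h2 => hω n h1 (h2.trans hNM)
    have hBinter : ⋂ N, Bad N = ∅ := by
      rw [Set.eq_empty_iff_forall_notMem]
      intro ω hω
      have hfr : ∃ᶠ n : ℕ in atTop, X n ω / n < g ω + δ :=
        frequently_lt_of_liminf_lt (hcb ω) (by show g ω < g ω + δ; linarith)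
      obtain ⟨n, hn1, hn2⟩ := (hfr.and_eventually (eventually_ge_atTop 1)).exists
      have h3 := Set.mem_iInter.1 hω n n hn2 le_rfl
      rw [div_lt_iff₀ (by exact_mod_cast hn2)] at hn1
      linarith
    have hBt : Tendsto (fun N => μ.real (Bad N)) atTop (nhds 0) := by
      have := tendsto_measure_iInter_atTop (μ := μ) (fun N => (hBm N).nullMeasurableSet) hBanti
        ⟨0, measure_ne_top _ _⟩
      rw [hBinter, measure_empty] at this
      exact (ENNReal.tendsto_toReal ENNReal.zero_ne_top).comp this
    obtain ⟨N, hN⟩ : ∃ N, μ.real (Bad N) * C ≤ δ := by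
      have := hBt.mul_const C
      rw [zero_mul] at this
      exact (this.eventually_le_const hδ0).exists
    have hkey : ∀ L : ℕ, u L ≤ L * (∫ ω, g ω ∂μ) + L * δ + L * δ + C * N := by
      intro L
      have hpt : ∀ ω, X L ω ≤ L * (g ω + δ) +
          ∑ j ∈ Finset.range L, (Bad N).indicator (fun _ => C) (S^[j] ω) + C * N := by
        intro ω
        have := greedy_bound (fun i n => X n (S^[i] ω)) (fun i => (Bad N).indicator (fun _ => C) (S^[i] ω))
          (fun i => Set.indicator_nonneg (fun _ _ => hC0) _) C (g ω + δ) N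
          (by have := hg0 ω; positivity) hC0 (fun i n => hC n _)
          (fun i m n => by
            have := hsub m n (S^[i] ω)
            rw [← Function.iterate_add_apply, add_comm m i] at this
            exact this)
          (fun i => by
            by_cases hi : S^[i] ω ∈ Bad N
            · right
              simp only [Set.indicator_of_mem hi]
              simpa using hC 1 (S^[i] ω)
            · left
              simp only [Bad, Set.mem_ofPred_eq, not_forall, not_lt] at hi
              obtain ⟨n, h1, h2, h3⟩ := hi
              refine ⟨n, h1, h2, h3.trans ?_⟩
              have := hginv i ω
              gcongr) L 0
        simpa using this
      have hind : ∀ j, Integrable (fun ω => (Bad N).indicator (fun _ => C) (S^[j] ω)) μ := fun j =>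
        (hSi j).integrable_comp_of_integrable ((integrable_const C).indicator (hBm N))
      have hindI : ∀ j, ∫ ω, (Bad N).indicator (fun _ => C) (S^[j] ω) ∂μ = μ.real (Bad N) * C := by
        intro j
        rw [← integral_map (f := (Bad N).indicator (fun _ => C)) (hSi j).measurable.aemeasurable
          (by rw [(hSi j).map_eq]; exact (measurable_const.indicator (hBm N)).aestronglyMeasurable),
          (hSi j).map_eq, integral_indicator_const _ (hBm N), smul_eq_mul]
      have hi1 : Integrable (fun ω => L * (g ω + δ)) μ := (hgi.add (integrable_const δ)).const_mul _
      have hi2 : Integrable (fun ω => ∑ j ∈ Finset.range L, (Bad N).indicator (fun _ => C) (S^[j] ω)) μ :=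
        integrable_finsetSum _ fun j _ => hind j
      have hi12 : Integrable (fun ω => L * (g ω + δ) + ∑ j ∈ Finset.range L, (Bad N).indicator (fun _ => C) (S^[j] ω)) μ := hi1.add hi2
      calc u L ≤ ∫ ω, (L * (g ω + δ) +
          ∑ j ∈ Finset.range L, (Bad N).indicator (fun _ => C) (S^[j] ω) + C * N) ∂μ :=
            integral_mono (hIntg L) (hi12.add (integrable_const _)) hpt
        _ = L * ((∫ ω, g ω ∂μ) + δ) + L * (μ.real (Bad N) * C) + C * N := by
            rw [integral_add hi12 (integrable_const _), integral_add hi1 hi2,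
              integral_finsetSum _ (fun j _ => hind j), integral_const_mul,
              integral_add hgi (integrable_const _)]
            simp [hindI]
        _ ≤ _ := by
            have : (L : ℝ) * (μ.real (Bad N) * C) ≤ L * δ := by gcongr
            linarith
    obtain ⟨L, hL⟩ := exists_nat_gt (C * N / δ)
    have hL0 : (0 : ℝ) < L := lt_of_le_of_lt (by positivity) hL
    have h1 := hβle L (by rintro rfl; simp at hL0)
    rw [le_div_iff₀ hL0] at h1
    rw [div_lt_iff₀ hδ0] at hL
    have h2 := hkey L
    have h3 : β * L ≤ ((∫ ω, g ω ∂μ) + ε) * L := by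
      have : ε = 3 * δ := by rw [hδ]; ring
      rw [this]; nlinarith
    exact le_of_mul_le_mul_right h3 hL0
  have hgeq : ∀ᵐ ω ∂μ, g ω = β := by
    have h1 : 0 ≤ᵐ[μ] fun ω => β - g ω := by
      filter_upwards [hgle] with ω h; simpa using h
    have hi : Integrable (fun ω => β - g ω) μ := (integrable_const β).sub hgi
    have h2 : ∫ ω, (β - g ω) ∂μ = 0 := by
      refine le_antisymm ?_ (integral_nonneg_of_ae h1)
      rw [integral_sub (integrable_const β) hgi]; simp; exact hEg
    have h3 := (integral_eq_zero_iff_of_nonneg_ae h1 hi).1 h2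
    filter_upwards [h3] with ω h
    simp at h; linarith
  filter_upwards [hup, hgeq] with ω h1 h2
  have : (fun n : ℕ => (1 / (n : ℝ)) * X n ω) = fun n : ℕ => X n ω / n := by
    funext n; ring
  rw [this]
  refine tendsto_order.2 ⟨fun a ha => ?_, fun a ha => ?_⟩
  · refine eventually_lt_of_lt_liminf ?_ (hbd ω)
    show a < g ω
    rw [h2]; exact ha
  · have := h1 (a - β) (by linarith)
    simpa using this
end king

end PK4

section PK3
open MeasureTheory Filter
open scoped ENNReal
noncomputable section

lemma opNorm_mul_le (A B : Matrix (Fin 2) (Fin 2) ℝ) : opNorm (A * B) ≤ opNorm A * opNorm B := by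
  unfold opNorm
  rw [map_mul]; exact norm_mul_le _ _

lemma opNorm_apply (M : Matrix (Fin 2) (Fin 2) ℝ) (p q : ℝ) :
    √((M 0 0 * p + M 0 1 * q) ^ 2 + (M 1 0 * p + M 1 1 * q) ^ 2) ≤ opNorm M * √(p ^ 2 + q ^ 2) := by
  have := (Matrix.toEuclideanCLM (𝕜 := ℝ) M).le_opNorm (WithLp.toLp 2 ![p, q])
  rw [Matrix.toEuclideanCLM_toLp, EuclideanSpace.norm_eq, EuclideanSpace.norm_eq] at this
  simpa [Matrix.mulVec, dotProduct, Fin.sum_univ_two, opNorm] using this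

lemma opNorm_nonneg (M : Matrix (Fin 2) (Fin 2) ℝ) : 0 ≤ opNorm M := norm_nonneg _

lemma opNorm_le_entries (M : Matrix (Fin 2) (Fin 2) ℝ) :
    opNorm M ≤ |M 0 0| + |M 0 1| + |M 1 0| + |M 1 1| := by
  refine ContinuousLinearMap.opNorm_le_bound _ (by positivity) fun x => ?_
  have hx0 : |x 0| ≤ ‖x‖ := by simpa using PiLp.norm_apply_le x 0
  have hx1 : |x 1| ≤ ‖x‖ := by simpa using PiLp.norm_apply_le x 1
  have e : ‖Matrix.toEuclideanCLM (𝕜 := ℝ) M x‖ =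
      √((M 0 0 * x 0 + M 0 1 * x 1) ^ 2 + (M 1 0 * x 0 + M 1 1 * x 1) ^ 2) := by
    rw [EuclideanSpace.norm_eq]
    simp [Matrix.ofLp_toEuclideanCLM, Matrix.mulVec, dotProduct, Fin.sum_univ_two]
  rw [e]
  have b : ∀ a c : ℝ, |a * x 0 + c * x 1| ≤ (|a| + |c|) * ‖x‖ := by
    intro a c
    calc _ ≤ |a * x 0| + |c * x 1| := abs_add_le _ _
      _ = |a| * |x 0| + |c| * |x 1| := by rw [abs_mul, abs_mul]
      _ ≤ |a| * ‖x‖ + |c| * ‖x‖ := by gcongr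
      _ = _ := by ring
  have b0 := b (M 0 0) (M 0 1)
  have b1 := b (M 1 0) (M 1 1)
  have s : ∀ a c : ℝ, √(a ^ 2 + c ^ 2) ≤ |a| + |c| := by
    intro a c
    rw [Real.sqrt_le_left (by positivity), ← sq_abs a, ← sq_abs c]
    nlinarith [abs_nonneg a, abs_nonneg c]
  refine (s _ _).trans ?_
  linarith

lemma one_le_opNorm (M : Matrix (Fin 2) (Fin 2) ℝ) (h : M.det = 1) : 1 ≤ opNorm M := by
  rw [Matrix.det_fin_two] at h
  have h1 := opNorm_apply M 1 0
  have h2 := opNorm_apply M 0 1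
  simp only [mul_one, mul_zero, add_zero, zero_add, one_pow, ne_eq, OfNat.ofNat_ne_zero,
    not_false_eq_true, zero_pow, Real.sqrt_one] at h1 h2
  rw [Real.sqrt_le_left (opNorm_nonneg _)] at h1 h2
  have h3 := mul_le_mul h1 h2 (by positivity) (by positivity)
  have h4 : 1 ≤ (M 0 0 ^ 2 + M 1 0 ^ 2) * (M 0 1 ^ 2 + M 1 1 ^ 2) := by
    nlinarith [sq_nonneg (M 0 0 * M 0 1 + M 1 0 * M 1 1)]
  by_contra hlt
  push Not at hlt
  have h5 : opNorm M ^ 2 < 1 := by nlinarith [opNorm_nonneg M]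
  nlinarith [sq_nonneg (opNorm M)]

lemma det_AE (E x : ℝ) : (AE E x).det = 1 := by simp [AE, Matrix.det_fin_two]

lemma det_transferN (E : ℝ) (ω : ℕ → ℝ) (n : ℕ) : (transferN E ω n).det = 1 := by
  induction n with
  | zero => simp [transferN]
  | succ n ih => rw [transferN, Matrix.det_mul, ih, det_AE, one_mul]

lemma one_le_opNorm_transferN (E : ℝ) (ω : ℕ → ℝ) (n : ℕ) : 1 ≤ opNorm (transferN E ω n) :=
  one_le_opNorm _ (det_transferN E ω n)

lemma transferN_congr (E : ℝ) (ω ω' : ℕ → ℝ) (n : ℕ) (h : ∀ i, 1 ≤ i → i ≤ n → ω i = ω' i) :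
    transferN E ω n = transferN E ω' n := by
  induction n with
  | zero => rfl
  | succ n ih => rw [transferN, transferN, ih fun i h1 h2 => h i h1 (by omega), h (n + 1) (by omega) le_rfl]

lemma transferN_add (E : ℝ) (ω : ℕ → ℝ) (m n : ℕ) :
    transferN E ω (m + n) = transferN E (fun i => ω (i + m)) n * transferN E ω m := by
  induction n with
  | zero => simp [transferN]
  | succ n ih =>
    rw [← add_assoc, transferN, ih, transferN, Matrix.mul_assoc]
    congr 3; ring_nf

def AEinv (E x : ℝ) : Matrix (Fin 2) (Fin 2) ℝ := !![0, 1; -1, E - x]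

lemma transferN_shift_inv (E : ℝ) (ω : ℕ → ℝ) (n : ℕ) :
    transferN E (fun i => ω (i + 1)) n = transferN E ω (n + 1) * AEinv E (ω 1) := by
  have h1 : transferN E ω (n + 1) = transferN E (fun i => ω (i + 1)) n * AE E (ω 1) := by
    rw [add_comm n 1, transferN_add]; simp [transferN]
  have h2 : AE E (ω 1) * AEinv E (ω 1) = 1 := by
    ext i j; fin_cases i <;> fin_cases j <;> simp [AE, AEinv, Matrix.mul_apply, Fin.sum_univ_two]
  rw [h1, Matrix.mul_assoc, h2, Matrix.mul_one]

lemma opNorm_AE_le (E x B : ℝ) (hx : |x| ≤ B) : opNorm (AE E x) ≤ |E| + B + 2 := by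
  have := opNorm_le_entries (AE E x)
  have h2 := abs_sub E x
  simp only [AE] at this ⊢
  simp at this
  linarith

lemma opNorm_AEinv_le (E x B : ℝ) (hx : |x| ≤ B) : opNorm (AEinv E x) ≤ |E| + B + 2 := by
  have := opNorm_le_entries (AEinv E x)
  have h2 := abs_sub E x
  simp only [AEinv] at this ⊢
  simp at this
  linarith

lemma continuous_opNorm : Continuous opNorm := by
  unfold opNorm
  have : Continuous (Matrix.toEuclideanCLM (n := Fin 2) (𝕜 := ℝ)) :=
    LinearMap.continuous_of_finiteDimensional
      ((Matrix.toEuclideanCLM (n := Fin 2) (𝕜 := ℝ)).toAlgEquiv.toLinearMap)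
  exact continuous_norm.comp this

lemma continuous_transferN (E : ℝ) (n : ℕ) : Continuous fun ω : ℕ → ℝ => transferN E ω n := by
  induction n with
  | zero => exact continuous_const
  | succ n ih =>
    simp only [transferN]
    refine Continuous.matrix_mul ?_ ih
    refine continuous_matrix fun i j => ?_
    fin_cases i <;> fin_cases j <;> simp [AE] <;> fun_prop

def clampB (B x : ℝ) : ℝ := max (-B) (min B x)

lemma abs_clampB (B x : ℝ) (hB : 0 ≤ B) : |clampB B x| ≤ B := by
  unfold clampB
  rw [abs_le]
  exact ⟨le_max_left _ _, max_le (by linarith) (min_le_left _ _)⟩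

lemma clampB_eq (B x : ℝ) (hx : |x| ≤ B) : clampB B x = x := by
  rw [abs_le] at hx
  unfold clampB
  rw [min_eq_right hx.2, max_eq_right hx.1]

/-- log-norm of the transfer matrix with clamped potential -/
def XB (E B : ℝ) (n : ℕ) (ω : ℕ → ℝ) : ℝ := Real.log (opNorm (transferN E (fun i => clampB B (ω i)) n))

def shiftS (ω : ℕ → ℝ) : ℕ → ℝ := fun i => ω (i + 1)

lemma shiftS_iterate (m : ℕ) (ω : ℕ → ℝ) : shiftS^[m] ω = fun i => ω (i + m) := by
  induction m generalizing ω with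
  | zero => simp
  | succ m ih =>
    rw [Function.iterate_succ_apply, ih]
    funext i; simp [shiftS]; congr 1

lemma XB_nonneg (E B : ℝ) (n : ℕ) (ω : ℕ → ℝ) : 0 ≤ XB E B n ω :=
  Real.log_nonneg (one_le_opNorm_transferN _ _ _)

lemma XB_sub (E B : ℝ) (m n : ℕ) (ω : ℕ → ℝ) :
    XB E B (m + n) ω ≤ XB E B m ω + XB E B n (shiftS^[m] ω) := by
  rw [shiftS_iterate]
  unfold XB
  rw [transferN_add, add_comm, ← Real.log_mul]
  · apply Real.log_le_log
    · have := one_le_opNorm_transferN E (fun i => clampB B (ω i)) (m + n)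
      rw [transferN_add] at this
      exact one_pos.trans_le this
    · exact opNorm_mul_le _ _
  · exact (one_pos.trans_le (one_le_opNorm_transferN _ _ _)).ne'
  · exact (one_pos.trans_le (one_le_opNorm_transferN _ _ _)).ne'

lemma XB_one (E B : ℝ) (hB : 0 ≤ B) (ω : ℕ → ℝ) : XB E B 1 ω ≤ Real.log (|E| + B + 2) := by
  unfold XB
  apply Real.log_le_log (one_pos.trans_le (one_le_opNorm_transferN _ _ _))
  simp only [transferN, Matrix.mul_one]
  exact opNorm_AE_le E _ B (abs_clampB B _ hB)

lemma XB_le (E B : ℝ) (hB : 0 ≤ B) (n : ℕ) (ω : ℕ → ℝ) :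
    XB E B n ω ≤ n * Real.log (|E| + B + 2) := by
  induction n with
  | zero =>
    have : opNorm 1 ≤ 1 := by
      unfold opNorm; rw [map_one]; exact ContinuousLinearMap.norm_id_le
    simpa [XB, transferN] using Real.log_nonpos (opNorm_nonneg _) this
  | succ n ih =>
    have := XB_sub E B n 1 ω
    have h2 := XB_one E B hB (shiftS^[n] ω)
    push_cast; linarith

lemma XB_inv (E B : ℝ) (hB : 0 ≤ B) (n : ℕ) (ω : ℕ → ℝ) :
    XB E B n (shiftS ω) ≤ XB E B (n + 1) ω + Real.log (|E| + B + 2) := by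
  unfold XB
  have hp : 0 < |E| + B + 2 := by positivity
  rw [← Real.log_mul (one_pos.trans_le (one_le_opNorm_transferN _ _ _)).ne' hp.ne']
  apply Real.log_le_log (one_pos.trans_le (one_le_opNorm_transferN _ _ _))
  have := transferN_shift_inv E (fun i => clampB B (ω i)) n
  simp only [shiftS]
  rw [this]
  refine (opNorm_mul_le _ _).trans ?_
  exact mul_le_mul_of_nonneg_left (opNorm_AEinv_le E _ B (abs_clampB B _ hB)) (opNorm_nonneg _)

lemma measurable_XB (E B : ℝ) (n : ℕ) : Measurable (XB E B n) := by
  unfold XB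
  apply Real.measurable_log.comp
  have h : Continuous fun ω : ℕ → ℝ => fun i => clampB B (ω i) := by unfold clampB; fun_prop
  exact (continuous_opNorm.comp ((continuous_transferN E n).comp h)).measurable

/-- the evolution of a vector -/
def tv (E : ℝ) (v : ℝ × ℝ) (ω : ℕ → ℝ) : ℕ → ℝ × ℝ
  | 0 => v
  | n + 1 => ((E - ω (n + 1)) * (tv E v ω n).1 - (tv E v ω n).2, (tv E v ω n).1)

lemma tv_eq (E : ℝ) (v : ℝ × ℝ) (ω : ℕ → ℝ) (n : ℕ) :
    tv E v ω n = (transferN E ω n 0 0 * v.1 + transferN E ω n 0 1 * v.2,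
      transferN E ω n 1 0 * v.1 + transferN E ω n 1 1 * v.2) := by
  induction n with
  | zero => simp [tv, transferN]
  | succ n ih =>
    rw [tv, ih]
    ext <;> simp [transferN, AE, Matrix.mul_apply, Fin.sum_univ_two] <;> ring

lemma tv_congr (E : ℝ) (v : ℝ × ℝ) (ω ω' : ℕ → ℝ) (n : ℕ) (h : ∀ i, 1 ≤ i → i ≤ n → ω i = ω' i) :
    tv E v ω n = tv E v ω' n := by
  rw [tv_eq, tv_eq, transferN_congr E ω ω' n h]

lemma tv_norm (E : ℝ) (v : ℝ × ℝ) (ω : ℕ → ℝ) (n : ℕ) :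
    √((tv E v ω n).1 ^ 2 + (tv E v ω n).2 ^ 2) ≤ opNorm (transferN E ω n) * √(v.1 ^ 2 + v.2 ^ 2) := by
  rw [tv_eq]; exact opNorm_apply _ _ _

lemma measurable_tv (E : ℝ) (v : ℝ × ℝ) (n : ℕ) : Measurable fun ω => tv E v ω n := by
  induction n with
  | zero => exact measurable_const
  | succ n ih => simp only [tv]; fun_prop
end

end PK3

section PK5
open MeasureTheory Filter
section prodfacts
open ProbabilityTheory

variable {ν : Measure ℝ} [IsProbabilityMeasure ν] {μ : Measure (ℕ → ℝ)} [IsProbabilityMeasure μ]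

/-- the product measure hypothesis -/
def IsProd (ν : Measure ℝ) (μ : Measure (ℕ → ℝ)) : Prop :=
  ∀ (s : Finset ℕ) (A : ℕ → Set ℝ), (∀ i, MeasurableSet (A i)) →
      μ {ω | ∀ i ∈ s, ω i ∈ A i} = ∏ i ∈ s, ν (A i)

lemma IsProd.eq (h : IsProd ν μ) : μ = Measure.infinitePi (fun _ => ν) := by
  apply Measure.eq_infinitePi
  intro s t ht
  rw [← h s t ht]
  rfl

lemma IsProd.iIndep (h : IsProd ν μ) : iIndepFun (fun (i : ℕ) (ω : ℕ → ℝ) => ω i) μ := by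
  rw [h.eq]
  exact iIndepFun_infinitePi (X := fun _ x => x) fun _ => measurable_id

lemma IsProd.eval (h : IsProd ν μ) (i : ℕ) : MeasurePreserving (fun ω : ℕ → ℝ => ω i) μ ν := by
  rw [h.eq]
  exact measurePreserving_eval_infinitePi (fun _ => ν) i

lemma measurable_shiftS : Measurable shiftS := by
  unfold shiftS
  exact measurable_pi_lambda _ fun i => measurable_pi_apply _

lemma IsProd.shift (h : IsProd ν μ) : MeasurePreserving shiftS μ μ := by
  refine ⟨measurable_shiftS, ?_⟩
  have : Measure.map shiftS μ = Measure.infinitePi (fun _ => ν) := by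
    apply Measure.eq_infinitePi
    intro s t ht
    rw [Measure.map_apply measurable_shiftS
      (MeasurableSet.pi s.countable_toSet fun i _ => ht i)]
    have e : shiftS ⁻¹' ((s : Set ℕ).pi t) =
        {ω | ∀ i ∈ s.image (· + 1), ω i ∈ t (i - 1)} := by
      ext ω
      simp [shiftS, Set.mem_pi]
    rw [e, h _ (fun i => t (i - 1)) fun i => ht _, Finset.prod_image (by intro a _ b _ hab; simpa using hab)]
    simp
  rw [this, ← h.eq]

lemma IsProd.indep_of_dep {β γ : Type*} [MeasurableSpace β] [MeasurableSpace γ]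
    (h : IsProd ν μ) (S T : Finset ℕ) (hd : Disjoint S T)
    (φ : (ℕ → ℝ) → β) (ψ : (ℕ → ℝ) → γ) (hφ : Measurable φ) (hψ : Measurable ψ)
    (hφS : ∀ ω ω', (∀ i ∈ S, ω i = ω' i) → φ ω = φ ω')
    (hψT : ∀ ω ω', (∀ i ∈ T, ω i = ω' i) → ψ ω = ψ ω') : IndepFun φ ψ μ := by
  have h1 := h.iIndep.indepFun_finset S T hd fun i => measurable_pi_apply i
  let ext : ∀ U : Finset ℕ, (U → ℝ) → ℕ → ℝ := fun U f i => if hi : i ∈ U then f ⟨i, hi⟩ else 0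
  have hext : ∀ U, Measurable (ext U) := by
    intro U
    refine measurable_pi_lambda _ fun i => ?_
    by_cases hi : i ∈ U
    · simp only [ext, hi, dite_true]; exact measurable_pi_apply _
    · simp only [ext, hi, dite_false]; exact measurable_const
  have h2 := h1.comp (hφ.comp (hext S)) (hψ.comp (hext T))
  have e1 : (φ ∘ ext S) ∘ (fun (a : ℕ → ℝ) (i : S) => a i) = φ := by
    funext ω; apply hφS; intro i hi; simp [ext, hi]
  have e2 : (ψ ∘ ext T) ∘ (fun (a : ℕ → ℝ) (i : T) => a i) = ψ := by
    funext ω; apply hψT; intro i hi; simp [ext, hi]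
  rw [e1, e2] at h2
  exact h2

lemma XB_congr (E B : ℝ) (n : ℕ) (ω ω' : ℕ → ℝ) (h : ∀ i, 1 ≤ i → i ≤ n → ω i = ω' i) :
    XB E B n ω = XB E B n ω' := by
  unfold XB
  rw [transferN_congr E _ (fun i => clampB B (ω' i)) n fun i h1 h2 => by rw [h i h1 h2]]

lemma XB_integrable (E B : ℝ) (hB : 0 ≤ B) (n : ℕ) : Integrable (XB E B n) μ := by
  refine Integrable.of_bound (measurable_XB E B n).aestronglyMeasurable (n * Real.log (|E| + B + 2))
    (ae_of_all _ fun ω => ?_)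
  rw [Real.norm_of_nonneg (XB_nonneg _ _ _ _)]
  exact XB_le E B hB n ω

lemma IsProd.slln (h : IsProd ν μ) (E B : ℝ) (hB : 0 ≤ B) (m : ℕ) :
    ∀ᵐ ω ∂μ, Tendsto (fun k : ℕ => (∑ j ∈ Finset.range k, XB E B m (shiftS^[m * j] ω)) / k) atTop
      (nhds (∫ ω, XB E B m ω ∂μ)) := by
  have hS : ∀ k, MeasurePreserving (shiftS^[k]) μ μ := fun k => h.shift.iterate k
  have := strong_law_ae_real (μ := μ) (fun j ω => XB E B m (shiftS^[m * j] ω)) ?_ ?_ ?_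
  · simpa using this
  · simpa using XB_integrable E B hB m
  · intro i j hij
    have hm : ∀ k, Measurable fun ω => XB E B m (shiftS^[m * k] ω) := fun k =>
      (measurable_XB E B m).comp (hS _).measurable
    refine h.indep_of_dep (Finset.Icc (m * i + 1) (m * i + m)) (Finset.Icc (m * j + 1) (m * j + m))
      ?_ _ _ (hm i) (hm j) ?_ ?_
    · rw [Finset.disjoint_left]
      intro a ha hb
      simp only [Finset.mem_Icc] at ha hb
      rcases lt_or_gt_of_ne hij with hl | hl
      · have := Nat.mul_le_mul_left m (Nat.succ_le_of_lt hl)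
        rw [Nat.mul_succ] at this; omega
      · have := Nat.mul_le_mul_left m (Nat.succ_le_of_lt hl)
        rw [Nat.mul_succ] at this; omega
    all_goals
      intro ω ω' hω
      simp only [shiftS_iterate]
      apply XB_congr
      intro k h1 h2
      apply hω
      simp only [Finset.mem_Icc]; omega
  · intro i
    refine ⟨?_, ?_, ?_⟩
    · exact ((measurable_XB E B m).comp (hS _).measurable).aemeasurable
    · exact ((measurable_XB E B m).comp (hS _).measurable).aemeasurable
    · have : ∀ k, Measure.map (fun ω => XB E B m (shiftS^[k] ω)) μ = Measure.map (XB E B m) μ := by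
        intro k
        have := Measure.map_map (μ := μ) (measurable_XB E B m) (hS k).measurable
        rw [(hS k).map_eq] at this
        exact this.symm
      rw [this, this]

open scoped ENNReal

/-- transition operator on functions of a vector -/
noncomputable def Pv (ν : Measure ℝ) (E : ℝ) (f : ℝ × ℝ → ℝ≥0∞) (v : ℝ × ℝ) : ℝ≥0∞ :=
  ∫⁻ x, f ((E - x) * v.1 - v.2, v.1) ∂ν

lemma measurable_Pv (E : ℝ) {f : ℝ × ℝ → ℝ≥0∞} (hf : Measurable f) : Measurable (Pv ν E f) := by
  unfold Pv
  refine Measurable.lintegral_prod_right' (f := fun p : (ℝ × ℝ) × ℝ => f ((E - p.2) * p.1.1 - p.1.2, p.1.1)) ?_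
  apply hf.comp
  fun_prop

lemma IsProd.lintegral_tv (h : IsProd ν μ) (E : ℝ) (v : ℝ × ℝ) (n : ℕ) :
    ∀ f : ℝ × ℝ → ℝ≥0∞, Measurable f → ∫⁻ ω, f (tv E v ω n) ∂μ = (Pv ν E)^[n] f v := by
  induction n with
  | zero => intro f _; simp [tv]
  | succ n ih =>
    intro f hf
    rw [Function.iterate_succ_apply, ← ih _ (measurable_Pv E hf)]
    have hi : IndepFun (fun ω : ℕ → ℝ => tv E v ω n) (fun ω => ω (n + 1)) μ := by
      refine h.indep_of_dep (Finset.Icc 1 n) {n + 1} (by simp) _ _ (measurable_tv E v n)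
        (measurable_pi_apply _) ?_ ?_
      · intro ω ω' hω
        exact tv_congr E v ω ω' n fun i h1 h2 => hω i (by simp [h1, h2])
      · intro ω ω' hω; exact hω _ (by simp)
    have hp := (indepFun_iff_map_prod_eq_prod_map_map (measurable_tv E v n).aemeasurable
      (measurable_pi_apply (n + 1)).aemeasurable).1 hi
    rw [(h.eval (n + 1)).map_eq] at hp
    let F : (ℝ × ℝ) × ℝ → ℝ≥0∞ := fun p => f ((E - p.2) * p.1.1 - p.1.2, p.1.1)
    have hF : Measurable F := hf.comp (by fun_prop)
    have e1 : ∫⁻ ω, f (tv E v ω (n + 1)) ∂μ =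
        ∫⁻ p, F p ∂(Measure.map (fun ω => (tv E v ω n, ω (n + 1))) μ) := by
      rw [lintegral_map hF ((measurable_tv E v n).prodMk (measurable_pi_apply _))]
      rfl
    rw [e1, hp, lintegral_prod _ hF.aemeasurable]
    rw [lintegral_map hF.lintegral_prod_right' (measurable_tv E v n)]
    rfl
end prodfacts

end PK5

section P6
open MeasureTheory Filter
section contr
open scoped ENNReal

lemma Kop_sq_congr (ν : Measure ℝ) [IsProbabilityMeasure ν] (E : ℝ) {h g : ℝ → ℝ≥0∞}
    (hm : Measurable h) (gm : Measurable g) (hg : h =ᵐ[volume] g) :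
    ∫⁻ s, Kop ν E h s ^ 2 = ∫⁻ s, Kop ν E g s ^ 2 := by
  rw [Kop_sq ν E hm, Kop_sq ν E gm]
  refine lintegral_congr fun x => lintegral_congr fun y => lintegral_congr_ae ?_
  have h2 : (fun s => h (s + (x - y))) =ᵐ[volume] fun s => g (s + (x - y)) :=
    (measurePreserving_add_right volume (x - y)).quasiMeasurePreserving.ae_eq_comp hg
  filter_upwards [hg, h2] with s h3 h4
  rw [h3, h4]

/-- homogeneity of degree minus one -/
def Homog (f : ℝ × ℝ → ℝ≥0∞) : Prop :=
  ∀ (c : ℝ) (v : ℝ × ℝ), c ≠ 0 → f (c * v.1, c * v.2) = ENNReal.ofReal |c|⁻¹ * f v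

lemma Homog.Pv {f : ℝ × ℝ → ℝ≥0∞} (hf : Homog f) (hm : Measurable f) (ν : Measure ℝ) (E : ℝ) :
    Homog (Pv ν E f) := by
  intro c v hc
  unfold _root_.Pv
  rw [← lintegral_const_mul' _ _ ENNReal.ofReal_ne_top]
  refine lintegral_congr fun x => ?_
  rw [← hf c _ hc]
  congr 2
  ring

lemma Pv_chart {f : ℝ × ℝ → ℝ≥0∞} (hf : Homog f) (hm : Measurable f) (ν : Measure ℝ) (E t : ℝ)
    (ht : t ≠ 0) : Pv ν E f (t, 1) = Jop (Kop ν E fun s => f (s, 1)) t := by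
  unfold Pv Jop Kop
  rw [← lintegral_const_mul' _ _ ENNReal.ofReal_ne_top]
  refine lintegral_congr fun x => ?_
  rw [← hf t _ ht]
  congr 2
  · field_simp
    ring
  · simp

lemma Pv_two {ν : Measure ℝ} [IsProbabilityMeasure ν] {f : ℝ × ℝ → ℝ≥0∞} (hf : Homog f)
    (hm : Measurable f) (E : ℝ) :
    ∫⁻ t : ℝ, Pv ν E (Pv ν E f) (t, 1) ^ 2 =
      ∫⁻ t, Jop (Kop ν E (Jop (Kop ν E fun s => f (s, 1)))) t ^ 2 := by
  have hne : ∀ᵐ t : ℝ, t ≠ 0 := by simp [ae_iff, measure_singleton]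
  have hhm : Measurable fun s : ℝ => f (s, 1) := hm.comp (by fun_prop)
  have hPm := measurable_Pv (ν := ν) E hm
  rw [Jop_norm]
  have e1 : ∫⁻ t : ℝ, Pv ν E (Pv ν E f) (t, 1) ^ 2 =
      ∫⁻ t, Jop (Kop ν E fun s => Pv ν E f (s, 1)) t ^ 2 := by
    refine lintegral_congr_ae ?_
    filter_upwards [hne] with t ht
    rw [Pv_chart (hf.Pv hm ν E) hPm ν E t ht]
  rw [e1, Jop_norm]
  refine Kop_sq_congr ν E (hPm.comp (by fun_prop)) (measurable_Jop (measurable_Kop ν E hhm)) ?_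
  filter_upwards [hne] with t ht
  exact Pv_chart hf hm ν E t ht

/-- the initial function -/
noncomputable def fz (v : ℝ × ℝ) : ℝ≥0∞ := (ENNReal.ofReal √(v.1 ^ 2 + v.2 ^ 2))⁻¹

lemma measurable_fz : Measurable fz := by unfold fz; fun_prop

lemma homog_fz : Homog fz := by
  intro c v hc
  unfold fz
  have hc' : 0 < |c| := abs_pos.2 hc
  have : √((c * v.1) ^ 2 + (c * v.2) ^ 2) = |c| * √(v.1 ^ 2 + v.2 ^ 2) := by
    rw [← Real.sqrt_sq_eq_abs, ← Real.sqrt_mul (sq_nonneg c)]; congr 1; ring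
  rw [this, ENNReal.ofReal_mul hc'.le, ENNReal.ofReal_inv_of_pos hc', ENNReal.mul_inv]
  · left; simpa using hc
  · left; simp

lemma fz_norm : ∫⁻ t : ℝ, fz (t, 1) ^ 2 ≠ ∞ := by
  have h1 : ∀ t : ℝ, fz (t, 1) ^ 2 = ENNReal.ofReal (1 + t ^ 2)⁻¹ := by
    intro t
    have hp : (0:ℝ) < 1 + t ^ 2 := by positivity
    unfold fz
    rw [← ENNReal.inv_pow, ← ENNReal.ofReal_pow (by positivity), Real.sq_sqrt (by positivity),
      ENNReal.ofReal_inv_of_pos hp]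
    congr 2; simp; ring
  simp_rw [h1]
  exact (integrable_inv_one_add_sq.lintegral_lt_top).ne

lemma Pv_iter {ν : Measure ℝ} [IsProbabilityMeasure ν] (E ρ : ℝ)
    (hρ : ∀ h : ℝ → ℝ≥0∞, Measurable h → ∫⁻ s, h s ^ 2 ≠ ∞ →
      ∫⁻ s, Jop (Kop ν E (Jop (Kop ν E h))) s ^ 2 ≤ ENNReal.ofReal ρ * ∫⁻ s, h s ^ 2) (k : ℕ) :
    Measurable ((Pv ν E)^[2 * k] fz) ∧ Homog ((Pv ν E)^[2 * k] fz) ∧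
    ∫⁻ t : ℝ, ((Pv ν E)^[2 * k] fz (t, 1)) ^ 2 ≤ ENNReal.ofReal ρ ^ k * ∫⁻ t : ℝ, fz (t, 1) ^ 2 := by
  induction k with
  | zero => exact ⟨measurable_fz, homog_fz, by simp⟩
  | succ k ih =>
    obtain ⟨h1, h2, h3⟩ := ih
    have e : (Pv ν E)^[2 * (k + 1)] fz = Pv ν E (Pv ν E ((Pv ν E)^[2 * k] fz)) := by
      rw [show 2 * (k + 1) = 2 * k + 1 + 1 by ring, Function.iterate_succ_apply',
        Function.iterate_succ_apply']
    rw [e]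
    have hm1 := measurable_Pv (ν := ν) E h1
    refine ⟨measurable_Pv E hm1, (h2.Pv h1 ν E).Pv hm1 ν E, ?_⟩
    rw [Pv_two h2 h1]
    have hfin : ∫⁻ t : ℝ, ((Pv ν E)^[2 * k] fz (t, 1)) ^ 2 ≠ ∞ :=
      (h3.trans_lt (ENNReal.mul_lt_top (ENNReal.pow_lt_top ENNReal.ofReal_lt_top) fz_norm.lt_top)).ne
    refine (hρ _ (h1.comp (by fun_prop)) hfin).trans ?_
    rw [pow_succ', mul_assoc]
    exact mul_le_mul_right h3 _

lemma small_ball {ν : Measure ℝ} [IsProbabilityMeasure ν] {μ : Measure (ℕ → ℝ)}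
    [IsProbabilityMeasure μ] (h : IsProd ν μ) (E ρ : ℝ) (hρ0 : 0 < ρ)
    (hρ : ∀ h : ℝ → ℝ≥0∞, Measurable h → ∫⁻ s, h s ^ 2 ≠ ∞ →
      ∫⁻ s, Jop (Kop ν E (Jop (Kop ν E h))) s ^ 2 ≤ ENNReal.ofReal ρ * ∫⁻ s, h s ^ 2) (k : ℕ) :
    (∫ ω, (opNorm (transferN E ω (2 * k)))⁻¹ ∂μ) ^ 2 ≤
      4 * (∫⁻ t : ℝ, fz (t, 1) ^ 2).toReal * ρ ^ k := by
  obtain ⟨h1, -, h3⟩ := Pv_iter E ρ hρ k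
  have hTp : ∀ ω, 0 < opNorm (transferN E ω (2 * k)) := fun ω =>
    one_pos.trans_le (one_le_opNorm_transferN E ω (2 * k))
  have hTm : Measurable fun ω => (opNorm (transferN E ω (2 * k)))⁻¹ :=
    (continuous_opNorm.comp (continuous_transferN E (2 * k))).measurable.inv
  set z := ∫ ω, (opNorm (transferN E ω (2 * k)))⁻¹ ∂μ with hz
  have hzi : Integrable (fun ω => (opNorm (transferN E ω (2 * k)))⁻¹) μ := by
    refine Integrable.of_bound hTm.aestronglyMeasurable 1 (ae_of_all _ fun ω => ?_)
    rw [Real.norm_of_nonneg (inv_nonneg.2 (hTp ω).le)]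
    exact inv_le_one_of_one_le₀ (one_le_opNorm_transferN E ω (2 * k))
  have hz0 : 0 ≤ z := integral_nonneg fun ω => inv_nonneg.2 (hTp ω).le
  have hzl : ENNReal.ofReal (z / 2) =
      ∫⁻ ω, ENNReal.ofReal ((opNorm (transferN E ω (2 * k)))⁻¹ / 2) ∂μ := by
    rw [hz, ← integral_div, ofReal_integral_eq_lintegral_ofReal (hzi.div_const 2)
      (ae_of_all _ fun ω => div_nonneg (inv_nonneg.2 (hTp ω).le) two_pos.le)]
  have key : ∀ t ∈ Set.Icc (0:ℝ) 1, ENNReal.ofReal (z / 2) ≤ (Pv ν E)^[2 * k] fz (t, 1) := by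
    intro t ht
    rw [← h.lintegral_tv E (t, 1) (2 * k) fz measurable_fz, hzl]
    refine lintegral_mono fun ω => ?_
    unfold fz
    have h4 := tv_norm E (t, 1) ω (2 * k)
    have h5 : √(t ^ 2 + 1 ^ 2) ≤ 2 := by
      rw [Real.sqrt_le_left two_pos.le]; nlinarith [ht.1, ht.2]
    have h6 : √((tv E (t, 1) ω (2 * k)).1 ^ 2 + (tv E (t, 1) ω (2 * k)).2 ^ 2) ≤
        opNorm (transferN E ω (2 * k)) * 2 :=
      h4.trans (mul_le_mul_of_nonneg_left h5 (hTp ω).le)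
    have h7 : (opNorm (transferN E ω (2 * k)))⁻¹ / 2 = (opNorm (transferN E ω (2 * k)) * 2)⁻¹ := by
      rw [mul_inv]; rfl
    rw [h7, ENNReal.ofReal_inv_of_pos (mul_pos (hTp ω) two_pos)]
    exact ENNReal.inv_le_inv.2 (ENNReal.ofReal_le_ofReal h6)
  have h8 : ENNReal.ofReal (z / 2) ^ 2 ≤ ∫⁻ t : ℝ, ((Pv ν E)^[2 * k] fz (t, 1)) ^ 2 := by
    calc ENNReal.ofReal (z / 2) ^ 2 = ∫⁻ t in Set.Icc (0:ℝ) 1, ENNReal.ofReal (z / 2) ^ 2 := by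
          rw [setLIntegral_const]; simp
      _ ≤ ∫⁻ t in Set.Icc (0:ℝ) 1, ((Pv ν E)^[2 * k] fz (t, 1)) ^ 2 := by
          refine setLIntegral_mono' measurableSet_Icc fun t ht => ?_
          gcongr
          exact key t ht
      _ ≤ _ := setLIntegral_le_lintegral _ _
  have h9 := h8.trans h3
  rw [← ENNReal.ofReal_toReal fz_norm, ← ENNReal.ofReal_pow hρ0.le, ← ENNReal.ofReal_mul (by positivity),
    ← ENNReal.ofReal_pow (by positivity), ENNReal.ofReal_le_ofReal_iff (by positivity)] at h9
  nlinarith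

lemma log_lower {ν : Measure ℝ} [IsProbabilityMeasure ν] {μ : Measure (ℕ → ℝ)}
    [IsProbabilityMeasure μ] (h : IsProd ν μ) (E B ρ : ℝ) (hB0 : 0 ≤ B)
    (hB : ∀ᵐ x ∂ν, |x| ≤ B) (hρ0 : 0 < ρ)
    (hρ : ∀ h : ℝ → ℝ≥0∞, Measurable h → ∫⁻ s, h s ^ 2 ≠ ∞ →
      ∫⁻ s, Jop (Kop ν E (Jop (Kop ν E h))) s ^ 2 ≤ ENNReal.ofReal ρ * ∫⁻ s, h s ^ 2) :
    ∃ K : ℝ, ∀ k : ℕ, (-Real.log ρ / 2) * k - K ≤ ∫ ω, XB E B (2 * k) ω ∂μ := by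
  set N := (∫⁻ t : ℝ, fz (t, 1) ^ 2).toReal with hN
  have hN0 : 0 ≤ N := ENNReal.toReal_nonneg
  refine ⟨√(4 * N), fun k => ?_⟩
  have hs := small_ball h E ρ hρ0 hρ k
  rw [← hN] at hs
  have hae : ∀ᵐ ω ∂μ, ∀ i, |ω i| ≤ B := by
    rw [ae_all_iff]; intro i
    exact (h.eval i).quasiMeasurePreserving.ae hB
  have hTp : ∀ ω, 0 < opNorm (transferN E ω (2 * k)) := fun ω =>
    one_pos.trans_le (one_le_opNorm_transferN E ω (2 * k))
  have hTm : Measurable fun ω => (opNorm (transferN E ω (2 * k)))⁻¹ :=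
    (continuous_opNorm.comp (continuous_transferN E (2 * k))).measurable.inv
  set z := ∫ ω, (opNorm (transferN E ω (2 * k)))⁻¹ ∂μ with hz
  have hzi : Integrable (fun ω => (opNorm (transferN E ω (2 * k)))⁻¹) μ := by
    refine Integrable.of_bound hTm.aestronglyMeasurable 1 (ae_of_all _ fun ω => ?_)
    rw [Real.norm_of_nonneg (inv_nonneg.2 (hTp ω).le)]
    exact inv_le_one_of_one_le₀ (one_le_opNorm_transferN E ω (2 * k))
  have hz0 : 0 ≤ z := integral_nonneg fun ω => inv_nonneg.2 (hTp ω).le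
  set l := -Real.log ρ / 2 * k with hl
  have hexp : Real.exp l ^ 2 * ρ ^ k = 1 := by
    have : ρ ^ k = Real.exp (Real.log ρ * k) := by
      rw [mul_comm, Real.exp_nat_mul, Real.exp_log hρ0]
    rw [this, ← Real.exp_nat_mul, ← Real.exp_add, Real.exp_eq_one_iff, hl]
    push_cast; ring
  have hez : Real.exp l * z ≤ √(4 * N) := by
    apply Real.le_sqrt_of_sq_le
    rw [mul_pow]
    calc Real.exp l ^ 2 * z ^ 2 ≤ Real.exp l ^ 2 * (4 * N * ρ ^ k) := by gcongr
      _ = 4 * N * (Real.exp l ^ 2 * ρ ^ k) := by ring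
      _ = _ := by rw [hexp, mul_one]
  have hpt : ∀ᵐ ω ∂μ, l + 1 - Real.exp l * (opNorm (transferN E ω (2 * k)))⁻¹ ≤ XB E B (2 * k) ω := by
    filter_upwards [hae] with ω hω
    have e : (fun i => clampB B (ω i)) = ω := by
      funext i; exact clampB_eq B _ (hω i)
    unfold XB
    rw [e]
    have := Real.add_one_le_exp (l - Real.log (opNorm (transferN E ω (2 * k))))
    rw [Real.exp_sub, Real.exp_log (hTp ω), div_eq_mul_inv] at this
    linarith
  have hIntg := integral_mono_ae ((integrable_const (l + 1)).sub (hzi.const_mul (Real.exp l)))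
    (XB_integrable E B hB0 (2 * k)) hpt
  have e2 : ∫ ω, (l + 1 - Real.exp l * (opNorm (transferN E ω (2 * k)))⁻¹) ∂μ = l + 1 - Real.exp l * z := by
    rw [integral_sub (integrable_const _) (hzi.const_mul _), integral_const_mul]; simp [hz]
  have hIntg' : l + 1 - Real.exp l * z ≤ ∫ ω, XB E B (2 * k) ω ∂μ := by
    rw [← e2]; exact hIntg
  linarith
end contr

section fin
lemma supp_bound (ν : Measure ℝ) (hc : IsCompact (msupp ν)) : ∃ B, 0 ≤ B ∧ ∀ᵐ x ∂ν, |x| ≤ B := by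
  obtain ⟨B, hB⟩ := hc.isBounded.exists_norm_le
  have h0 : ν (msupp ν)ᶜ = 0 := by
    apply measure_null_of_locally_null
    intro x hx
    simp only [msupp, Set.mem_compl_iff, Set.mem_ofPred_eq, not_forall, not_not] at hx
    obtain ⟨U, hU, hU0⟩ := hx
    exact ⟨U, mem_nhdsWithin_of_mem_nhds hU, hU0⟩
  refine ⟨max B 0, le_max_right _ _, ?_⟩
  have : ∀ᵐ x ∂ν, x ∈ msupp ν := by rw [ae_iff]; exact h0
  filter_upwards [this] with x hx
  exact (hB x hx).trans (le_max_left _ _)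

lemma var_pos (ν : Measure ℝ) [IsProbabilityMeasure ν] (B : ℝ) (hB : ∀ᵐ x ∂ν, |x| ≤ B)
    (h2 : ∃ a b : ℝ, a ∈ msupp ν ∧ b ∈ msupp ν ∧ a ≠ b) :
    0 < ∫ x, ∫ y, (x - y) ^ 2 ∂ν ∂ν := by
  have hBB : ∀ x y : ℝ, |x| ≤ B → |y| ≤ B → (x - y) ^ 2 ≤ (2 * B) ^ 2 := by
    intro x y hx hy
    rw [abs_le] at hx hy
    exact sq_le_sq' (by linarith) (by linarith)
  have hi1 : ∀ x : ℝ, |x| ≤ B → Integrable (fun y => (x - y) ^ 2) ν := by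
    intro x hx
    refine Integrable.of_bound (by fun_prop) ((2 * B) ^ 2) ?_
    filter_upwards [hB] with y hy
    rw [Real.norm_of_nonneg (sq_nonneg _)]
    exact hBB x y hx hy
  have hnn : ∀ x : ℝ, 0 ≤ ∫ y, (x - y) ^ 2 ∂ν := fun x => integral_nonneg fun y => sq_nonneg _
  have hi2 : Integrable (fun x => ∫ y, (x - y) ^ 2 ∂ν) ν := by
    refine Integrable.of_bound ?_ ((2 * B) ^ 2) ?_
    · have : StronglyMeasurable (fun p : ℝ × ℝ => (p.1 - p.2) ^ 2) :=
        (by fun_prop : Continuous fun p : ℝ × ℝ => (p.1 - p.2) ^ 2).stronglyMeasurable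
      exact this.integral_prod_right'.aestronglyMeasurable
    · filter_upwards [hB] with x hx
      rw [Real.norm_of_nonneg (hnn x)]
      calc ∫ y, (x - y) ^ 2 ∂ν ≤ ∫ y, (2 * B) ^ 2 ∂ν := by
            refine integral_mono_ae (hi1 x hx) (integrable_const _) ?_
            filter_upwards [hB] with y hy
            exact hBB x y hx hy
        _ = _ := by simp
  refine lt_of_le_of_ne (integral_nonneg hnn) fun h0 => ?_
  have h3 := (integral_eq_zero_iff_of_nonneg hnn hi2).1 h0.symm
  obtain ⟨x, hx, hx0⟩ := (hB.and h3).exists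
  have h4 := (integral_eq_zero_iff_of_nonneg (fun y => sq_nonneg _) (hi1 x hx)).1 hx0
  have h5 : ν {x}ᶜ = 0 := by
    have : ∀ᵐ y ∂ν, y = x := by
      filter_upwards [h4] with y hy
      simp only [Pi.zero_apply] at hy
      have := pow_eq_zero_iff (two_ne_zero) |>.1 hy
      linarith
    exact this
  have h6 : ∀ a ∈ msupp ν, a = x := by
    intro a ha
    by_contra hax
    exact ha _ (isOpen_compl_singleton.mem_nhds hax) h5
  obtain ⟨a, b, ha, hb, hab⟩ := h2
  exact hab ((h6 a ha).trans (h6 b hb).symm)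
end fin


end P6

/-- **Positivity of the Lyapunov exponent for the one-dimensional Anderson model
(Fürstenberg).** Let `ν` be a probability measure on `ℝ` whose support is compact and has at
least two points, and let `μ = ν^ℕ` be the product measure on sequences (characterized by its
values on cylinder sets). Fix `E ∈ ℝ`. Then there is `γ(E) > 0` such that for `μ`-almost
every `ω`, `(1/n) log ‖A_E(ω_n) ⋯ A_E(ω_1)‖ → γ(E)` as `n → ∞`. -/
theorem anderson_lyapunov_positive
    (ν : Measure ℝ) [IsProbabilityMeasure ν]
    (hsupp_compact : IsCompact (msupp ν))
    (hsupp_two : ∃ a b : ℝ, a ∈ msupp ν ∧ b ∈ msupp ν ∧ a ≠ b)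
    (μ : Measure (ℕ → ℝ)) [IsProbabilityMeasure μ]
    (hμ : ∀ (s : Finset ℕ) (A : ℕ → Set ℝ), (∀ i, MeasurableSet (A i)) →
      μ {ω | ∀ i ∈ s, ω i ∈ A i} = ∏ i ∈ s, ν (A i))
    (E : ℝ) :
    ∃ γ : ℝ, 0 < γ ∧
      ∀ᵐ ω ∂μ, Tendsto (fun n : ℕ => (1 / (n : ℝ)) * Real.log (opNorm (transferN E ω n)))
        atTop (nhds γ) := by
  have hP : IsProd ν μ := hμ
  obtain ⟨B, hB0, hB⟩ := supp_bound ν hsupp_compact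
  have hv := var_pos ν B hB hsupp_two
  obtain ⟨ρ, hρ0, hρ1, hρ⟩ := two_step ν E B hB _ rfl hv
  obtain ⟨K, hK⟩ := log_lower hP E B ρ hB0 hB hρ0 hρ
  obtain ⟨γ, hγ, hlim⟩ := kingman_abs (X := XB E B) (C := Real.log (|E| + B + 2)) hP.shift
    (measurable_XB E B) (XB_nonneg E B) (XB_le E B hB0) (XB_sub E B) (XB_inv E B hB0)
    (fun m _ => hP.slln E B hB0 m) (-Real.log ρ / 2) K
    (by have := Real.log_neg hρ0 hρ1; linarith) hK
  refine ⟨γ, hγ, ?_⟩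
  have hae : ∀ᵐ ω ∂μ, ∀ i, |ω i| ≤ B := by
    rw [ae_all_iff]; intro i
    exact (hP.eval i).quasiMeasurePreserving.ae hB
  filter_upwards [hlim, hae] with ω h1 hω
  have e : (fun i => clampB B (ω i)) = ω := by
    funext i; exact clampB_eq B _ (hω i)
  simpa only [XB, e] using h1
end
end
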